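/- There exist a threshold q₀ and a constant c > 0 such that for every group Γ, all integers d > k ≥ 2, every prime power q ≥ q₀, and every (possibly empty) face s of B(2d,S_k,q) with 2k+1 − |s| ≥ 3, the following holds: for every Γ-valued 1-cochain f on the link of s there exists g from the link's vertices to Γ with c·dist(f,δg) ≤ wt(δf). In particular, taking s = ∅, the complex B(2d,S_k,q) itself is a 1-coboundary expander with expansion at least c with respect to every group. -/

import Mathlib

open Finset
open scoped Classical

noncomputable instance (F : Type) [Field F] [Fintype F] (n : ℕ) :
    Fintype (Submodule F (Fin n → F)) :=
  Fintype.ofInjective (fun W => (W : Set (Fin n → F)))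
    fun _ _ h => SetLike.coe_injective h

/-- A face of the projected flags complex `B(n,S,q)`: a finite chain of subspaces of `F^n`
whose dimensions all lie in `S`. -/
def IsFlagFace (F : Type) [Field F] [Fintype F] (n : ℕ) (S : Finset ℕ)
    (s : Finset (Submodule F (Fin n → F))) : Prop :=
  IsChain (· ≤ ·) (s : Set (Submodule F (Fin n → F))) ∧
    ∀ W ∈ s, Module.finrank F W ∈ S

/-- A maximal face of `B(n,S,q)`: a chain containing one subspace of each dimension in `S`. -/
def IsMaxFlagFace (F : Type) [Field F] [Fintype F] (n : ℕ) (S : Finset ℕ)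
    (T : Finset (Submodule F (Fin n → F))) : Prop :=
  IsFlagFace F n S T ∧ ∀ i ∈ S, ∃ W ∈ T, Module.finrank F W = i

/-- The maximal faces of `B(n,S,q)` containing a given face `s`. -/
noncomputable def maxFacesAbove (F : Type) [Field F] [Fintype F] (n : ℕ) (S : Finset ℕ)
    (s : Finset (Submodule F (Fin n → F))) : Finset (Finset (Submodule F (Fin n → F))) :=
  Finset.univ.filter fun T => IsMaxFlagFace F n S T ∧ s ⊆ T

/-- `wt(δf) = Pr_{{u,v,w} ∼ π₂}[δf(u,v,w) ≠ 1]` for the link of `s`, where `π₂` samples a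
uniformly random maximal face `T ⊇ s` and then a uniformly random 3-element subset of
`T ∖ s`. -/
noncomputable def linkWt (F : Type) [Field F] [Fintype F] (n : ℕ) (S : Finset ℕ)
    (s : Finset (Submodule F (Fin n → F))) (Γ : Type) [Group Γ]
    (f : Submodule F (Fin n → F) → Submodule F (Fin n → F) → Γ) : ℝ :=
  (∑ T ∈ maxFacesAbove F n S s,
      (∑ e ∈ (T \ s).powersetCard 3,
          if ∃ u ∈ e, ∃ v ∈ e, ∃ w ∈ e, u ≠ v ∧ v ≠ w ∧ u ≠ w ∧
              f u v * f v w * f w u ≠ 1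
          then (1 : ℝ) else 0) / (((T \ s).powersetCard 3).card : ℝ)) /
    ((maxFacesAbove F n S s).card : ℝ)

/-- `dist(f, δg) = Pr_{{u,v} ∼ π₁}[f(u,v) ≠ g(u)·g(v)⁻¹]` for the link of `s`, where `π₁`
samples a uniformly random maximal face `T ⊇ s` and then a uniformly random 2-element
subset of `T ∖ s`. -/
noncomputable def linkDist (F : Type) [Field F] [Fintype F] (n : ℕ) (S : Finset ℕ)
    (s : Finset (Submodule F (Fin n → F))) (Γ : Type) [Group Γ]
    (f : Submodule F (Fin n → F) → Submodule F (Fin n → F) → Γ)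
    (g : Submodule F (Fin n → F) → Γ) : ℝ :=
  (∑ T ∈ maxFacesAbove F n S s,
      (∑ e ∈ (T \ s).powersetCard 2,
          if ∃ u ∈ e, ∃ v ∈ e, u ≠ v ∧ f u v ≠ g u * (g v)⁻¹
          then (1 : ℝ) else 0) / (((T \ s).powersetCard 2).card : ℝ)) /
    ((maxFacesAbove F n S s).card : ℝ)

/-! ### Averages, conditioning, covariance -/

namespace CB

/-- Average of `φ` over the finite set `Ω`. -/
noncomputable def ex {X : Type} (Ω : Finset X) (φ : X → ℝ) : ℝ :=
  (∑ ω ∈ Ω, φ ω) / (Ω.card : ℝ)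

/-- Conditioning `Ω` on the event `y = a`. -/
noncomputable def cnd {X V : Type} (Ω : Finset X) (y : X → V) (a : V) : Finset X :=
  Ω.filter fun ω => y ω = a

/-- Indicator of a proposition. -/
noncomputable def ind (p : Prop) : ℝ := if p then 1 else 0

/-- Probability of an event. -/
noncomputable def pr {X : Type} (Ω : Finset X) (p : X → Prop) : ℝ := ex Ω fun ω => ind (p ω)

section basic
variable {X V W : Type} {Ω : Finset X}

lemma ind_nonneg (p : Prop) : 0 ≤ ind p := by unfold ind; split_ifs <;> norm_num
lemma ind_le_one (p : Prop) : ind p ≤ 1 := by unfold ind; split_ifs <;> norm_num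
lemma ind_true {p : Prop} (h : p) : ind p = 1 := by simp [ind, h]
lemma ind_false {p : Prop} (h : ¬ p) : ind p = 0 := by simp [ind, h]
lemma ind_mono {p q : Prop} (h : p → q) : ind p ≤ ind q := by
  by_cases h1 : p
  · rw [ind_true h1, ind_true (h h1)]
  · rw [ind_false h1]; exact ind_nonneg _
lemma ind_or_le (p q : Prop) : ind (p ∨ q) ≤ ind p + ind q := by
  unfold ind; by_cases h1 : p <;> by_cases h2 : q <;> simp [h1, h2]
lemma ind_sq (p : Prop) : ind p * ind p = ind p := by unfold ind; split_ifs <;> norm_num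

lemma ex_mono {φ ψ : X → ℝ} (h : ∀ ω ∈ Ω, φ ω ≤ ψ ω) : ex Ω φ ≤ ex Ω ψ := by
  unfold ex; gcongr with i hi; exact h i hi
lemma ex_congr {φ ψ : X → ℝ} (h : ∀ ω ∈ Ω, φ ω = ψ ω) : ex Ω φ = ex Ω ψ := by
  unfold ex; rw [Finset.sum_congr rfl h]
lemma ex_add (φ ψ : X → ℝ) : ex Ω (fun ω => φ ω + ψ ω) = ex Ω φ + ex Ω ψ := by
  unfold ex; rw [Finset.sum_add_distrib, add_div]
lemma ex_sub (φ ψ : X → ℝ) : ex Ω (fun ω => φ ω - ψ ω) = ex Ω φ - ex Ω ψ := by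
  unfold ex; rw [Finset.sum_sub_distrib, sub_div]
lemma ex_mul_left (c : ℝ) (φ : X → ℝ) : ex Ω (fun ω => c * φ ω) = c * ex Ω φ := by
  unfold ex; rw [← Finset.mul_sum, mul_div_assoc]
lemma ex_mul_right (c : ℝ) (φ : X → ℝ) : ex Ω (fun ω => φ ω * c) = ex Ω φ * c := by
  unfold ex; rw [← Finset.sum_mul]; ring
lemma ex_const (h : Ω.Nonempty) (c : ℝ) : ex Ω (fun _ => c) = c := by
  unfold ex; rw [Finset.sum_const, nsmul_eq_mul]
  have : (Ω.card : ℝ) ≠ 0 := by exact_mod_cast h.card_pos.ne'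
  field_simp
lemma ex_empty (φ : X → ℝ) : ex (∅ : Finset X) φ = 0 := by simp [ex]
lemma ex_nonneg {φ : X → ℝ} (h : ∀ ω ∈ Ω, 0 ≤ φ ω) : 0 ≤ ex Ω φ := by
  unfold ex; exact div_nonneg (Finset.sum_nonneg h) (by positivity)
lemma ex_sum {κ : Type} (s : Finset κ) (φ : κ → X → ℝ) :
    ex Ω (fun ω => ∑ c ∈ s, φ c ω) = ∑ c ∈ s, ex Ω (φ c) := by
  unfold ex; rw [Finset.sum_comm, Finset.sum_div]
lemma exists_le_ex (h : Ω.Nonempty) (φ : X → ℝ) : ∃ ω ∈ Ω, φ ω ≤ ex Ω φ := by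
  by_contra hc
  push Not at hc
  have h1 : ex Ω (fun _ => ex Ω φ) = ex Ω φ := ex_const h _
  have h2 : ∑ ω ∈ Ω, ex Ω φ < ∑ ω ∈ Ω, φ ω := Finset.sum_lt_sum_of_nonempty h hc
  have h3 : (0 : ℝ) < Ω.card := by exact_mod_cast h.card_pos
  have : ex Ω (fun _ => ex Ω φ) < ex Ω φ := by
    unfold ex at *
    exact div_lt_div_of_pos_right h2 h3
  linarith

lemma pr_nonneg (p : X → Prop) : 0 ≤ pr Ω p := ex_nonneg fun _ _ => ind_nonneg _
lemma pr_le_one (p : X → Prop) : pr Ω p ≤ 1 := by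
  rcases Ω.eq_empty_or_nonempty with rfl | h
  · simp [pr, ex_empty]
  · calc pr Ω p ≤ ex Ω (fun _ => 1) := ex_mono fun _ _ => ind_le_one _
      _ = 1 := ex_const h 1
lemma pr_mono {p q : X → Prop} (h : ∀ ω ∈ Ω, p ω → q ω) : pr Ω p ≤ pr Ω q :=
  ex_mono fun ω hω => ind_mono (h ω hω)
lemma pr_congr {p q : X → Prop} (h : ∀ ω ∈ Ω, (p ω ↔ q ω)) : pr Ω p = pr Ω q :=
  le_antisymm (pr_mono fun ω hω => (h ω hω).1) (pr_mono fun ω hω => (h ω hω).2)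
lemma pr_or (p q : X → Prop) : pr Ω (fun ω => p ω ∨ q ω) ≤ pr Ω p + pr Ω q := by
  unfold pr; rw [← ex_add]; exact ex_mono fun _ _ => ind_or_le _ _
lemma pr_le_of_imp_or {p q r : X → Prop} (h : ∀ ω ∈ Ω, p ω → q ω ∨ r ω) :
    pr Ω p ≤ pr Ω q + pr Ω r := (pr_mono h).trans (pr_or _ _)
lemma pr_eq_zero {p : X → Prop} (h : pr Ω p = 0) : ∀ ω ∈ Ω, ¬ p ω := by
  intro ω hω hp
  unfold pr ex at h
  have hc : (0 : ℝ) < Ω.card := by exact_mod_cast Finset.card_pos.2 ⟨ω, hω⟩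
  rw [div_eq_zero_iff] at h
  rcases h with h | h
  · have := (Finset.sum_eq_zero_iff_of_nonneg (fun i _ => ind_nonneg (p i))).1 h ω hω
    rw [ind_true hp] at this; norm_num at this
  · linarith

lemma mem_cnd {y : X → V} {a : V} {ω : X} : ω ∈ cnd Ω y a ↔ ω ∈ Ω ∧ y ω = a := by
  simp [cnd]
lemma self_mem_cnd {y : X → V} {ω : X} (h : ω ∈ Ω) : ω ∈ cnd Ω y (y ω) := by
  simp [cnd, h]
lemma cnd_comm (y : X → V) (z : X → W) (a : V) (b : W) :
    cnd (cnd Ω y a) z b = cnd (cnd Ω z b) y a := by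
  ext ω; simp [mem_cnd]; tauto

lemma ex_tower (y : X → V) (φ : X → ℝ) :
    ex Ω (fun ω => ex (cnd Ω y (y ω)) φ) = ex Ω φ := by
  unfold ex
  congr 1
  have h1 : ∀ ω ∈ Ω, (∑ ω' ∈ cnd Ω y (y ω), φ ω') / ((cnd Ω y (y ω)).card : ℝ)
      = ∑ ω' ∈ Ω, if y ω' = y ω then φ ω' / ((cnd Ω y (y ω')).card : ℝ) else 0 := by
    intro ω _
    rw [Finset.sum_div, cnd, Finset.sum_filter]
    refine Finset.sum_congr rfl fun ω' _ => ?_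
    split_ifs with h
    · rw [← h]; rfl
    · rfl
  rw [Finset.sum_congr rfl h1, Finset.sum_comm]
  refine Finset.sum_congr rfl fun ω' hω' => ?_
  have h2 : ∀ ω ∈ Ω, (if y ω' = y ω then φ ω' / ((cnd Ω y (y ω')).card : ℝ) else 0)
     = if y ω = y ω' then φ ω' / ((cnd Ω y (y ω')).card : ℝ) else 0 := by
    intro ω _; simp only [eq_comm]
  rw [Finset.sum_congr rfl h2, ← Finset.sum_filter, Finset.sum_const, nsmul_eq_mul]
  have hc : ((cnd Ω y (y ω')).card : ℝ) ≠ 0 := by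
    exact_mod_cast (Finset.card_pos.2 ⟨ω', self_mem_cnd hω'⟩).ne'
  change ((cnd Ω y (y ω')).card : ℝ) * _ = _
  field_simp

/-- Tower property, the integrand being allowed to depend on the value conditioned on. -/
lemma ex_tower' (y : X → V) (φ : V → X → ℝ) :
    ex Ω (fun ω => ex (cnd Ω y (y ω)) (φ (y ω))) = ex Ω (fun ω => φ (y ω) ω) := by
  rw [← ex_tower y (fun ω => φ (y ω) ω)]
  refine ex_congr fun ω _ => ex_congr fun ω' hω' => ?_
  rw [(mem_cnd.1 hω').2]

lemma ex_cnd_dep {y : X → V} {a : V} (φ : V → X → ℝ) :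
    ex (cnd Ω y a) (fun ω => φ (y ω) ω) = ex (cnd Ω y a) (φ a) :=
  ex_congr fun ω hω => by rw [(mem_cnd.1 hω).2]

/-- Covariance. -/
noncomputable def cov (Ω : Finset X) (φ ψ : X → ℝ) : ℝ :=
  ex Ω (fun ω => φ ω * ψ ω) - ex Ω φ * ex Ω ψ

lemma var_nonneg (φ : X → ℝ) : 0 ≤ cov Ω φ φ := by
  rcases Ω.eq_empty_or_nonempty with rfl | h
  · simp [cov, ex_empty]
  · have h1 : 0 ≤ ex Ω (fun ω => (φ ω - ex Ω φ) * (φ ω - ex Ω φ)) :=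
      ex_nonneg fun ω _ => mul_self_nonneg _
    have h2 : ex Ω (fun ω => (φ ω - ex Ω φ) * (φ ω - ex Ω φ)) = cov Ω φ φ := by
      have : (fun ω => (φ ω - ex Ω φ) * (φ ω - ex Ω φ)) =
        fun ω => (φ ω * φ ω - (2 * ex Ω φ) * φ ω) + ex Ω φ * ex Ω φ := by
        funext ω; ring
      rw [this, ex_add, ex_sub, ex_mul_left, ex_const h]; unfold cov; ring
    linarith

lemma cov_eq_centered (h : Ω.Nonempty) (φ ψ : X → ℝ) (c d : ℝ) :
    cov Ω φ ψ = cov Ω (fun ω => φ ω - c) (fun ω => ψ ω - d) := by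
  have : (fun ω => (φ ω - c) * (ψ ω - d)) =
        fun ω => (φ ω * ψ ω - c * ψ ω) - (d * φ ω - c * d) := by
    funext ω; ring
  unfold cov
  rw [this, ex_sub, ex_sub, ex_sub, ex_sub, ex_sub, ex_mul_left, ex_mul_left, ex_const h,
    ex_const h, ex_const h]; ring

lemma cov_total (y : X → V) (φ ψ : X → ℝ) :
    cov Ω φ ψ = cov Ω (fun ω => ex (cnd Ω y (y ω)) φ) (fun ω => ex (cnd Ω y (y ω)) ψ)
      + ex Ω (fun ω => cov (cnd Ω y (y ω)) φ ψ) := by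
  unfold cov
  rw [ex_sub, ex_tower, ex_tower, ex_tower]; ring

lemma cov_comm (φ ψ : X → ℝ) : cov Ω φ ψ = cov Ω ψ φ := by
  unfold cov; rw [mul_comm (ex Ω φ)]; simp only [mul_comm]

lemma cov_smul_left (c : ℝ) (φ ψ : X → ℝ) : cov Ω (fun ω => c * φ ω) ψ = c * cov Ω φ ψ := by
  unfold cov; rw [ex_mul_left]; simp only [mul_assoc]; rw [ex_mul_left]; ring

lemma cov_const_right (φ ψ : X → ℝ) (c : ℝ) (hc : ∀ ω ∈ Ω, ψ ω = c) : cov Ω φ ψ = 0 := by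
  rcases Ω.eq_empty_or_nonempty with rfl | h
  · simp [cov, ex_empty]
  · unfold cov
    have h1 : ex Ω (fun ω => φ ω * ψ ω) = ex Ω (fun ω => φ ω * c) :=
      ex_congr fun ω hω => by rw [hc ω hω]
    have h2 : ex Ω ψ = c := by rw [ex_congr hc, ex_const h]
    rw [h1, h2, ex_mul_right]; ring

/-- `Z` is decorrelated from functions of `y`. -/
def Dec (Ω : Finset X) (y : X → V) (Z : X → ℝ) (l : ℝ) : Prop :=
  ∀ h : V → ℝ, 2 * cov Ω (fun ω => h (y ω)) Z ≤
    l * (cov Ω (fun ω => h (y ω)) (fun ω => h (y ω)) + cov Ω Z Z)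

/-- The pair `(y,z)` is an `l`-expanding bipartite graph. -/
def PE (Ω : Finset X) (y : X → V) (z : X → W) (l : ℝ) : Prop :=
  ∀ k : W → ℝ, Dec Ω y (fun ω => k (z ω)) l

lemma PE.symm {y : X → V} {z : X → W} {l : ℝ} (h : PE Ω y z l) : PE Ω z y l := by
  intro k h'
  have := h h' k
  rw [cov_comm, add_comm]; exact this

lemma PE.mono {y : X → V} {z : X → W} {l l' : ℝ} (h : PE Ω y z l) (hl : l ≤ l') :
    PE Ω y z l' := fun k h' => (h k h').trans
  (mul_le_mul_of_nonneg_right hl (add_nonneg (var_nonneg _) (var_nonneg _)))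

lemma PE_of_indep {y : X → V} {z : X → W} {l : ℝ} (hl : 0 ≤ l)
    (h : ∀ (h : V → ℝ) (k : W → ℝ), cov Ω (fun ω => h (y ω)) (fun ω => k (z ω)) = 0) :
    PE Ω y z l := fun k h' => by
  rw [h h' k]
  have := mul_nonneg hl (add_nonneg (var_nonneg (Ω := Ω) (fun ω => h' (y ω)))
    (var_nonneg (Ω := Ω) (fun ω => k (z ω))))
  linarith

lemma Dec_const {y : X → V} {Z : X → ℝ} {c : ℝ} (hc : ∀ ω ∈ Ω, Z ω = c) : Dec Ω y Z 0 := by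
  intro h; rw [cov_const_right _ _ c hc]; simp

lemma Dec_tower {y : X → V} {z : X → W} {Z : X → ℝ} {l m : ℝ} (hl : 0 ≤ l) (hm : 0 ≤ m)
    (h1 : PE Ω y z l) (h2 : ∀ a, Dec (cnd Ω z a) y Z m) : Dec Ω y Z (l + m) := by
  intro h
  set H : X → ℝ := fun ω => h (y ω) with hH
  set E : W → ℝ := fun a => ex (cnd Ω z a) Z with hE
  have e1 : cov Ω H Z = cov Ω H (fun ω => E (z ω)) + ex Ω (fun ω => cov (cnd Ω z (z ω)) H Z) := by
    have a1 := cov_total (Ω := Ω) z H Z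
    have a2 := cov_total (Ω := Ω) z H (fun ω => E (z ω))
    have a3 : ex Ω (fun ω => cov (cnd Ω z (z ω)) H (fun ω => E (z ω))) = 0 := by
      rw [ex_congr (ψ := fun _ => (0 : ℝ))]
      · rcases Ω.eq_empty_or_nonempty with rfl | h
        · exact ex_empty _
        · exact ex_const h 0
      · intro ω _
        exact cov_const_right _ _ (E (z ω)) fun ω' hω' => by rw [(mem_cnd.1 hω').2]
    have a4 : cov Ω (fun ω => ex (cnd Ω z (z ω)) H)
        (fun ω => ex (cnd Ω z (z ω)) (fun ω => E (z ω))) =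
        cov Ω (fun ω => ex (cnd Ω z (z ω)) H) (fun ω => ex (cnd Ω z (z ω)) Z) := by
      unfold cov
      have : ∀ ω ∈ Ω, ex (cnd Ω z (z ω)) (fun ω => E (z ω)) = ex (cnd Ω z (z ω)) Z := by
        intro ω hω
        rw [ex_congr (ψ := fun _ => E (z ω))]
        · exact ex_const ⟨ω, self_mem_cnd hω⟩ _
        · intro ω' hω'; rw [(mem_cnd.1 hω').2]
      rw [ex_congr this]
      congr 1
      exact ex_congr fun ω hω => by beta_reduce; rw [this ω hω]
    rw [a1, a2, a3, a4]; ring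
  have e2 : cov Ω Z Z = cov Ω (fun ω => E (z ω)) (fun ω => E (z ω)) +
      ex Ω (fun ω => cov (cnd Ω z (z ω)) Z Z) := cov_total z Z Z
  have e3 : ex Ω (fun ω => cov (cnd Ω z (z ω)) H H) ≤ cov Ω H H := by
    have := cov_total (Ω := Ω) z H H
    have := var_nonneg (Ω := Ω) (fun ω => ex (cnd Ω z (z ω)) H)
    linarith
  have e4 : 2 * ex Ω (fun ω => cov (cnd Ω z (z ω)) H Z) ≤
      m * (ex Ω (fun ω => cov (cnd Ω z (z ω)) H H) + ex Ω (fun ω => cov (cnd Ω z (z ω)) Z Z)) := by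
    rw [← ex_add, ← ex_mul_left, ← ex_mul_left]
    exact ex_mono fun ω _ => h2 (z ω) h
  have e5 := h1 E h
  have n1 := var_nonneg (Ω := Ω) (fun ω => E (z ω))
  have n2 : 0 ≤ ex Ω (fun ω => cov (cnd Ω z (z ω)) Z Z) := ex_nonneg fun ω _ => var_nonneg _
  rw [e1, e2]
  have k1 := mul_le_mul_of_nonneg_left e3 hm
  have k2 := mul_nonneg hm n1
  have k3 := mul_nonneg hl n2
  change 2 * cov Ω H (fun ω => E (z ω)) ≤ l * (cov Ω H H + _) at e5
  nlinarith

lemma Dec.samp {y : X → V} {Z : X → ℝ} {l : ℝ} (hl : 0 < l) (h : Dec Ω y Z l) :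
    cov Ω (fun ω => ex (cnd Ω y (y ω)) Z) (fun ω => ex (cnd Ω y (y ω)) Z) ≤ l ^ 2 * cov Ω Z Z := by
  set E : V → ℝ := fun a => ex (cnd Ω y a) Z with hE
  have e1 : cov Ω (fun ω => E (y ω)) Z = cov Ω (fun ω => E (y ω)) (fun ω => E (y ω)) := by
    unfold cov
    have a1 : ex Ω (fun ω => E (y ω)) = ex Ω Z := ex_tower y Z
    have a2 : ex Ω (fun ω => E (y ω) * Z ω) = ex Ω (fun ω => E (y ω) * E (y ω)) := by
      rw [← ex_tower' y (fun a ω => E a * Z ω)]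
      refine ex_congr fun ω _ => ?_
      rw [ex_mul_left]
    rw [a1, a2]
  have e2 := h (fun a => l⁻¹ * E a)
  rw [cov_smul_left, cov_smul_left, cov_comm _ (fun ω => l⁻¹ * E (y ω)), cov_smul_left, e1] at e2
  change cov Ω (fun ω => E (y ω)) (fun ω => E (y ω)) ≤ _
  set v := cov Ω (fun ω => E (y ω)) (fun ω => E (y ω))
  have e3 := mul_le_mul_of_nonneg_left e2 hl.le
  have e4 : l * (2 * (l⁻¹ * v)) = 2 * v := by field_simp
  have e5 : l * (l * (l⁻¹ * (l⁻¹ * v) + cov Ω Z Z)) = v + l ^ 2 * cov Ω Z Z := by field_simp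
  linarith

/-- Sampling lemma. -/
lemma samp {y : X → V} {p : X → Prop} {l t : ℝ} (hl : 0 < l) (ht : 0 < t)
    (h : Dec Ω y (fun ω => ind (p ω)) l) :
    pr Ω (fun ω => 2 * t < pr (cnd Ω y (y ω)) p) ≤
      l ^ 2 / t ^ 2 * pr Ω p + ind (t < pr Ω p) := by
  rcases Ω.eq_empty_or_nonempty with rfl | hne
  · simp only [pr, ex_empty]; simp [ind_nonneg]
  by_cases hb : t < pr Ω p
  · rw [ind_true hb]
    have := pr_le_one (Ω := Ω) (fun ω => 2 * t < pr (cnd Ω y (y ω)) p)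
    have h2 : 0 ≤ l ^ 2 / t ^ 2 * pr Ω p := mul_nonneg (by positivity) (pr_nonneg _)
    linarith
  rw [ind_false hb, add_zero]
  push Not at hb
  have h1 := h.samp hl
  set E : X → ℝ := fun ω => pr (cnd Ω y (y ω)) p with hE
  change cov Ω E E ≤ _ at h1
  have h2 : ex Ω E = pr Ω p := ex_tower y _
  have h3 : cov Ω (fun ω => ind (p ω)) (fun ω => ind (p ω)) ≤ pr Ω p := by
    unfold cov
    have : ex Ω (fun ω => ind (p ω) * ind (p ω)) = pr Ω p := ex_congr fun ω _ => ind_sq _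
    rw [this]
    have := mul_self_nonneg (ex Ω fun ω => ind (p ω))
    linarith
  have h4 : t ^ 2 * pr Ω (fun ω => 2 * t < E ω) ≤ cov Ω E E := by
    rw [cov_eq_centered hne E E (pr Ω p) (pr Ω p)]
    have : cov Ω (fun ω => E ω - pr Ω p) (fun ω => E ω - pr Ω p)
        = ex Ω (fun ω => (E ω - pr Ω p) * (E ω - pr Ω p)) := by
      unfold cov; rw [ex_sub, ex_const hne, h2]; ring
    rw [this]; unfold pr; rw [← ex_mul_left]
    refine ex_mono fun ω _ => ?_
    change _ ≤ (E ω - pr Ω p) * (E ω - pr Ω p)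
    by_cases hc : 2 * t < E ω
    · rw [ind_true hc]; nlinarith
    · rw [ind_false hc]; nlinarith [mul_self_nonneg (E ω - pr Ω p)]
  have h5 : t ^ 2 * pr Ω (fun ω => 2 * t < E ω) ≤ l ^ 2 * pr Ω p :=
    h4.trans (h1.trans (mul_le_mul_of_nonneg_left h3 (by positivity)))
  rw [div_mul_eq_mul_div, le_div_iff₀ (by positivity)]
  linarith

/-- Majority lemma. -/
lemma majority {Γ : Type} {y : X → V} {z : X → W} {l : ℝ} (hl : l ≤ 1 / 2)
    (h : PE Ω y z l) (φ : V → Γ) (ψ : W → Γ) (hne : Ω.Nonempty) :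
    ∃ c : Γ, pr Ω (fun ω => φ (y ω) ≠ c) ≤ 4 * pr Ω (fun ω => φ (y ω) ≠ ψ (z ω)) := by
  set K : Finset Γ := Ω.image (fun ω => φ (y ω)) ∪ Ω.image (fun ω => ψ (z ω)) with hK
  have hKne : K.Nonempty := by
    obtain ⟨ω, hω⟩ := hne
    exact ⟨φ (y ω), by simp only [hK, Finset.mem_union, Finset.mem_image]; left; exact ⟨ω, hω, rfl⟩⟩
  obtain ⟨c, _, hcmax⟩ := Finset.exists_max_image K (fun c => pr Ω (fun ω => φ (y ω) = c)) hKne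
  refine ⟨c, ?_⟩
  set P : Γ → ℝ := fun c => pr Ω (fun ω => φ (y ω) = c) with hP
  have hPc : pr Ω (fun ω => φ (y ω) ≠ c) = 1 - P c := by
    have : pr Ω (fun ω => φ (y ω) ≠ c) = ex Ω (fun ω => 1 - ind (φ (y ω) = c)) :=
      ex_congr fun ω _ => by by_cases h : φ (y ω) = c <;> simp [ind, h]
    rw [this, ex_sub, ex_const hne]; rfl
  have hsumP : ∑ c ∈ K, P c = 1 := by
    simp only [hP, pr]
    rw [← ex_sum, ← ex_const hne 1]
    refine ex_congr fun ω hω => ?_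
    simp only [ind]
    rw [Finset.sum_ite_eq K (φ (y ω)) (fun _ => (1 : ℝ)), if_pos]
    simp only [hK, Finset.mem_union, Finset.mem_image]; left; exact ⟨ω, hω, rfl⟩
  have hkey : ∀ c ∈ K, (1 / 2) * (P c * (1 - P c)) ≤
      ex Ω (fun ω => (ind (φ (y ω) = c) - ind (ψ (z ω) = c)) ^ 2) := by
    intro c _
    set a : X → ℝ := fun ω => ind (φ (y ω) = c) with ha
    set b : X → ℝ := fun ω => ind (ψ (z ω) = c) with hb
    have e1 : 2 * cov Ω a b ≤ l * (cov Ω a a + cov Ω b b) :=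
      h (fun w => ind (ψ w = c)) (fun v => ind (φ v = c))
    have e2 : ex Ω (fun ω => (a ω - b ω) ^ 2) =
        cov Ω a a + cov Ω b b - 2 * cov Ω a b + (ex Ω a - ex Ω b) ^ 2 := by
      have : (fun ω => (a ω - b ω) ^ 2) =
        fun ω => (a ω * a ω + b ω * b ω) - 2 * (a ω * b ω) := by funext ω; ring
      rw [this, ex_sub, ex_add, ex_mul_left]; unfold cov; ring
    have e3 : cov Ω a a = P c * (1 - P c) := by
      unfold cov
      have : ex Ω (fun ω => a ω * a ω) = P c := ex_congr fun ω _ => ind_sq _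
      rw [this]; simp only [hP, pr, ha]; ring
    have n1 := var_nonneg (Ω := Ω) a
    have n2 := var_nonneg (Ω := Ω) b
    rw [e2, ← e3]
    nlinarith [sq_nonneg (ex Ω a - ex Ω b)]
  have hsum : ∑ c ∈ K, ex Ω (fun ω => (ind (φ (y ω) = c) - ind (ψ (z ω) = c)) ^ 2) =
      2 * pr Ω (fun ω => φ (y ω) ≠ ψ (z ω)) := by
    rw [← ex_sum, pr, ← ex_mul_left]
    refine ex_congr fun ω hω => ?_
    have m1 : φ (y ω) ∈ K := by
      simp only [hK, Finset.mem_union, Finset.mem_image]; left; exact ⟨ω, hω, rfl⟩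
    have m2 : ψ (z ω) ∈ K := by
      simp only [hK, Finset.mem_union, Finset.mem_image]; right; exact ⟨ω, hω, rfl⟩
    have : ∀ c ∈ K, (ind (φ (y ω) = c) - ind (ψ (z ω) = c)) ^ 2 =
      ind (φ (y ω) = c) + ind (ψ (z ω) = c) - (if φ (y ω) = c then 2 * ind (ψ (z ω) = c) else 0) := by
      intro c _; simp only [ind]; split_ifs <;> norm_num
    rw [Finset.sum_congr rfl this, Finset.sum_sub_distrib, Finset.sum_add_distrib,
      Finset.sum_ite_eq, if_pos m1]
    simp only [ind]
    rw [Finset.sum_ite_eq, Finset.sum_ite_eq, if_pos m1, if_pos m2]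
    by_cases hh : φ (y ω) = ψ (z ω)
    · simp [hh]; norm_num
    · rw [if_neg (Ne.symm hh), if_pos hh]; norm_num
  have hfin : (1 / 2) * (1 - P c) ≤ 2 * pr Ω (fun ω => φ (y ω) ≠ ψ (z ω)) := by
    rw [← hsum]
    calc (1 / 2) * (1 - P c) = ∑ c' ∈ K, (1 / 2) * (P c' * (1 - P c)) := by
          rw [← Finset.mul_sum, ← Finset.sum_mul, hsumP, one_mul]
      _ ≤ ∑ c' ∈ K, (1 / 2) * (P c' * (1 - P c')) := by
          refine Finset.sum_le_sum fun c' hc' => ?_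
          have := hcmax c' hc'
          have n : 0 ≤ P c' := pr_nonneg _
          have : P c' ≤ P c := this
          gcongr
      _ ≤ _ := Finset.sum_le_sum hkey
  rw [hPc]; linarith

/-- Majority lemma, joint version. -/
lemma majority' {Γ : Type} {y : X → V} {z : X → W} {l : ℝ} (hl : l ≤ 1 / 2)
    (h : PE Ω y z l) (φ : V → Γ) (ψ : W → Γ) [Nonempty Γ] :
    ∃ c : Γ, pr Ω (fun ω => φ (y ω) ≠ c ∨ ψ (z ω) ≠ c) ≤
      5 * pr Ω (fun ω => φ (y ω) ≠ ψ (z ω)) := by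
  rcases Ω.eq_empty_or_nonempty with rfl | hne
  · exact ⟨Classical.arbitrary Γ, by simp [pr, ex_empty]⟩
  obtain ⟨c, hc⟩ := majority hl h φ ψ hne
  refine ⟨c, ?_⟩
  have := pr_le_of_imp_or (Ω := Ω) (p := fun ω => φ (y ω) ≠ c ∨ ψ (z ω) ≠ c)
    (q := fun ω => φ (y ω) ≠ c) (r := fun ω => φ (y ω) ≠ ψ (z ω)) (by
      intro ω _ hh
      by_contra hcon; push Not at hcon
      obtain ⟨h1, h2⟩ := hcon
      rcases hh with hh | hh
      · exact hh h1
      · exact hh (h2 ▸ h1))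
  linarith

end basic
end CB

/-! ### Typed cochains -/

namespace CB

section cochains
variable {X V Γ : Type} [Group Γ]

/-- Antisymmetry of a typed cochain. -/
def AS (f : ℕ → ℕ → V → V → Γ) : Prop := ∀ i j u v, i ≠ j → f i j u v = (f j i v u)⁻¹

/-- The triangle of types `i,j,k` of `ω` is closed. -/
def tri (x : ℕ → X → V) (f : ℕ → ℕ → V → V → Γ) (i j k : ℕ) (ω : X) : Prop :=
  f i j (x i ω) (x j ω) * f j k (x j ω) (x k ω) * f k i (x k ω) (x i ω) = 1

/-- `f = δ g` on the edge of types `i,j` of `ω`. -/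
def edg (x : ℕ → X → V) (f : ℕ → ℕ → V → V → Γ) (g : ℕ → V → Γ) (i j : ℕ) (ω : X) : Prop :=
  f i j (x i ω) (x j ω) = g i (x i ω) * (g j (x j ω))⁻¹

/-- Some triangle with types in `J` is not closed. -/
def badT (x : ℕ → X → V) (f : ℕ → ℕ → V → V → Γ) (J : Finset ℕ) (ω : X) : Prop :=
  ∃ i ∈ J, ∃ j ∈ J, ∃ k ∈ J, i ≠ j ∧ j ≠ k ∧ i ≠ k ∧ ¬ tri x f i j k ω

/-- Some edge with types in `J` has `f ≠ δ g`. -/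
def badE (x : ℕ → X → V) (f : ℕ → ℕ → V → V → Γ) (g : ℕ → V → Γ) (J : Finset ℕ) (ω : X) : Prop :=
  ∃ i ∈ J, ∃ j ∈ J, i ≠ j ∧ ¬ edg x f g i j ω

/-- Coboundary expansion on the types in `J`. -/
def Cob (Γ : Type) [Group Γ] (Ω : Finset X) (x : ℕ → X → V) (J : Finset ℕ) (B : ℝ) : Prop :=
  ∀ f : ℕ → ℕ → V → V → Γ, AS f → ∃ g : ℕ → V → Γ,
    pr Ω (badE x f g J) ≤ B * pr Ω (badT x f J)

variable {Ω : Finset X} {x : ℕ → X → V} {f : ℕ → ℕ → V → V → Γ} {g : ℕ → V → Γ}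

lemma tri_rot {i j k : ℕ} {ω : X} (h : tri x f i j k ω) : tri x f j k i ω := by
  unfold tri at *
  rw [mul_assoc, mul_eq_one_iff_inv_eq] at h
  rw [← h]; group

lemma tri_swap (hf : AS f) {i j k : ℕ} (hij : i ≠ j) (hjk : j ≠ k) (hik : i ≠ k) {ω : X}
    (h : tri x f i j k ω) : tri x f j i k ω := by
  unfold tri at *
  rw [hf j i _ _ hij.symm, hf i k _ _ hik, hf k j _ _ hjk.symm]
  have h2 := congrArg (·⁻¹) (tri_rot (x := x) (f := f) (i := i) (j := j) (k := k) h)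
  simp only [mul_inv_rev, inv_one] at h2
  rw [mul_assoc]; exact h2

lemma edg_symm (hf : AS f) {i j : ℕ} (hij : i ≠ j) {ω : X} (h : edg x f g i j ω) :
    edg x f g j i ω := by
  unfold edg at *
  rw [hf j i _ _ hij.symm, h]; group

lemma Cob.mono {J : Finset ℕ} {B B' : ℝ} (h : Cob Γ Ω x J B) (hB : B ≤ B') : Cob Γ Ω x J B' := by
  intro f hf
  obtain ⟨g, hg⟩ := h f hf
  exact ⟨g, hg.trans (mul_le_mul_of_nonneg_right hB (pr_nonneg _))⟩

lemma badT_triple (hf : AS f) {i j k : ℕ} (hij : i ≠ j) (hjk : j ≠ k) (hik : i ≠ k) (ω : X) :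
    badT x f {i, j, k} ω ↔ ¬ tri x f i j k ω := by
  constructor
  · rintro ⟨a, ha, b, hb, c, hc, hab, hbc, hac, h⟩ h0
    apply h
    have h1 := tri_rot h0
    have h2 := tri_rot h1
    have h3 := tri_swap hf hij hjk hik h0
    have h4 := tri_rot h3
    have h5 := tri_rot h4
    simp only [Finset.mem_insert, Finset.mem_singleton] at ha hb hc
    rcases ha with rfl | rfl | rfl <;> rcases hb with rfl | rfl | rfl <;>
      rcases hc with rfl | rfl | rfl <;> first | assumption | contradiction
  · intro h
    exact ⟨i, by simp, j, by simp, k, by simp, hij, hjk, hik, h⟩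

lemma badE_triple (hf : AS f) {i j k : ℕ} (ω : X)
    (h : badE x f g {i, j, k} ω) : ¬ edg x f g i j ω ∨ ¬ edg x f g k i ω ∨ ¬ edg x f g k j ω := by
  obtain ⟨a, ha, b, hb, hab, h⟩ := h
  by_contra hc; push Not at hc
  obtain ⟨h1, h2, h3⟩ := hc
  simp only [Finset.mem_insert, Finset.mem_singleton] at ha hb
  rcases ha with rfl | rfl | rfl <;> rcases hb with rfl | rfl | rfl <;>
    first | contradiction | (exact h (edg_symm hf hab.symm (by assumption)))

lemma pr_tower {W : Type} (y : X → W) (p : X → Prop) :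
    ex Ω (fun ω => pr (cnd Ω y (y ω)) p) = pr Ω p := ex_tower y _

/-- Join lemma. -/
lemma J_lemma {i j k : ℕ} (hij : i ≠ j) (hjk : j ≠ k) (hik : i ≠ k)
    (hind : ∀ ω0 ∈ Ω, ∀ φ : V → V → ℝ, ex (cnd Ω (x k) (x k ω0)) (fun ω => φ (x i ω) (x j ω)) =
      ex Ω (fun ω => φ (x i ω) (x j ω)))
    (hPE : ∀ b, PE (cnd Ω (x k) b) (x i) (x j) (1 / 2)) : Cob Γ Ω x {i, j, k} 11 := by
  intro f hf
  rcases Ω.eq_empty_or_nonempty with rfl | hne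
  · exact ⟨fun _ _ => 1, by simp [pr, ex_empty]⟩
  rw [pr_congr (q := fun ω => ¬ tri x f i j k ω) fun ω _ => badT_triple hf hij hjk hik ω]
  set ε := pr Ω (fun ω => ¬ tri x f i j k ω) with hε
  obtain ⟨ω0, hω0, h0⟩ := exists_le_ex hne
    (fun ω => pr (cnd Ω (x k) (x k ω)) (fun ω => ¬ tri x f i j k ω))
  rw [pr_tower] at h0
  set b := x k ω0 with hb
  set gi : V → Γ := fun a => f i k a b with hgi
  set gj : V → Γ := fun a => f j k a b with hgj
  have h1 : pr Ω (fun ω => f i j (x i ω) (x j ω) ≠ gi (x i ω) * (gj (x j ω))⁻¹) ≤ ε := by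
    refine le_trans (le_of_eq ?_) h0
    refine ((hind ω0 hω0 (fun a a' => ind (f i j a a' ≠ gi a * (gj a')⁻¹))).symm).trans ?_
    refine pr_congr fun ω hω => ?_
    have hk := (mem_cnd.1 hω).2
    rw [not_iff_not]
    unfold tri
    simp only [hgi, hgj]
    rw [hk, hf k i _ _ hik.symm, mul_inv_eq_one, eq_mul_inv_iff_mul_eq]
  have key : ∀ b' : V, ∃ c : Γ, pr (cnd Ω (x k) b') (fun ω =>
      f k i b' (x i ω) * gi (x i ω) ≠ c ∨ f k j b' (x j ω) * gj (x j ω) ≠ c) ≤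
      5 * pr (cnd Ω (x k) b') (fun ω => ¬ tri x f i j k ω ∨
        f i j (x i ω) (x j ω) ≠ gi (x i ω) * (gj (x j ω))⁻¹) := by
    intro b'
    obtain ⟨c, hc⟩ := majority' le_rfl (hPE b') (fun a => f k i b' a * gi a)
      (fun a => f k j b' a * gj a)
    refine ⟨c, hc.trans ?_⟩
    gcongr
    refine pr_mono fun ω hω hne => ?_
    by_contra hcon; push Not at hcon
    obtain ⟨t1, t2⟩ := hcon
    apply hne
    have hk := (mem_cnd.1 hω).2
    have t3 := tri_rot (tri_rot t1)
    unfold tri at t3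
    rw [hk, t2, hf j k _ _ hjk] at t3
    rw [mul_inv_eq_one] at t3
    rw [← t3]; group
  choose gk hgk using key
  refine ⟨fun t => if t = i then gi else if t = j then gj else gk, ?_⟩
  have h2 : pr Ω (fun ω => f k i (x k ω) (x i ω) * gi (x i ω) ≠ gk (x k ω) ∨
      f k j (x k ω) (x j ω) * gj (x j ω) ≠ gk (x k ω)) ≤ 5 * (ε + ε) := by
    have e1 := ex_tower' (Ω := Ω) (x k) (fun b' ω => ind (f k i b' (x i ω) * gi (x i ω) ≠ gk b' ∨
      f k j b' (x j ω) * gj (x j ω) ≠ gk b'))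
    refine (le_of_eq e1.symm).trans ?_
    refine (ex_mono fun ω _ => hgk (x k ω)).trans ?_
    rw [ex_mul_left, pr_tower]
    gcongr
    exact (pr_or _ _).trans (add_le_add_right h1 _)
  have h3 := pr_le_of_imp_or (Ω := Ω)
    (p := badE x f (fun t => if t = i then gi else if t = j then gj else gk) {i, j, k})
    (q := fun ω => f i j (x i ω) (x j ω) ≠ gi (x i ω) * (gj (x j ω))⁻¹)
    (r := fun ω => f k i (x k ω) (x i ω) * gi (x i ω) ≠ gk (x k ω) ∨
      f k j (x k ω) (x j ω) * gj (x j ω) ≠ gk (x k ω)) (by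
      intro ω _ hω
      have := badE_triple hf ω hω
      unfold edg at this
      simp only [if_true, if_neg hij.symm, if_neg hjk.symm, if_neg hik.symm] at this
      simp only [ne_eq, eq_mul_inv_iff_mul_eq] at this ⊢
      exact this)
  linarith

end cochains
end CB

/-! ### The local-to-global lemma for four types -/

namespace CB

section mlemma
variable {X V Γ : Type} [Group Γ] {Ω : Finset X} {x : ℕ → X → V}

lemma Dec_of_dep {W W' : Type} {y : X → W} {z : X → W'} {Z : X → ℝ} {l : ℝ} (h : PE Ω y z l)
    (hZ : ∀ ω ∈ Ω, ∀ ω' ∈ Ω, z ω = z ω' → Z ω = Z ω') : Dec Ω y Z l := by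
  set k : W' → ℝ := fun a => if ha : ∃ ω ∈ Ω, z ω = a then Z ha.choose else 0 with hk
  have e : ∀ ω ∈ Ω, k (z ω) = Z ω := by
    intro ω hω
    have ha : ∃ ω' ∈ Ω, z ω' = z ω := ⟨ω, hω, rfl⟩
    simp only [hk, dif_pos ha]
    exact hZ _ ha.choose_spec.1 _ hω ha.choose_spec.2
  intro h'
  have := h k h'
  have c1 : cov Ω (fun ω => h' (y ω)) (fun ω => k (z ω)) = cov Ω (fun ω => h' (y ω)) Z := by
    unfold cov
    rw [ex_congr e, ex_congr (φ := fun ω => h' (y ω) * k (z ω)) (ψ := fun ω => h' (y ω) * Z ω)]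
    intro ω hω; rw [e ω hω]
  have c2 : cov Ω (fun ω => k (z ω)) (fun ω => k (z ω)) = cov Ω Z Z := by
    unfold cov
    rw [ex_congr e, ex_congr (φ := fun ω => k (z ω) * k (z ω)) (ψ := fun ω => Z ω * Z ω)]
    intro ω hω; rw [e ω hω]
  rw [c1, c2] at this; exact this

lemma Dec_of_dep2 {W W1 W2 : Type} {y : X → W} {z1 : X → W1} {z2 : X → W2} {Z : X → ℝ} {l : ℝ}
    (hl : 0 ≤ l) (h1 : PE Ω y z1 l) (h2 : ∀ a, PE (cnd Ω z1 a) y z2 l)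
    (hZ : ∀ ω ∈ Ω, ∀ ω' ∈ Ω, z1 ω = z1 ω' → z2 ω = z2 ω' → Z ω = Z ω') : Dec Ω y Z (2 * l) := by
  rw [two_mul]
  refine Dec_tower hl hl h1 fun a => Dec_of_dep (h2 a) ?_
  intro ω hω ω' hω'
  rw [mem_cnd] at hω hω'
  exact hZ ω hω.1 ω' hω'.1 (hω.2.trans hω'.2.symm)

lemma Dec_of_dep3 {W W1 W2 W3 : Type} {y : X → W} {z1 : X → W1} {z2 : X → W2} {z3 : X → W3}
    {Z : X → ℝ} {l : ℝ}
    (hl : 0 ≤ l) (h1 : PE Ω y z1 l) (h2 : ∀ a, PE (cnd Ω z1 a) y z2 l)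
    (h3 : ∀ a b, PE (cnd (cnd Ω z1 a) z2 b) y z3 l)
    (hZ : ∀ ω ∈ Ω, ∀ ω' ∈ Ω, z1 ω = z1 ω' → z2 ω = z2 ω' → z3 ω = z3 ω' → Z ω = Z ω') :
    Dec Ω y Z (3 * l) := by
  rw [show 3 * l = l + 2 * l by ring]
  refine Dec_tower hl (by positivity) h1 fun a => Dec_of_dep2 hl (h2 a) (h3 a) ?_
  intro ω hω ω' hω'
  rw [mem_cnd] at hω hω'
  exact hZ ω hω.1 ω' hω'.1 (hω.2.trans hω'.2.symm)

lemma badE_congr {f : ℕ → ℕ → V → V → Γ} {g : ℕ → V → Γ} {J : Finset ℕ} {ω ω' : X}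
    (h : ∀ m ∈ J, x m ω = x m ω') : badE x f g J ω = badE x f g J ω' := by
  have : ∀ ω ω', (∀ m ∈ J, x m ω = x m ω') → badE x f g J ω → badE x f g J ω' := by
    rintro ω ω' h ⟨i, hi, j, hj, hij, hb⟩
    refine ⟨i, hi, j, hj, hij, ?_⟩
    unfold edg at *; rw [← h i hi, ← h j hj]; exact hb
  exact propext ⟨this _ _ h, this _ _ fun m hm => (h m hm).symm⟩

lemma badT_congr {f : ℕ → ℕ → V → V → Γ} {J : Finset ℕ} {ω ω' : X}
    (h : ∀ m ∈ J, x m ω = x m ω') : badT x f J ω = badT x f J ω' := by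
  have : ∀ ω ω', (∀ m ∈ J, x m ω = x m ω') → badT x f J ω → badT x f J ω' := by
    rintro ω ω' h ⟨i, hi, j, hj, k, hk, h1, h2, h3, hb⟩
    refine ⟨i, hi, j, hj, k, hk, h1, h2, h3, ?_⟩
    unfold tri at *; rw [← h i hi, ← h j hj, ← h k hk]; exact hb
  exact propext ⟨this _ _ h, this _ _ fun m hm => (h m hm).symm⟩

lemma badT_mono {f : ℕ → ℕ → V → V → Γ} {J J' : Finset ℕ} {ω : X} (hJ : J ⊆ J')
    (h : badT x f J ω) : badT x f J' ω := by
  obtain ⟨i, hi, j, hj, k, hk, h⟩ := h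
  exact ⟨i, hJ hi, j, hJ hj, k, hJ hk, h⟩

lemma pr_exists_le {κ : Type} (J : Finset κ) (p : κ → X → Prop) {b : ℝ}
    (h : ∀ i ∈ J, pr Ω (p i) ≤ b) : pr Ω (fun ω => ∃ i ∈ J, p i ω) ≤ J.card * b := by
  calc pr Ω (fun ω => ∃ i ∈ J, p i ω) ≤ ex Ω (fun ω => ∑ i ∈ J, ind (p i ω)) := by
        refine ex_mono fun ω _ => ?_
        by_cases hh : ∃ i ∈ J, p i ω
        · rw [ind_true hh]
          obtain ⟨i, hi, hp⟩ := hh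
          rw [← ind_true hp]
          exact Finset.single_le_sum (f := fun i => ind (p i ω)) (fun i _ => ind_nonneg _) hi
        · rw [ind_false hh]; exact Finset.sum_nonneg fun i _ => ind_nonneg _
    _ = ∑ i ∈ J, pr Ω (p i) := ex_sum _ _
    _ ≤ J.card * b := by
        rw [← nsmul_eq_mul]; exact Finset.sum_le_card_nsmul _ _ _ h

lemma pr_and_le {p : Prop} {q : X → Prop} {b : ℝ} (hb : 0 ≤ b) (h : p → pr Ω q ≤ b) :
    pr Ω (fun ω => p ∧ q ω) ≤ b := by
  by_cases hp : p
  · exact (pr_mono fun _ _ h => h.2).trans (h hp)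
  · refine le_trans (le_of_eq ?_) hb
    unfold pr
    rw [ex_congr (ψ := fun _ => (0 : ℝ)) fun ω _ => ind_false (fun h => hp h.1)]
    simp [ex]

/-- All the pair expansion hypotheses. -/
structure PEall (Ω : Finset X) (x : ℕ → X → V) (J : Finset ℕ) (l : ℝ) : Prop where
  p0 : ∀ i ∈ J, ∀ j ∈ J, i ≠ j → PE Ω (x i) (x j) l
  p1 : ∀ i ∈ J, ∀ j ∈ J, i ≠ j → ∀ k ∈ J, ∀ a, k ≠ i → k ≠ j → PE (cnd Ω (x k) a) (x i) (x j) l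
  p2 : ∀ i ∈ J, ∀ j ∈ J, i ≠ j → ∀ k ∈ J, ∀ k' ∈ J, ∀ a a', k ≠ i → k ≠ j → k' ≠ i → k' ≠ j →
    k ≠ k' → PE (cnd (cnd Ω (x k) a) (x k') a') (x i) (x j) l

lemma link_sol {f : ℕ → ℕ → V → V → Γ} (hf : AS f) {J : Finset ℕ} {B l : ℝ} (hB : 1 ≤ B)
    (hl : l ≤ 1 / 2) (hJ : J.card = 4) (hPE : PEall Ω x J l)
    {i : ℕ} (hi : i ∈ J) (v : V) (hC : Cob Γ (cnd Ω (x i) v) x (J.erase i) B) :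
    ∃ g : ℕ → V → Γ,
      pr (cnd Ω (x i) v) (badE x f g (J.erase i)) ≤ B * pr (cnd Ω (x i) v) (badT x f (J.erase i)) ∧
      pr (cnd Ω (x i) v) (fun ω => ∃ j ∈ J.erase i, g j (x j ω) ≠ f j i (x j ω) v) ≤
        12 * B * pr (cnd Ω (x i) v) (badT x f J) := by
  obtain ⟨g, hg⟩ := hC f hf
  have h3 : (J.erase i).card = 3 := by rw [Finset.card_erase_of_mem hi, hJ]
  obtain ⟨j, k, m, hjk, hjm, hkm, hJe⟩ := Finset.card_eq_three.1 h3
  have hj : j ∈ J.erase i := by rw [hJe]; simp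
  have hk : k ∈ J.erase i := by rw [hJe]; simp
  obtain ⟨hji, hjJ⟩ := Finset.mem_erase.1 hj
  obtain ⟨hki, hkJ⟩ := Finset.mem_erase.1 hk
  set Ωv := cnd Ω (x i) v with hΩv
  have rel : ∀ ω ∈ Ωv, ∀ a ∈ J.erase i, ∀ b ∈ J.erase i, a ≠ b →
      ¬ badT x f J ω → ¬ badE x f g (J.erase i) ω →
      f i a v (x a ω) * g a (x a ω) = f i b v (x b ω) * g b (x b ω) := by
    intro ω hω a ha b hb hab h1 h2
    have hv := (mem_cnd.1 hω).2
    have t : tri x f i a b ω := by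
      by_contra hc
      exact h1 ⟨i, hi, a, (Finset.mem_erase.1 ha).2, b, (Finset.mem_erase.1 hb).2,
        (Finset.mem_erase.1 ha).1.symm, hab, (Finset.mem_erase.1 hb).1.symm, hc⟩
    have e : edg x f g a b ω := by
      by_contra hc
      exact h2 ⟨a, ha, b, hb, hab, hc⟩
    unfold tri at t; unfold edg at e
    rw [e, hv, hf b i _ _ (Finset.mem_erase.1 hb).1, mul_inv_eq_one] at t
    rw [← t]; group
  have hbad : pr Ωv (fun ω => badT x f J ω ∨ badE x f g (J.erase i) ω) ≤
      2 * B * pr Ωv (badT x f J) := by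
    refine (pr_or _ _).trans ?_
    have a1 : pr Ωv (badT x f (J.erase i)) ≤ pr Ωv (badT x f J) :=
      pr_mono fun ω _ h => badT_mono (Finset.erase_subset _ _) h
    have a2 := pr_nonneg (Ω := Ωv) (badT x f J)
    have a3 : pr Ωv (badE x f g (J.erase i)) ≤ B * pr Ωv (badT x f J) :=
      hg.trans (mul_le_mul_of_nonneg_left a1 (by linarith))
    have a4 := mul_le_mul_of_nonneg_right hB a2
    change pr Ωv (badT x f J) + pr Ωv (badE x f g (J.erase i)) ≤ _
    linarith
  obtain ⟨c, hc⟩ := majority' hl (hPE.p1 j hjJ k hkJ hjk i hi v hji.symm hki.symm)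
    (fun a => f i j v a * g j a) (fun a => f i k v a * g k a)
  have hc' : pr Ωv (fun ω => f i j v (x j ω) * g j (x j ω) ≠ c ∨
      f i k v (x k ω) * g k (x k ω) ≠ c) ≤ 5 * (2 * B * pr Ωv (badT x f J)) := by
    refine hc.trans ?_
    gcongr
    refine le_trans (pr_mono fun ω hω hne => ?_) hbad
    by_contra hcon; push Not at hcon
    exact hne (rel ω hω j hj k hk hjk hcon.1 hcon.2)
  refine ⟨fun t a => g t a * c⁻¹, ?_, ?_⟩
  · refine le_trans (pr_mono ?_) hg
    rintro ω hω ⟨a, ha, b, hb, hab, h⟩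
    refine ⟨a, ha, b, hb, hab, fun he => h ?_⟩
    unfold edg at *
    rw [he]; group
  · refine le_trans (pr_le_of_imp_or (q := fun ω => f i j v (x j ω) * g j (x j ω) ≠ c ∨
      f i k v (x k ω) * g k (x k ω) ≠ c)
      (r := fun ω => badT x f J ω ∨ badE x f g (J.erase i) ω) ?_) ?_
    · rintro ω hω ⟨a, ha, hne⟩
      by_contra hcon; push Not at hcon
      obtain ⟨⟨h1, h2⟩, h4, h5⟩ := hcon
      have h6 : f i a v (x a ω) * g a (x a ω) = c := by
        by_cases haj : a = j
        · rw [haj]; exact h1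
        · rw [rel ω hω a ha j hj haj h4 h5]; exact h1
      apply hne
      rw [hf a i _ _ (Finset.mem_erase.1 ha).1, ← h6]; group
    · linarith

/-- One improvement step. -/
lemma improve {f : ℕ → ℕ → V → V → Γ} (hf : AS f) {J : Finset ℕ} {B l : ℝ} (hB : 1 ≤ B)
    (hl0 : 0 < l) (hl : l ≤ 1 / (20000 * B)) (hJ : J.card = 4) (hPE : PEall Ω x J l)
    (hC : ∀ i ∈ J, ∀ v, Cob Γ (cnd Ω (x i) v) x (J.erase i) B)
    (hsmall : pr Ω (badT x f J) ≤ 1 / (320 * B)) :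
    ∃ f' : ℕ → ℕ → V → V → Γ, AS f' ∧ pr Ω (badT x f' J) ≤ pr Ω (badT x f J) / 2 ∧
      pr Ω (fun ω => ∃ i ∈ J, ∃ j ∈ J, i ≠ j ∧ f i j (x i ω) (x j ω) ≠ f' i j (x i ω) (x j ω)) ≤
        240 * B * pr Ω (badT x f J) := by
  have hl2 : l ≤ 1 / 2 := by
    refine hl.trans ?_
    rw [div_le_div_iff₀ (by positivity) (by norm_num)]; linarith
  set ε := pr Ω (badT x f J) with hε
  have hε0 : 0 ≤ ε := pr_nonneg _
  have hG : ∀ i v, ∃ g : ℕ → V → Γ, i ∈ J →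
      (pr (cnd Ω (x i) v) (badE x f g (J.erase i)) ≤ B * pr (cnd Ω (x i) v) (badT x f (J.erase i)) ∧
      pr (cnd Ω (x i) v) (fun ω => ∃ j ∈ J.erase i, g j (x j ω) ≠ f j i (x j ω) v) ≤
        12 * B * pr (cnd Ω (x i) v) (badT x f J)) := by
    intro i v
    by_cases hi : i ∈ J
    · obtain ⟨g, hg⟩ := link_sol hf hB hl2 hJ hPE hi v (hC i hi v)
      exact ⟨g, fun _ => hg⟩
    · exact ⟨fun _ _ => 1, fun h => absurd h hi⟩
  choose G hG using hG
  -- the event that the two remaining vertices form a bad edge for `G i`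
  set Q : ℕ → ℕ → X → Prop := fun i j ω => badE x f (G i (x i ω)) ((J.erase i).erase j) ω with hQ
  have hQav : ∀ i ∈ J, ∀ j, pr Ω (Q i j) ≤ B * ε := by
    intro i hi j
    have e1 := ex_tower' (Ω := Ω) (x i) (fun v ω => ind (badE x f (G i v) ((J.erase i).erase j) ω))
    refine (le_of_eq e1.symm).trans ?_
    refine (ex_mono (ψ := fun ω => B * pr (cnd Ω (x i) (x i ω)) (badT x f J)) fun ω _ => ?_).trans ?_
    · refine (pr_mono (q := badE x f (G i (x i ω)) (J.erase i)) ?_).trans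
        (((hG i (x i ω) hi).1).trans ?_)
      · rintro ω' _ ⟨a, ha, b, hb, h⟩
        exact ⟨a, Finset.mem_of_mem_erase ha, b, Finset.mem_of_mem_erase hb, h⟩
      · gcongr
        exact pr_mono fun ω _ h => badT_mono (Finset.erase_subset _ _) h
    · rw [ex_mul_left, pr_tower]
  have hDav : ∀ i ∈ J, pr Ω (fun ω => ∃ j ∈ J.erase i, G i (x i ω) j (x j ω) ≠
      f j i (x j ω) (x i ω)) ≤ 12 * B * ε := by
    intro i hi
    have e1 := ex_tower' (Ω := Ω) (x i) (fun v ω => ind (∃ j ∈ J.erase i, G i v j (x j ω) ≠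
      f j i (x j ω) v))
    refine (le_of_eq e1.symm).trans ?_
    refine (ex_mono fun ω _ => (hG i (x i ω) hi).2).trans ?_
    rw [ex_mul_left, pr_tower]
  -- the majority values
  have hM : ∀ i j v v', ∃ c : Γ, i ∈ J → j ∈ J → i ≠ j →
      pr (cnd (cnd Ω (x i) v) (x j) v') (fun ω => ∃ k ∈ (J.erase i).erase j,
        (G i v k (x k ω))⁻¹ * G j v' k (x k ω) ≠ c) ≤
      5 * (pr (cnd (cnd Ω (x i) v) (x j) v') (Q i j) + pr (cnd (cnd Ω (x i) v) (x j) v') (Q j i)) := by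
    intro i j v v'
    by_cases hi : i ∈ J
    swap
    · exact ⟨1, fun h => absurd h hi⟩
    by_cases hj : j ∈ J
    swap
    · exact ⟨1, fun _ h => absurd h hj⟩
    by_cases hij : i ≠ j
    swap
    · exact ⟨1, fun _ _ h => absurd h hij⟩
    have h2 : ((J.erase i).erase j).card = 2 := by
      rw [Finset.card_erase_of_mem (Finset.mem_erase.2 ⟨hij.symm, hj⟩),
        Finset.card_erase_of_mem hi, hJ]
    obtain ⟨k, m, hkm, hJe⟩ := Finset.card_eq_two.1 h2
    have hk : k ∈ (J.erase i).erase j := by rw [hJe]; simp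
    have hm : m ∈ (J.erase i).erase j := by rw [hJe]; simp
    have hk' := hk
    have hm' := hm
    simp only [Finset.mem_erase] at hk' hm'
    obtain ⟨c, hc⟩ := majority' hl2 (hPE.p2 k hk'.2.2 m hm'.2.2 hkm i hi j hj v v' hk'.2.1.symm
      hm'.2.1.symm hk'.1.symm hm'.1.symm hij)
      (fun a => (G i v k a)⁻¹ * G j v' k a) (fun a => (G i v m a)⁻¹ * G j v' m a)
    refine ⟨c, fun _ _ _ => ?_⟩
    refine le_trans (pr_mono ?_) (hc.trans ?_)
    · rintro ω _ ⟨a, ha, h⟩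
      rw [hJe] at ha
      simp only [Finset.mem_insert, Finset.mem_singleton] at ha
      rcases ha with rfl | rfl
      · exact Or.inl h
      · exact Or.inr h
    · gcongr
      refine pr_le_of_imp_or fun ω hω h => ?_
      by_contra hcon; push Not at hcon
      obtain ⟨q1, q2⟩ := hcon
      rw [mem_cnd, mem_cnd] at hω
      obtain ⟨⟨_, hv⟩, hv'⟩ := hω
      have e1 : edg x f (G i (x i ω)) k m ω := by
        by_contra hh; exact q1 ⟨k, hk, m, hm, hkm, hh⟩
      have e2 : edg x f (G j (x j ω)) k m ω := by
        by_contra hh; exact q2 ⟨k, by rw [Finset.erase_right_comm]; exact hk, m,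
          by rw [Finset.erase_right_comm]; exact hm, hkm, hh⟩
      apply h
      unfold edg at e1 e2
      rw [hv] at e1; rw [hv'] at e2
      rw [e1] at e2
      have e3 : G i v k (x k ω) = G j v' k (x k ω) * (G j v' m (x m ω))⁻¹ * G i v m (x m ω) := by
        rw [← e2]; group
      rw [e3]; group
  choose M hM using hM
  set f' : ℕ → ℕ → V → V → Γ := fun i j u v => if i < j then M i j u v else (M j i v u)⁻¹ with hf'
  have hAS : AS f' := by
    intro i j u v hij
    simp only [hf']
    rcases lt_or_gt_of_ne hij with h | h
    · rw [if_pos h, if_neg (by omega), inv_inv]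
    · rw [if_neg (by omega), if_pos h]
  -- the event that the value at `k` disagrees with `f'`
  set E : ℕ → ℕ → ℕ → X → Prop := fun i j k ω =>
    (G i (x i ω) k (x k ω))⁻¹ * G j (x j ω) k (x k ω) ≠ f' i j (x i ω) (x j ω) with hE
  have hEsymm : ∀ i j k ω, i ≠ j → E i j k ω → E j i k ω := by
    intro i j k ω hij h h'
    apply h
    rw [hAS i j _ _ hij, ← h']; group
  have hElt : ∀ i ∈ J, ∀ j ∈ J, i < j → ∀ v v', pr (cnd (cnd Ω (x i) v) (x j) v')
      (fun ω => ∃ k ∈ (J.erase i).erase j, E i j k ω) ≤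
      5 * (pr (cnd (cnd Ω (x i) v) (x j) v') (Q i j) + pr (cnd (cnd Ω (x i) v) (x j) v') (Q j i)) := by
    intro i hi j hj hij v v'
    refine le_trans (pr_mono ?_) (hM i j v v' hi hj (ne_of_lt hij))
    rintro ω hω ⟨k, hk, h⟩
    rw [mem_cnd, mem_cnd] at hω
    refine ⟨k, hk, ?_⟩
    simp only [hE, hf', if_pos hij] at h
    rw [hω.1.2, hω.2] at h
    exact h
  have hEne : ∀ i ∈ J, ∀ j ∈ J, i ≠ j → ∀ v v', pr (cnd (cnd Ω (x i) v) (x j) v')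
      (fun ω => ∃ k ∈ (J.erase i).erase j, E i j k ω) ≤
      5 * (pr (cnd (cnd Ω (x i) v) (x j) v') (Q i j) + pr (cnd (cnd Ω (x i) v) (x j) v') (Q j i)) := by
    intro i hi j hj hij v v'
    rcases lt_or_gt_of_ne hij with h | h
    · exact hElt i hi j hj h v v'
    · have := hElt j hj i hi h v' v
      rw [cnd_comm, add_comm, Finset.erase_right_comm] at this
      refine le_trans (pr_mono ?_) this
      rintro ω _ ⟨k, hk, h⟩
      exact ⟨k, hk, hEsymm i j k ω hij h⟩
  have hEav : ∀ i ∈ J, ∀ j ∈ J, i ≠ j → pr Ω (fun ω => ∃ k ∈ (J.erase i).erase j, E i j k ω) ≤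
      10 * B * ε := by
    intro i hi j hj hij
    have e1 := ex_tower (Ω := Ω) (x i) (fun ω => ind (∃ k ∈ (J.erase i).erase j, E i j k ω))
    have e2 : ∀ p : X → Prop, pr Ω p = ex Ω (fun ω => ex (cnd Ω (x i) (x i ω))
        (fun ω' => pr (cnd (cnd Ω (x i) (x i ω)) (x j) (x j ω')) p)) := by
      intro p
      rw [← pr_tower (x i) p]
      refine ex_congr fun ω _ => ?_
      rw [pr_tower]
    rw [e2]
    have e3 : ex Ω (fun ω => ex (cnd Ω (x i) (x i ω))
        (fun ω' => 5 * (pr (cnd (cnd Ω (x i) (x i ω)) (x j) (x j ω')) (Q i j) +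
          pr (cnd (cnd Ω (x i) (x i ω)) (x j) (x j ω')) (Q j i)))) = 5 * (pr Ω (Q i j) + pr Ω (Q j i)) := by
      simp only [ex_mul_left, ex_add]
      rw [← e2, ← e2]
    refine (ex_mono fun ω _ => ex_mono fun ω' _ => hEne i hi j hj hij _ _).trans (e3.le.trans ?_)
    have := hQav i hi j
    have := hQav j hj i
    linarith
  refine ⟨f', hAS, ?_, ?_⟩
  swap
  · -- distance
    have d1 : pr Ω (fun ω => ∃ i ∈ J, ∃ j ∈ J.erase i, G i (x i ω) j (x j ω) ≠
      f j i (x j ω) (x i ω)) ≤ J.card * (12 * B * ε) := pr_exists_le J _ hDav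
    have d2 : pr Ω (fun ω => ∃ i ∈ J, ∃ j ∈ J, i ≠ j ∧ ∃ k ∈ (J.erase i).erase j, E i j k ω) ≤
        J.card * (J.card * (10 * B * ε)) := by
      refine pr_exists_le J _ fun i hi => pr_exists_le J _ fun j hj => ?_
      exact pr_and_le (by positivity) (hEav i hi j hj)
    rw [hJ] at d1 d2
    have d3 : pr Ω (fun ω => ∃ i ∈ J, ∃ j ∈ J, i ≠ j ∧
        f i j (x i ω) (x j ω) ≠ f' i j (x i ω) (x j ω)) ≤ pr Ω (badT x f J) + pr Ω (fun ω =>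
        (∃ i ∈ J, ∃ j ∈ J.erase i, G i (x i ω) j (x j ω) ≠ f j i (x j ω) (x i ω)) ∨
        ∃ i ∈ J, ∃ j ∈ J, i ≠ j ∧ ∃ k ∈ (J.erase i).erase j, E i j k ω) := by
      refine pr_le_of_imp_or ?_
      rintro ω hω ⟨i, hi, j, hj, hij, hne⟩
      by_contra hcon; push Not at hcon
      obtain ⟨c1, c2, c3⟩ := hcon
      have h2 : ((J.erase i).erase j).card = 2 := by
        rw [Finset.card_erase_of_mem (Finset.mem_erase.2 ⟨hij.symm, hj⟩),
          Finset.card_erase_of_mem hi, hJ]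
      obtain ⟨k, hk⟩ := Finset.card_pos.1 (by omega : 0 < ((J.erase i).erase j).card)
      have hk' := hk
      simp only [Finset.mem_erase] at hk'
      have b1 := c3 i hi j hj hij k hk
      simp only [hE, not_not] at b1
      have b2 := c2 i hi k (by simp [hk'])
      have b3 := c2 j hj k (by simp [hk'])
      have b4 : tri x f i j k ω := by
        by_contra hh
        exact c1 ⟨i, hi, j, hj, k, hk'.2.2, hij, hk'.1.symm, hk'.2.1.symm, hh⟩
      apply hne
      rw [← b1, b2, b3]
      unfold tri at b4
      rw [mul_eq_one_iff_eq_inv] at b4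
      rw [← b4, hf k j _ _ hk'.1]; group
    have d4 := d3.trans (add_le_add_right (pr_or _ _) _)
    have d5 := mul_le_mul_of_nonneg_right hB hε0
    push_cast at d1 d2
    linarith
  -- triangles
  have s3 : ∀ i ∈ J, pr Ω (fun ω => 1 / (160 * B) < pr (cnd Ω (x i) (x i ω)) (badT x f (J.erase i)))
      ≤ 921600 * l ^ 2 * B ^ 2 * ε := by
    intro i hi
    have h3 : (J.erase i).card = 3 := by rw [Finset.card_erase_of_mem hi, hJ]
    obtain ⟨j, k, m, hjk, hjm, hkm, hJe⟩ := Finset.card_eq_three.1 h3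
    have hj : j ∈ J.erase i := by rw [hJe]; simp
    have hk : k ∈ J.erase i := by rw [hJe]; simp
    have hm : m ∈ J.erase i := by rw [hJe]; simp
    simp only [Finset.mem_erase] at hj hk hm
    have hD : Dec Ω (x i) (fun ω => ind (badT x f (J.erase i) ω)) (3 * l) := by
      refine Dec_of_dep3 hl0.le (hPE.p0 i hi j hj.2 hj.1.symm)
        (fun a => hPE.p1 i hi k hk.2 hk.1.symm j hj.2 a hj.1 hjk)
        (fun a b => hPE.p2 i hi m hm.2 hm.1.symm j hj.2 k hk.2 a b hj.1 hjm hk.1 hkm hjk) ?_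
      intro ω _ ω' _ h1 h2 h3
      rw [badT_congr (ω := ω) (ω' := ω')]
      intro t ht
      rw [hJe] at ht
      simp only [Finset.mem_insert, Finset.mem_singleton] at ht
      rcases ht with rfl | rfl | rfl <;> assumption
    have hle : pr Ω (badT x f (J.erase i)) ≤ ε :=
      pr_mono fun ω _ h => badT_mono (Finset.erase_subset _ _) h
    have := samp (t := 1 / (320 * B)) (by positivity) (by positivity) hD
    rw [ind_false (not_lt.2 (hle.trans hsmall))] at this
    rw [show 2 * (1 / (320 * B)) = 1 / (160 * B) by field_simp; norm_num] at this
    refine this.trans ?_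
    rw [add_zero]
    have e : (3 * l) ^ 2 / (1 / (320 * B)) ^ 2 = 921600 * l ^ 2 * B ^ 2 := by field_simp; ring
    rw [e]
    gcongr
  have s2 : ∀ i ∈ J, ∀ j ∈ J, i ≠ j → pr Ω (fun ω => 1 / 80 <
      pr (cnd (cnd Ω (x i) (x i ω)) (x j) (x j ω)) (Q i j)) ≤
      102400 * l ^ 2 * (B * ε) + 921600 * l ^ 2 * B ^ 2 * ε := by
    intro i hi j hj hij
    have h2 : ((J.erase i).erase j).card = 2 := by
      rw [Finset.card_erase_of_mem (Finset.mem_erase.2 ⟨hij.symm, hj⟩),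
        Finset.card_erase_of_mem hi, hJ]
    obtain ⟨k, m, hkm, hJe⟩ := Finset.card_eq_two.1 h2
    have hk : k ∈ (J.erase i).erase j := by rw [hJe]; simp
    have hm : m ∈ (J.erase i).erase j := by rw [hJe]; simp
    simp only [Finset.mem_erase] at hk hm
    have loc : ∀ v, pr (cnd Ω (x i) v) (fun ω => 1 / 80 < pr (cnd (cnd Ω (x i) v) (x j) (x j ω)) (Q i j))
        ≤ 102400 * l ^ 2 * pr (cnd Ω (x i) v) (Q i j) +
          ind (1 / (160 * B) < pr (cnd Ω (x i) v) (badT x f (J.erase i))) := by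
      intro v
      have hD : Dec (cnd Ω (x i) v) (x j) (fun ω => ind (Q i j ω)) (2 * l) := by
        refine Dec_of_dep2 hl0.le (hPE.p1 j hj k hk.2.2 hk.1.symm i hi v hij hk.2.1.symm)
          (fun a => hPE.p2 j hj m hm.2.2 hm.1.symm i hi k hk.2.2 v a hij hm.2.1.symm hk.1 hkm
            hk.2.1.symm) ?_
        intro ω hω ω' hω' h1 h2
        simp only [hQ]
        rw [(mem_cnd.1 hω).2, (mem_cnd.1 hω').2, badE_congr (ω := ω) (ω' := ω')]
        intro t ht
        rw [hJe] at ht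
        simp only [Finset.mem_insert, Finset.mem_singleton] at ht
        rcases ht with rfl | rfl <;> assumption
      have := samp (t := 1 / 160) (by positivity) (by positivity) hD
      rw [show (2 : ℝ) * (1 / 160) = 1 / 80 by norm_num,
        show (2 * l) ^ 2 / (1 / 160) ^ 2 = 102400 * l ^ 2 by ring] at this
      refine this.trans ?_
      gcongr
      refine ind_mono fun hh => ?_
      have h1 : pr (cnd Ω (x i) v) (Q i j) ≤ B * pr (cnd Ω (x i) v) (badT x f (J.erase i)) := by
        refine le_trans (pr_mono ?_) (hG i v hi).1
        rintro ω hω ⟨a, ha, b, hb, h⟩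
        rw [(mem_cnd.1 hω).2] at h
        exact ⟨a, Finset.mem_of_mem_erase ha, b, Finset.mem_of_mem_erase hb, h⟩
      have h2 := hh.trans_le h1
      rw [div_lt_iff₀ (by positivity)]
      rw [div_lt_iff₀ (by positivity)] at h2
      linarith
    have e1 := ex_tower' (Ω := Ω) (x i) (fun v ω => ind (1 / 80 <
      pr (cnd (cnd Ω (x i) v) (x j) (x j ω)) (Q i j)))
    refine (le_of_eq e1.symm).trans ?_
    refine (ex_mono fun ω _ => loc (x i ω)).trans ?_
    rw [ex_add, ex_mul_left, pr_tower]
    refine add_le_add ?_ (s3 i hi)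
    exact mul_le_mul_of_nonneg_left (hQav i hi j) (by positivity)
  set S : ℕ → ℕ → ℕ → X → Prop := fun i j k ω => 1 / 4 <
    pr (cnd (cnd (cnd Ω (x i) (x i ω)) (x j) (x j ω)) (x k) (x k ω))
      (fun ω' => ∃ m ∈ ((J.erase i).erase j).erase k, E i j m ω') with hS
  have s1 : ∀ i ∈ J, ∀ j ∈ J, ∀ k ∈ J, i ≠ j → j ≠ k → i ≠ k → pr Ω (S i j k) ≤
      2048640 * l ^ 2 * B ^ 2 * ε := by
    intro i hi j hj k hk hij hjk hik
    have hke : k ∈ (J.erase i).erase j := by simp [hk, hjk.symm, hik.symm]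
    have h1 : (((J.erase i).erase j).erase k).card = 1 := by
      rw [Finset.card_erase_of_mem hke,
        Finset.card_erase_of_mem (Finset.mem_erase.2 ⟨hij.symm, hj⟩),
        Finset.card_erase_of_mem hi, hJ]
    obtain ⟨m, hJe⟩ := Finset.card_eq_one.1 h1
    have hm : m ∈ ((J.erase i).erase j).erase k := by rw [hJe]; simp
    simp only [Finset.mem_erase] at hm
    set p : X → Prop := fun ω' => ∃ m ∈ ((J.erase i).erase j).erase k, E i j m ω' with hp
    have loc : ∀ v v', pr (cnd (cnd Ω (x i) v) (x j) v') (fun ω => 1 / 4 <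
        pr (cnd (cnd (cnd Ω (x i) v) (x j) v') (x k) (x k ω)) p) ≤
        64 * l ^ 2 * pr (cnd (cnd Ω (x i) v) (x j) v') (fun ω => ∃ k ∈ (J.erase i).erase j, E i j k ω)
        + (ind (1 / 80 < pr (cnd (cnd Ω (x i) v) (x j) v') (Q i j)) +
          ind (1 / 80 < pr (cnd (cnd Ω (x j) v') (x i) v) (Q j i))) := by
      intro v v'
      have hD : Dec (cnd (cnd Ω (x i) v) (x j) v') (x k) (fun ω => ind (p ω)) l := by
        refine Dec_of_dep (hPE.p2 k hk m hm.2.2.2 hm.1.symm i hi j hj v v' hik hm.2.2.1.symm hjk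
          hm.2.1.symm hij) ?_
        intro ω hω ω' hω' h1
        rw [mem_cnd, mem_cnd] at hω hω'
        simp only [hp, hJe, Finset.mem_singleton, exists_eq_left, hE]
        rw [hω.1.2, hω.2, hω'.1.2, hω'.2, h1]
      have hpp : pr (cnd (cnd Ω (x i) v) (x j) v') p ≤ pr (cnd (cnd Ω (x i) v) (x j) v')
          (fun ω => ∃ k ∈ (J.erase i).erase j, E i j k ω) := by
        refine pr_mono ?_
        rintro ω _ ⟨m, hm, h⟩
        exact ⟨m, Finset.mem_of_mem_erase hm, h⟩
      have := samp (t := 1 / 8) (by positivity) (by positivity) hD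
      rw [show (2 : ℝ) * (1 / 8) = 1 / 4 by norm_num,
        show l ^ 2 / (1 / 8) ^ 2 = 64 * l ^ 2 by ring] at this
      refine this.trans (add_le_add (mul_le_mul_of_nonneg_left hpp (by positivity)) ?_)
      refine le_trans (ind_mono fun hh => ?_) (ind_or_le _ _)
      have h2 := hh.trans_le (hpp.trans (hEne i hi j hj hij v v'))
      by_contra hcon; push Not at hcon
      obtain ⟨c1, c2⟩ := hcon
      rw [cnd_comm] at c2
      linarith
    have e2 : ∀ φ : V → V → X → ℝ, ex Ω (fun ω => φ (x i ω) (x j ω) ω) =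
        ex Ω (fun ω => ex (cnd Ω (x i) (x i ω)) (fun ω' =>
        ex (cnd (cnd Ω (x i) (x i ω)) (x j) (x j ω')) (φ (x i ω) (x j ω')))) := by
      intro φ
      rw [← ex_tower' (x i) (fun v ω => φ v (x j ω) ω)]
      refine ex_congr fun ω _ => ?_
      rw [← ex_tower' (x j) (fun v' ω' => φ (x i ω) v' ω')]
    have e3 := e2 (fun v v' ω => ind (1 / 4 <
        pr (cnd (cnd (cnd Ω (x i) v) (x j) v') (x k) (x k ω)) p))
    refine (le_of_eq e3).trans ?_
    refine (ex_mono fun ω _ => ex_mono fun ω' _ => loc (x i ω) (x j ω')).trans ?_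
    have e4 : ex Ω (fun ω => ex (cnd Ω (x i) (x i ω)) (fun ω' =>
        64 * l ^ 2 * pr (cnd (cnd Ω (x i) (x i ω)) (x j) (x j ω'))
          (fun ω => ∃ k ∈ (J.erase i).erase j, E i j k ω)
        + (ind (1 / 80 < pr (cnd (cnd Ω (x i) (x i ω)) (x j) (x j ω')) (Q i j)) +
          ind (1 / 80 < pr (cnd (cnd Ω (x j) (x j ω')) (x i) (x i ω)) (Q j i))))) =
        64 * l ^ 2 * pr Ω (fun ω => ∃ k ∈ (J.erase i).erase j, E i j k ω) +
        (pr Ω (fun ω => 1 / 80 < pr (cnd (cnd Ω (x i) (x i ω)) (x j) (x j ω)) (Q i j)) +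
         pr Ω (fun ω => 1 / 80 < pr (cnd (cnd Ω (x j) (x j ω)) (x i) (x i ω)) (Q j i))) := by
      have a1 := e2 (fun _ _ ω => ind (∃ k ∈ (J.erase i).erase j, E i j k ω))
      have a2 := ex_tower' (Ω := Ω) (x i)
        (fun v ω => ind (1 / 80 < pr (cnd (cnd Ω (x i) v) (x j) (x j ω)) (Q i j)))
      have a3 := ex_tower' (Ω := Ω) (x i)
        (fun v ω => ind (1 / 80 < pr (cnd (cnd Ω (x j) (x j ω)) (x i) v) (Q j i)))
      simp only [ex_add, ex_mul_left]
      rw [show pr Ω (fun ω => ∃ k ∈ (J.erase i).erase j, E i j k ω) = _ from a1,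
        show pr Ω (fun ω => 1 / 80 < pr (cnd (cnd Ω (x i) (x i ω)) (x j) (x j ω)) (Q i j)) = _
          from a2.symm,
        show pr Ω (fun ω => 1 / 80 < pr (cnd (cnd Ω (x j) (x j ω)) (x i) (x i ω)) (Q j i)) = _
          from a3.symm]
      rfl
    rw [e4]
    have b1 := mul_le_mul_of_nonneg_left (hEav i hi j hj hij) (by positivity : 0 ≤ 64 * l ^ 2)
    have b2 := s2 i hi j hj hij
    have b3 := s2 j hj i hi hij.symm
    have b4 : l ^ 2 * (B * ε) ≤ l ^ 2 * B ^ 2 * ε := by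
      rw [mul_assoc]
      refine mul_le_mul_of_nonneg_left ?_ (by positivity)
      refine mul_le_mul_of_nonneg_right ?_ hε0
      nlinarith
    nlinarith
  have s0 : pr Ω (badT x f' J) ≤ pr Ω (fun ω => ∃ i ∈ J, ∃ j ∈ J, ∃ k ∈ J,
      (i ≠ j ∧ j ≠ k ∧ i ≠ k) ∧ S i j k ω) := by
    refine pr_mono ?_
    rintro ω hω ⟨i, hi, j, hj, k, hk, hij, hjk, hik, hbad⟩
    by_contra hcon; push Not at hcon
    set Ω3 := cnd (cnd (cnd Ω (x i) (x i ω)) (x j) (x j ω)) (x k) (x k ω) with hΩ3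
    have hω3 : ω ∈ Ω3 := by simp [hΩ3, mem_cnd, hω]
    set R := ((J.erase i).erase j).erase k with hR
    have c1 : pr Ω3 (fun ω' => ∃ m ∈ R, E i j m ω') ≤ 1 / 4 := by
      have := hcon i hi j hj k hk ⟨hij, hjk, hik⟩
      simp only [hS, not_lt] at this
      exact this
    have c2 : pr Ω3 (fun ω' => ∃ m ∈ R, E j k m ω') ≤ 1 / 4 := by
      have := hcon j hj k hk i hi ⟨hjk, hik.symm, hij.symm⟩
      simp only [hS, not_lt] at this
      rw [cnd_comm (x k) (x i), cnd_comm (x j) (x i)] at this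
      rw [show R = ((J.erase j).erase k).erase i by
        rw [hR]; ext t; simp only [Finset.mem_erase]; tauto]
      exact this
    have c3 : pr Ω3 (fun ω' => ∃ m ∈ R, E k i m ω') ≤ 1 / 4 := by
      have := hcon k hk i hi j hj ⟨hik.symm, hij, hjk.symm⟩
      simp only [hS, not_lt] at this
      rw [cnd_comm (x k) (x i), cnd_comm (x k) (x j)] at this
      rw [show R = ((J.erase k).erase i).erase j by
        rw [hR]; ext t; simp only [Finset.mem_erase]; tauto]
      exact this
    have hke : k ∈ (J.erase i).erase j := by simp [hk, hjk.symm, hik.symm]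
    have h1 : R.card = 1 := by
      rw [hR, Finset.card_erase_of_mem hke,
        Finset.card_erase_of_mem (Finset.mem_erase.2 ⟨hij.symm, hj⟩),
        Finset.card_erase_of_mem hi, hJ]
    obtain ⟨m, hm⟩ := Finset.card_pos.1 (by omega : 0 < R.card)
    have c4 : pr Ω3 (fun _ => True) ≤ pr Ω3 (fun ω' => ∃ m ∈ R, E i j m ω') +
        pr Ω3 (fun ω' => (∃ m ∈ R, E j k m ω') ∨ ∃ m ∈ R, E k i m ω') := by
      refine pr_le_of_imp_or ?_
      intro ω' hω' _
      by_contra hc; push Not at hc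
      obtain ⟨n1, n2, n3⟩ := hc
      have n1 := n1 m hm
      have n2 := n2 m hm
      have n3 := n3 m hm
      simp only [hE, not_not] at n1 n2 n3
      simp only [hΩ3, mem_cnd] at hω'
      apply hbad
      unfold tri
      rw [← hω'.1.1.2, ← hω'.1.2, ← hω'.2]
      rw [← n1, ← n2, ← n3]; group
    have c5 : pr Ω3 (fun _ => True) = 1 := by
      unfold pr
      rw [ex_congr (ψ := fun _ => (1 : ℝ)) fun _ _ => ind_true trivial]
      exact ex_const ⟨ω, hω3⟩ 1
    have c6 := pr_or (Ω := Ω3) (fun ω' => ∃ m ∈ R, E j k m ω') (fun ω' => ∃ m ∈ R, E k i m ω')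
    linarith
  have hpos : 0 ≤ 2048640 * l ^ 2 * B ^ 2 * ε := by positivity
  have s4 : pr Ω (fun ω => ∃ i ∈ J, ∃ j ∈ J, ∃ k ∈ J,
      (i ≠ j ∧ j ≠ k ∧ i ≠ k) ∧ S i j k ω) ≤
      J.card * (J.card * (J.card * (2048640 * l ^ 2 * B ^ 2 * ε))) := by
    refine pr_exists_le J _ fun i hi => pr_exists_le J _ fun j hj => pr_exists_le J _ fun k hk => ?_
    exact pr_and_le hpos fun h => s1 i hi j hj k hk h.1 h.2.1 h.2.2
  rw [hJ] at s4
  have hlB : l * B ≤ 1 / 20000 := by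
    rw [le_div_iff₀ (by positivity)] at hl
    rw [le_div_iff₀ (by positivity)]; linarith
  have hlB2 : l ^ 2 * B ^ 2 ≤ 1 / 400000000 := by
    rw [← mul_pow]
    calc (l * B) ^ 2 ≤ (1 / 20000) ^ 2 := by gcongr
      _ = _ := by norm_num
  have hfin := mul_le_mul_of_nonneg_right hlB2 hε0
  push_cast at s4
  linarith

/-- The local-to-global lemma. -/
lemma M_lemma {J : Finset ℕ} {B l : ℝ} (hB : 1 ≤ B)
    (hl0 : 0 < l) (hl : l ≤ 1 / (20000 * B)) (hJ : J.card = 4) (hPE : PEall Ω x J l)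
    (hC : ∀ i ∈ J, ∀ v, Cob Γ (cnd Ω (x i) v) x (J.erase i) B)
    (hH : ∀ f : ℕ → ℕ → V → V → Γ, AS f → (∀ ω ∈ Ω, ¬ badT x f J ω) →
      ∃ g : ℕ → V → Γ, ∀ ω ∈ Ω, ¬ badE x f g J ω) : Cob Γ Ω x J (800 * B) := by
  have main : ∀ n : ℕ, ∀ f : ℕ → ℕ → V → V → Γ, AS f → (Ω.filter (badT x f J)).card ≤ n →
      ∃ g : ℕ → V → Γ, pr Ω (badE x f g J) ≤ 800 * B * pr Ω (badT x f J) := by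
    intro n
    induction n with
    | zero =>
      intro f hf hn
      have h0 : ∀ ω ∈ Ω, ¬ badT x f J ω := by
        intro ω hω hb
        have : ω ∈ Ω.filter (badT x f J) := by simp [hω, hb]
        have := Finset.card_pos.2 ⟨ω, this⟩
        omega
      obtain ⟨g, hg⟩ := hH f hf h0
      refine ⟨g, ?_⟩
      have : pr Ω (badE x f g J) ≤ pr Ω (badT x f J) :=
        pr_mono fun ω hω h => absurd h (hg ω hω)
      refine this.trans ?_
      have := pr_nonneg (Ω := Ω) (badT x f J)
      nlinarith
    | succ n ih =>
      intro f hf hn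
      by_cases hn' : (Ω.filter (badT x f J)).card ≤ n
      · exact ih f hf hn'
      by_cases hs : pr Ω (badT x f J) ≤ 1 / (320 * B)
      swap
      · refine ⟨fun _ _ => 1, (pr_le_one _).trans ?_⟩
        push Not at hs
        rw [div_lt_iff₀ (by positivity)] at hs
        nlinarith
      obtain ⟨f', hf', h1, h2⟩ := improve hf hB hl0 hl hJ hPE hC hs
      have hcard : ∀ p : X → Prop, pr Ω p = ((Ω.filter p).card : ℝ) / Ω.card := by
        intro p; unfold pr ex ind; rw [Finset.sum_boole]
      have hlt : (Ω.filter (badT x f' J)).card ≤ n := by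
        have hpos : 0 < (Ω.filter (badT x f J)).card := by omega
        have hΩ : 0 < Ω.card := hpos.trans_le (Finset.card_filter_le _ _)
        rw [hcard, hcard, div_div, mul_comm, ← div_div,
          div_le_div_iff_of_pos_right (by exact_mod_cast hΩ)] at h1
        have h3 : ((Ω.filter (badT x f' J)).card : ℝ) < (Ω.filter (badT x f J)).card := by
          have : (0 : ℝ) < (Ω.filter (badT x f J)).card := by exact_mod_cast hpos
          linarith
        have h4 : (Ω.filter (badT x f' J)).card < (Ω.filter (badT x f J)).card := by
          exact_mod_cast h3
        omega
      obtain ⟨g, hg⟩ := ih f' hf' hlt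
      refine ⟨g, ?_⟩
      have h5 := pr_le_of_imp_or (Ω := Ω) (p := badE x f g J) (q := badE x f' g J)
        (r := fun ω => ∃ i ∈ J, ∃ j ∈ J, i ≠ j ∧ f i j (x i ω) (x j ω) ≠ f' i j (x i ω) (x j ω)) (by
          rintro ω _ ⟨i, hi, j, hj, hij, h⟩
          by_cases he : f i j (x i ω) (x j ω) = f' i j (x i ω) (x j ω)
          · left; refine ⟨i, hi, j, hj, hij, ?_⟩
            unfold edg at *; rw [← he]; exact h
          · right; exact ⟨i, hi, j, hj, hij, he⟩)
      have h6 := pr_nonneg (Ω := Ω) (badT x f J)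
      have h7 : 800 * B * pr Ω (badT x f' J) ≤ 800 * B * (pr Ω (badT x f J) / 2) := by gcongr
      have h8 : 0 ≤ B * pr Ω (badT x f J) := by positivity
      linarith
  intro f hf
  exact main _ f hf le_rfl

end mlemma
end CB

/-! ### Cones, averaged over a transitive group -/

namespace CB

section cone
variable {X V Γ : Type} [Group Γ]

/-- The data used for the cone argument. -/
structure ConeData (Ω : Finset X) (x : ℕ → X → V) (i j k : ℕ) where
  le : V → V → Prop
  A : V → Prop
  B : V → Prop
  C : V → Prop
  trans : ∀ u v w, le u v → le v w → le u w
  hA : ∀ ω ∈ Ω, A (x i ω)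
  hB : ∀ ω ∈ Ω, B (x j ω)
  hC : ∀ ω ∈ Ω, C (x k ω)
  hAB : ∀ ω ∈ Ω, le (x i ω) (x j ω)
  hBC : ∀ ω ∈ Ω, le (x j ω) (x k ω)
  hT : ∀ u v w, A u → B v → C w → le u v → le v w → ∃ ω ∈ Ω, x i ω = u ∧ x j ω = v ∧ x k ω = w
  H1 : ∀ u v w, A u → A v → A w → ∃ P, C P ∧ le u P ∧ le v P ∧ le w P
  H2 : ∀ u v P, A u → A v → C P → le u P → le v P → ∃ l, B l ∧ le u l ∧ le v l ∧ le l P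
  H3 : ∀ u v l l', A u → A v → B l → B l' → le u l → le v l → le u l' → le v l' →
    ∃ l'' P1 P2, B l'' ∧ C P1 ∧ C P2 ∧ le u l'' ∧ le v l'' ∧ le l P1 ∧ le l'' P1 ∧ le l'' P2 ∧
      le l' P2

def Filled (Γ : Type) [Group Γ] (Ω : Finset X) (x : ℕ → X → V) (i j k : ℕ) (n : ℕ)
    (Q : (ℕ → ℕ → V → V → Γ) → Prop) : Prop :=
  ∃ D : Finset X, D ⊆ Ω ∧ D.card ≤ n ∧ ∀ f : ℕ → ℕ → V → V → Γ, (∀ ω ∈ D, tri x f i j k ω) →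
    AS f → Q f

variable {Ω : Finset X} {x : ℕ → X → V} {i j k : ℕ}

lemma Filled.and {n m : ℕ} {P Q R : (ℕ → ℕ → V → V → Γ) → Prop}
    (h1 : Filled Γ Ω x i j k n P) (h2 : Filled Γ Ω x i j k m Q)
    (h : ∀ f, P f → Q f → R f) : Filled Γ Ω x i j k (n + m) R := by
  obtain ⟨D1, s1, c1, q1⟩ := h1
  obtain ⟨D2, s2, c2, q2⟩ := h2
  refine ⟨D1 ∪ D2, Finset.union_subset s1 s2, (Finset.card_union_le _ _).trans (by omega), ?_⟩
  intro f hf hAS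
  exact h f (q1 f (fun ω hω => hf ω (Finset.mem_union_left _ hω)) hAS)
    (q2 f (fun ω hω => hf ω (Finset.mem_union_right _ hω)) hAS)


lemma fill_tri (cd : ConeData Ω x i j k) (hik : i ≠ k) {u v w : V} (hu : cd.A u) (hv : cd.B v) (hw : cd.C w) (h1 : cd.le u v)
    (h2 : cd.le v w) : Filled Γ Ω x i j k 1 (fun f => f i j u v * f j k v w = f i k u w) := by
  obtain ⟨ω, hω, rfl, rfl, rfl⟩ := cd.hT u v w hu hv hw h1 h2
  refine ⟨{ω}, by simpa using hω, by simp, fun f hf hAS => ?_⟩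
  have := hf ω (by simp)
  unfold tri at this
  rw [hAS k i _ _ hik.symm, mul_inv_eq_one] at this
  exact this

lemma fill_two (cd : ConeData Ω x i j k) (hik : i ≠ k) {u u' v w : V} (hu : cd.A u) (hu' : cd.A u') (hv : cd.B v) (hw : cd.C w)
    (h1 : cd.le u v) (h1' : cd.le u' v) (h2 : cd.le v w) : Filled Γ Ω x i j k 2
    (fun f => f i j u v * (f i j u' v)⁻¹ = f i k u w * (f i k u' w)⁻¹) :=
  (fill_tri cd hik hu hv hw h1 h2).and (fill_tri cd hik hu' hv hw h1' h2) fun f a b => by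
    rw [← a, ← b]; group

lemma fill_bigon (cd : ConeData Ω x i j k) (hik : i ≠ k) {u u' v v' : V} (hu : cd.A u) (hu' : cd.A u') (hv : cd.B v) (hv' : cd.B v')
    (h1 : cd.le u v) (h2 : cd.le u' v) (h3 : cd.le u v') (h4 : cd.le u' v') :
    Filled Γ Ω x i j k 8
    (fun f => f i j u v * (f i j u' v)⁻¹ = f i j u v' * (f i j u' v')⁻¹) := by
  obtain ⟨l, P1, P2, hl, hP1, hP2, a1, a2, a3, a4, a5, a6⟩ :=
    cd.H3 u u' v v' hu hu' hv hv' h1 h2 h3 h4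
  have b1 : Filled Γ Ω x i j k 4
      (fun f => f i j u v * (f i j u' v)⁻¹ = f i j u l * (f i j u' l)⁻¹) :=
    (fill_two cd hik hu hu' hv hP1 h1 h2 a3).and (fill_two cd hik hu hu' hl hP1 a1 a2 a4)
      fun f a b => a.trans b.symm
  have b2 : Filled Γ Ω x i j k 4
      (fun f => f i j u l * (f i j u' l)⁻¹ = f i j u v' * (f i j u' v')⁻¹) :=
    (fill_two cd hik hu hu' hl hP2 a1 a2 a5).and (fill_two cd hik hu hu' hv' hP2 h3 h4 a6)
      fun f a b => a.trans b.symm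
  exact b1.and b2 fun f a b => a.trans b

lemma fill_three (cd : ConeData Ω x i j k) (hik : i ≠ k) {p u u' l l1 l2 : V} (hp : cd.A p) (hu : cd.A u) (hu' : cd.A u')
    (hl : cd.B l) (hl1 : cd.B l1) (hl2 : cd.B l2)
    (h1 : cd.le u l) (h2 : cd.le u' l) (h3 : cd.le p l1) (h4 : cd.le u l1)
    (h5 : cd.le p l2) (h6 : cd.le u' l2) : Filled Γ Ω x i j k 30
    (fun f => f i j u l1 * (f i j p l1)⁻¹ =
      (f i j u l * (f i j u' l)⁻¹) * (f i j u' l2 * (f i j p l2)⁻¹)) := by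
  obtain ⟨P, hP, a1, a2, a3⟩ := cd.H1 p u u' hp hu hu'
  obtain ⟨m, hm, b1, b2, b3⟩ := cd.H2 u u' P hu hu' hP a2 a3
  obtain ⟨m1, hm1, c1, c2, c3⟩ := cd.H2 u p P hu hp hP a2 a1
  obtain ⟨m2, hm2, d1, d2, d3⟩ := cd.H2 u' p P hu' hp hP a3 a1
  have e := (fill_bigon (Γ := Γ) cd hik hu hu' hl hm h1 h2 b1 b2).and
    (fill_two cd hik hu hu' hm hP b1 b2 b3) fun f a b => a.trans b
  have e1 := (fill_bigon (Γ := Γ) cd hik hu hp hl1 hm1 h4 h3 c1 c2).and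
    (fill_two cd hik hu hp hm1 hP c1 c2 c3) fun f a b => a.trans b
  have e2 := (fill_bigon (Γ := Γ) cd hik hu' hp hl2 hm2 h6 h5 d1 d2).and
    (fill_two cd hik hu' hp hm2 hP d1 d2 d3) fun f a b => a.trans b
  refine ((e.and e1 (R := fun f => (f i j u l * (f i j u' l)⁻¹ = f i k u P * (f i k u' P)⁻¹) ∧
    (f i j u l1 * (f i j p l1)⁻¹ = f i k u P * (f i k p P)⁻¹)) fun f a b => ⟨a, b⟩).and e2
    fun f a b => ?_)
  rw [a.1, a.2, b]; group

/-- The cone lemma without averaging. -/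
lemma cone_basic (cd : ConeData Ω x i j k) (hij : i ≠ j) (hjk : j ≠ k) (hik : i ≠ k) (hne : Ω.Nonempty) :
    ∃ g : (ℕ → ℕ → V → V → Γ) → ℕ → V → Γ, ∀ ω ∈ Ω,
      Filled Γ Ω x i j k 63 (fun f => ¬ badE x f (g f) {i, j, k} ω) := by
  obtain ⟨ω0, hω0⟩ := hne
  set p := x i ω0 with hp
  have hpA : cd.A p := cd.hA ω0 hω0
  have hL : ∀ u, ∃ l, cd.A u → cd.B l ∧ cd.le p l ∧ cd.le u l := by
    intro u
    by_cases hu : cd.A u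
    · obtain ⟨P, hP, a1, a2, _⟩ := cd.H1 p u u hpA hu hu
      obtain ⟨l, hl, b1, b2, _⟩ := cd.H2 p u P hpA hu hP a1 a2
      exact ⟨l, fun _ => ⟨hl, b1, b2⟩⟩
    · exact ⟨p, fun h => absurd h hu⟩
  choose L hL using hL
  have hY : ∀ v, ∃ u, (∃ ω ∈ Ω, x j ω = v) → cd.A u ∧ cd.le u v := by
    intro v
    by_cases hv : ∃ ω ∈ Ω, x j ω = v
    · obtain ⟨ω, hω, rfl⟩ := hv
      exact ⟨x i ω, fun _ => ⟨cd.hA ω hω, cd.hAB ω hω⟩⟩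
    · exact ⟨p, fun h => absurd h hv⟩
  choose Y hY using hY
  have hZ : ∀ v, ∃ u, (∃ ω ∈ Ω, x k ω = v) → cd.A u ∧ cd.le u v := by
    intro v
    by_cases hv : ∃ ω ∈ Ω, x k ω = v
    · obtain ⟨ω, hω, rfl⟩ := hv
      exact ⟨x i ω, fun _ => ⟨cd.hA ω hω, cd.trans _ _ _ (cd.hAB ω hω) (cd.hBC ω hω)⟩⟩
    · exact ⟨p, fun h => absurd h hv⟩
  choose Z hZ using hZ
  set g0 : (ℕ → ℕ → V → V → Γ) → V → Γ := fun f u => f i j u (L u) * (f i j p (L u))⁻¹ with hg0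
  set g : (ℕ → ℕ → V → V → Γ) → ℕ → V → Γ := fun f t v =>
    if t = i then g0 f v else if t = j then (f i j (Y v) v)⁻¹ * g0 f (Y v)
    else (f i k (Z v) v)⁻¹ * g0 f (Z v) with hg
  refine ⟨g, fun ω hω => ?_⟩
  have claim1 : ∀ u u' l, cd.A u → cd.A u' → cd.B l → cd.le u l → cd.le u' l →
      Filled Γ Ω x i j k 30 (fun f => g0 f u = (f i j u l * (f i j u' l)⁻¹) * g0 f u') := by
    intro u u' l hu hu' hl h1 h2
    obtain ⟨a1, a2, a3⟩ := hL u hu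
    obtain ⟨b1, b2, b3⟩ := hL u' hu'
    exact fill_three cd hik hpA hu hu' hl a1 b1 h1 h2 a2 a3 b2 b3
  set u := x i ω with hu
  set v := x j ω with hv
  set w := x k ω with hw
  obtain ⟨y1, y2⟩ := hY v ⟨ω, hω, rfl⟩
  obtain ⟨z1, z2⟩ := hZ w ⟨ω, hω, rfl⟩
  have uA := cd.hA ω hω
  have vB := cd.hB ω hω
  have wC := cd.hC ω hω
  have uv := cd.hAB ω hω
  have vw := cd.hBC ω hω
  have uw := cd.trans _ _ _ uv vw
  have s1 := claim1 u (Y v) v uA y1 vB uv y2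
  obtain ⟨m, hm, m1, m2, m3⟩ := cd.H2 u (Z w) w uA z1 wC uw z2
  have s2 := (claim1 u (Z w) m uA z1 hm m1 m2).and (fill_two cd hik uA z1 hm wC m1 m2 m3)
    (R := fun f => g0 f u = (f i k u w * (f i k (Z w) w)⁻¹) * g0 f (Z w))
    fun f a b => by rw [a, b]
  have s3 := fill_tri (Γ := Γ) cd hik uA vB wC uv vw
  have s4 := (s1.and s2 (R := fun f =>
    (g0 f u = (f i j u v * (f i j (Y v) v)⁻¹) * g0 f (Y v)) ∧
    (g0 f u = (f i k u w * (f i k (Z w) w)⁻¹) * g0 f (Z w))) fun f a b => ⟨a, b⟩).and s3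
    (R := fun f => f i j u v = g f i u * (g f j v)⁻¹ ∧ f i k u w = g f i u * (g f k w)⁻¹ ∧
      f j k v w = g f j v * (g f k w)⁻¹) (by
      rintro f ⟨a, b⟩ c
      change f i j u v * f j k v w = f i k u w at c
      simp only [hg, if_true, if_neg hij.symm, if_neg hik.symm, if_neg hjk.symm]
      have r1 : f i j u v = g0 f u * ((f i j (Y v) v)⁻¹ * g0 f (Y v))⁻¹ := by rw [a]; group
      have r2 : f i k u w = g0 f u * ((f i k (Z w) w)⁻¹ * g0 f (Z w))⁻¹ := by rw [b]; group
      refine ⟨r1, r2, ?_⟩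
      have r3 : f j k v w = (f i j u v)⁻¹ * f i k u w := by rw [← c]; group
      rw [r3, r2, r1]; group)
  obtain ⟨D, hD, hc, hq⟩ := s4
  refine ⟨D, hD, hc, fun f hf hAS hbad => ?_⟩
  obtain ⟨q1, q2, q3⟩ := hq f hf hAS
  have e1 : edg x f (g f) i j ω := q1
  have e2 : edg x f (g f) k i ω := edg_symm hAS hik q2
  have e3 : edg x f (g f) k j ω := edg_symm hAS hjk q3
  rcases badE_triple hAS ω hbad with h | h | h <;> contradiction

/-- The cone lemma. -/
lemma C_lemma (cd : ConeData Ω x i j k) (hij : i ≠ j) (hjk : j ≠ k) (hik : i ≠ k)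
    {H : Type} [Fintype H] [Nonempty H] (a b : H → V → V) (σ : H → X → X)
    (hab : ∀ h v, b h (a h v) = v)
    (hσ : ∀ h, ∀ ω ∈ Ω, σ h ω ∈ Ω) (hx : ∀ t h, ∀ ω ∈ Ω, x t (σ h ω) = a h (x t ω))
    (hinv : ∀ h (φ : X → ℝ), ex Ω (fun ω => φ (σ h ω)) = ex Ω φ)
    (havg : ∀ ω ∈ Ω, ∀ φ : X → ℝ, ex (Finset.univ : Finset H) (fun h => φ (σ h ω)) = ex Ω φ) :
    Cob Γ Ω x {i, j, k} 63 := by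
  intro f hf
  rcases Ω.eq_empty_or_nonempty with rfl | hne
  · exact ⟨fun _ _ => 1, by simp [pr, ex_empty]⟩
  obtain ⟨g, hg⟩ := cone_basic (Γ := Γ) cd hij hjk hik hne
  have hDD : ∀ ω, ∃ D : Finset X, ω ∈ Ω → D ⊆ Ω ∧ D.card ≤ 63 ∧ ∀ f : ℕ → ℕ → V → V → Γ,
      (∀ ω ∈ D, tri x f i j k ω) → AS f → ¬ badE x f (g f) {i, j, k} ω := by
    intro ω
    by_cases hω : ω ∈ Ω
    · obtain ⟨D, hD⟩ := hg ω hω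
      exact ⟨D, fun _ => hD⟩
    · exact ⟨∅, fun h => absurd h hω⟩
  choose D hD using hDD
  set fh : H → ℕ → ℕ → V → V → Γ := fun h t t' u v => f t t' (a h u) (a h v) with hfh
  have hfhAS : ∀ h, AS (fh h) := fun h t t' u v htt => hf _ _ _ _ htt
  set gh : H → ℕ → V → Γ := fun h t v => g (fh h) t (b h v) with hgh
  have hE : ∀ h, ∀ ω ∈ Ω, badE x f (gh h) {i, j, k} (σ h ω) ↔ badE x (fh h) (g (fh h)) {i, j, k} ω := by
    intro h ω hω
    unfold badE edg
    simp only [hx _ h ω hω, hgh, hfh, hab]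
  have hTr : ∀ h, ∀ ω ∈ Ω, tri x f i j k (σ h ω) ↔ tri x (fh h) i j k ω := by
    intro h ω hω
    unfold tri
    simp only [hx _ h ω hω, hfh]
  have hTT : pr Ω (badT x f {i, j, k}) = pr Ω (fun ω => ¬ tri x f i j k ω) :=
    pr_congr fun ω _ => badT_triple hf hij hjk hik ω
  have key : ex (Finset.univ : Finset H) (fun h => pr Ω (badE x f (gh h) {i, j, k})) ≤
      63 * pr Ω (badT x f {i, j, k}) := by
    have e1 : ∀ h, pr Ω (badE x f (gh h) {i, j, k}) ≤
        ex Ω (fun ω => ∑ ω' ∈ D ω, ind (¬ tri x f i j k (σ h ω'))) := by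
      intro h
      unfold pr
      rw [← hinv h]
      refine ex_mono fun ω hω => ?_
      obtain ⟨d1, d2, d3⟩ := hD ω hω
      by_cases hb : badE x f (gh h) {i, j, k} (σ h ω)
      · rw [ind_true hb]
        rw [hE h ω hω] at hb
        have : ∃ ω' ∈ D ω, ¬ tri x (fh h) i j k ω' := by
          by_contra hcon; push Not at hcon
          exact d3 (fh h) hcon (hfhAS h) hb
        obtain ⟨ω', hω', ht⟩ := this
        rw [← hTr h ω' (d1 hω')] at ht
        rw [← ind_true ht]
        exact Finset.single_le_sum (f := fun ω' => ind (¬ tri x f i j k (σ h ω')))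
          (fun _ _ => ind_nonneg _) hω'
      · rw [ind_false hb]; exact Finset.sum_nonneg fun _ _ => ind_nonneg _
    refine (ex_mono fun h _ => e1 h).trans ?_
    have e2 : ex (Finset.univ : Finset H) (fun h => ex Ω (fun ω => ∑ ω' ∈ D ω,
        ind (¬ tri x f i j k (σ h ω')))) = ex Ω (fun ω => ex (Finset.univ : Finset H) (fun h =>
        ∑ ω' ∈ D ω, ind (¬ tri x f i j k (σ h ω')))) := by
      unfold ex
      simp only [Finset.sum_div]
      rw [Finset.sum_comm]
      refine Finset.sum_congr rfl fun ω _ => Finset.sum_congr rfl fun h _ => ?_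
      refine Finset.sum_congr rfl fun ω' _ => ?_
      rw [div_right_comm]
    rw [e2]
    rw [← ex_const hne (63 * pr Ω (badT x f {i, j, k}))]
    refine ex_mono fun ω hω => ?_
    obtain ⟨d1, d2, d3⟩ := hD ω hω
    rw [ex_sum, hTT]
    calc ∑ ω' ∈ D ω, ex (Finset.univ : Finset H) (fun h => ind (¬ tri x f i j k (σ h ω')))
        = ∑ ω' ∈ D ω, pr Ω (fun ω => ¬ tri x f i j k ω) :=
          Finset.sum_congr rfl fun ω' hω' => havg ω' (d1 hω') (fun ω => ind (¬ tri x f i j k ω))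
      _ = (D ω).card * pr Ω (fun ω => ¬ tri x f i j k ω) := by rw [Finset.sum_const, nsmul_eq_mul]
      _ ≤ _ := by
        refine mul_le_mul_of_nonneg_right ?_ (pr_nonneg _)
        exact_mod_cast d2
  obtain ⟨h, _, hh⟩ := exists_le_ex (Finset.univ_nonempty (α := H))
    (fun h => pr Ω (badE x f (gh h) {i, j, k}))
  exact ⟨gh h, hh.trans key⟩

end cone
end CB

/-! ### Extending from a few types to all types -/

namespace CB

section ext
variable {X V Γ : Type} [Group Γ] {Ω : Finset X} {x : ℕ → X → V}

/-- The types are distinct and the triangle is not closed. -/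
def bad (x : ℕ → X → V) (f : ℕ → ℕ → V → V → Γ) (i j k : ℕ) (ω : X) : Prop :=
  i ≠ j ∧ j ≠ k ∧ i ≠ k ∧ ¬ tri x f i j k ω

variable {f : ℕ → ℕ → V → V → Γ}

lemma bad_rot {i j k : ℕ} {ω : X} (h : bad x f i j k ω) : bad x f j k i ω :=
  ⟨h.2.1, h.2.2.1.symm, h.1.symm, fun h' => h.2.2.2 (tri_rot (tri_rot h'))⟩

lemma bad_swap (hf : AS f) {i j k : ℕ} {ω : X} (h : bad x f i j k ω) : bad x f j i k ω :=
  ⟨h.1.symm, h.2.2.1, h.2.1, fun h' => h.2.2.2 (tri_swap hf h.1.symm h.2.2.1 h.2.1 h')⟩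

lemma badT_quad (hf : AS f) {a b c d : ℕ} {τ : Finset ℕ} (hτ : τ ⊆ {a, b, c, d}) {ω : X}
    (h : badT x f τ ω) :
    bad x f a b c ω ∨ bad x f a b d ω ∨ bad x f a c d ω ∨ bad x f b c d ω := by
  obtain ⟨i, hi, j, hj, k, hk, h1, h2, h3, h4⟩ := h
  have hi := hτ hi
  have hj := hτ hj
  have hk := hτ hk
  have p1 : bad x f i j k ω := ⟨h1, h2, h3, h4⟩
  have p2 := bad_rot p1
  have p3 := bad_rot p2
  have q1 := bad_swap hf p1
  have q2 := bad_rot q1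
  have q3 := bad_rot q2
  simp only [Finset.mem_insert, Finset.mem_singleton] at hi hj hk
  rcases hi with hi | hi | hi | hi <;> rcases hj with hj | hj | hj | hj <;>
    first
    | exact absurd (hi.trans hj.symm) h1
    | (rcases hk with hk | hk | hk | hk <;>
        first
        | exact absurd (hi.trans hk.symm) h3
        | exact absurd (hj.trans hk.symm) h2
        | (subst hi hj hk; simp only [p1, p2, p3, q1, q2, q3, true_or, or_true]))

lemma ex_le_sum {κ : Type} {R I : Finset κ} (hI : I ⊆ R) (hR : R.Nonempty) {K : ℝ}
    (hK : (R.card : ℝ) ≤ K * I.card) (φ : κ → ℝ) (hφ : ∀ r, 0 ≤ φ r) :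
    ex I φ ≤ K / R.card * ∑ r ∈ R, φ r := by
  have hm : (0 : ℝ) < R.card := by exact_mod_cast hR.card_pos
  have hIc : (0 : ℝ) < I.card := by
    rcases Nat.eq_zero_or_pos I.card with h | h
    · rw [h] at hK; simp at hK; exact absurd hK hR.ne_empty
    · exact_mod_cast h
  have h1 : ∑ r ∈ I, φ r ≤ ∑ r ∈ R, φ r := Finset.sum_le_sum_of_subset_of_nonneg hI fun r _ _ => hφ r
  have h0 : 0 ≤ ∑ r ∈ I, φ r := Finset.sum_nonneg fun r _ => hφ r
  unfold ex
  rw [div_mul_eq_mul_div, div_le_div_iff₀ hIc hm]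
  have hK0 : 0 ≤ K := by
    by_contra hc; push Not at hc
    nlinarith
  calc (∑ r ∈ I, φ r) * R.card ≤ (∑ r ∈ I, φ r) * (K * I.card) := by gcongr
    _ ≤ (∑ r ∈ R, φ r) * (K * I.card) := by gcongr
    _ = _ := by ring

/-- Extension from the types in `τ` to all types in `R`. -/
lemma extend (hf : AS f) {R τ : Finset ℕ} (hτ : τ ⊆ R) {B : ℝ} (hB : 0 ≤ B) (hC : Cob Γ Ω x τ B)
    {a b : ℕ} (ha : a ∈ τ) (hb : b ∈ τ) (hab : a ≠ b)
    (hPE : ∀ r ∈ R, r ≠ a → r ≠ b → ∀ w, PE (cnd Ω (x r) w) (x a) (x b) (1 / 2)) :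
    ∃ g : ℕ → V → Γ, ∑ r ∈ R, ∑ r' ∈ R, pr Ω (fun ω => r ≠ r' ∧ ¬ edg x f g r r' ω) ≤
      ∑ r ∈ R, ∑ r' ∈ R, pr Ω (bad x f a r r') + 10 * R.card * ∑ r ∈ R, pr Ω (bad x f a b r) +
      10 * (R.card : ℝ) ^ 2 * (B * pr Ω (badT x f τ)) := by
  obtain ⟨g0, hg0⟩ := hC f hf
  set e0 := B * pr Ω (badT x f τ) with he0
  have he0' : 0 ≤ e0 := mul_nonneg hB (pr_nonneg _)
  have key : ∀ r w, ∃ c : Γ, r ∈ R → r ∉ τ → pr (cnd Ω (x r) w) (fun ω =>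
      f r a w (x a ω) * g0 a (x a ω) ≠ c ∨ f r b w (x b ω) * g0 b (x b ω) ≠ c) ≤
      5 * pr (cnd Ω (x r) w) (fun ω => bad x f a b r ω ∨ badE x f g0 τ ω) := by
    intro r w
    by_cases hr : r ∈ R
    swap
    · exact ⟨1, fun h => absurd h hr⟩
    by_cases hrt : r ∈ τ
    · exact ⟨1, fun _ h => absurd hrt h⟩
    have hra : r ≠ a := fun h => hrt (h ▸ ha)
    have hrb : r ≠ b := fun h => hrt (h ▸ hb)
    obtain ⟨c, hc⟩ := majority' le_rfl (hPE r hr hra hrb w) (fun v => f r a w v * g0 a v)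
      (fun v => f r b w v * g0 b v)
    refine ⟨c, fun _ _ => hc.trans ?_⟩
    gcongr
    refine pr_mono fun ω hω hne => ?_
    by_contra hcon; push Not at hcon
    obtain ⟨t1, t2⟩ := hcon
    apply hne
    have hk := (mem_cnd.1 hω).2
    have t3 : tri x f a b r ω := by
      by_contra hh; exact t1 ⟨hab, hrb.symm, hra.symm, hh⟩
    have t4 : edg x f g0 a b ω := by
      by_contra hh; exact t2 ⟨a, ha, b, hb, hab, hh⟩
    have t5 := tri_rot (tri_rot t3)
    unfold tri at t5; unfold edg at t4
    rw [hk, t4, hf b r _ _ hrb.symm, mul_inv_eq_one] at t5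
    rw [← t5]; group
  choose gr hgr using key
  set g : ℕ → V → Γ := fun t v => if t ∈ τ then g0 t v else gr t v with hg
  have hη : ∀ r ∈ R, r ≠ a → pr Ω (fun ω => ¬ edg x f g r a ω) ≤ 5 * pr Ω (bad x f a b r) + 5 * e0 := by
    intro r hr hra
    have hn := pr_nonneg (Ω := Ω) (bad x f a b r)
    by_cases hrt : r ∈ τ
    · have : pr Ω (fun ω => ¬ edg x f g r a ω) ≤ pr Ω (badE x f g0 τ) := by
        refine pr_mono fun ω _ h => ⟨r, hrt, a, ha, hra, ?_⟩
        unfold edg at *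
        simpa only [hg, if_pos hrt, if_pos ha] using h
      linarith
    · have e1 := ex_tower' (Ω := Ω) (x r) (fun w ω => ind (f r a w (x a ω) * g0 a (x a ω) ≠ gr r w ∨
        f r b w (x b ω) * g0 b (x b ω) ≠ gr r w))
      have e2 : pr Ω (fun ω => ¬ edg x f g r a ω) ≤ ex Ω (fun ω =>
          ind (f r a (x r ω) (x a ω) * g0 a (x a ω) ≠ gr r (x r ω) ∨
        f r b (x r ω) (x b ω) * g0 b (x b ω) ≠ gr r (x r ω))) := by
        refine pr_mono fun ω _ h => Or.inl fun h' => h ?_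
        unfold edg
        simp only [hg, if_neg hrt, if_pos ha]
        rw [← h']; group
      refine e2.trans (e1.symm.le.trans ?_)
      refine (ex_mono fun ω _ => hgr r (x r ω) hr hrt).trans ?_
      rw [ex_mul_left, pr_tower]
      have := pr_or (Ω := Ω) (bad x f a b r) (badE x f g0 τ)
      linarith
  have hpair : ∀ r ∈ R, ∀ r' ∈ R, pr Ω (fun ω => r ≠ r' ∧ ¬ edg x f g r r' ω) ≤
      pr Ω (bad x f a r r') + ((5 * pr Ω (bad x f a b r) + 5 * e0) +
        (5 * pr Ω (bad x f a b r') + 5 * e0)) := by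
    intro r hr r' hr'
    have n1 := pr_nonneg (Ω := Ω) (bad x f a b r)
    have n2 := pr_nonneg (Ω := Ω) (bad x f a b r')
    have n3 := pr_nonneg (Ω := Ω) (bad x f a r r')
    refine pr_and_le (by positivity) fun hrr => ?_
    by_cases h1 : r = a
    · subst h1
      have h2 := hη r' hr' hrr.symm
      have h3 : pr Ω (fun ω => ¬ edg x f g r r' ω) ≤ pr Ω (fun ω => ¬ edg x f g r' r ω) :=
        pr_mono fun ω _ h h' => h (edg_symm hf hrr.symm h')
      linarith
    by_cases h2 : r' = a
    · subst h2
      have h2 := hη r hr hrr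
      linarith
    have h3 := hη r hr h1
    have h4 := hη r' hr' h2
    have h5 := pr_le_of_imp_or (Ω := Ω) (p := fun ω => ¬ edg x f g r r' ω) (q := bad x f a r r')
      (r := fun ω => ¬ edg x f g r a ω ∨ ¬ edg x f g r' a ω) (by
        intro ω _ h
        by_contra hcon; push Not at hcon
        obtain ⟨c1, c2, c3⟩ := hcon
        have t : tri x f a r r' ω := by
          by_contra hh; exact c1 ⟨Ne.symm h1, hrr, Ne.symm h2, hh⟩
        apply h
        unfold tri at t; unfold edg at *
        rw [hf a r _ _ (Ne.symm h1), c2, c3] at t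
        rw [mul_eq_one_iff_eq_inv, inv_mul_eq_iff_eq_mul] at t
        rw [t]; group)
    have h6 := pr_or (Ω := Ω) (fun ω => ¬ edg x f g r a ω) (fun ω => ¬ edg x f g r' a ω)
    linarith
  refine ⟨g, (Finset.sum_le_sum fun r hr => Finset.sum_le_sum fun r' hr' =>
    hpair r hr r' hr').trans (le_of_eq ?_)⟩
  simp only [Finset.sum_add_distrib, Finset.sum_const, nsmul_eq_mul, ← Finset.mul_sum]
  ring

/-- Choosing the base types by averaging. -/
lemma assemble {R I1 I2 I3 I4 : Finset ℕ} {K B : ℝ} (hK : 1 ≤ K) (hB : 1 ≤ B) (hR : R.Nonempty)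
    (s1 : I1 ⊆ R) (s2 : I2 ⊆ R) (s3 : I3 ⊆ R) (s4 : I4 ⊆ R)
    (k1 : (R.card : ℝ) ≤ K * I1.card) (k2 : (R.card : ℝ) ≤ K * I2.card)
    (k3 : (R.card : ℝ) ≤ K * I3.card) (k4 : (R.card : ℝ) ≤ K * I4.card)
    (hPE : ∀ r ∈ R, ∀ a ∈ R, ∀ b ∈ R, a ≠ b → r ≠ a → r ≠ b → ∀ w,
      PE (cnd Ω (x r) w) (x a) (x b) (1 / 2))
    (hC : ∀ t1 ∈ I1, ∀ t2 ∈ I2, ∀ t3 ∈ I3, ∀ t4 ∈ I4, t1 ≠ t2 ∧ ∃ τ : Finset ℕ, t1 ∈ τ ∧ t2 ∈ τ ∧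
      τ ⊆ {t1, t2, t3, t4} ∧ Cob Γ Ω x τ B) (hf : AS f) :
    ∃ g : ℕ → V → Γ, ∑ r ∈ R, ∑ r' ∈ R, pr Ω (fun ω => r ≠ r' ∧ ¬ edg x f g r r' ω) ≤
      51 * B * K ^ 3 / R.card * ∑ i ∈ R, ∑ j ∈ R, ∑ k ∈ R, pr Ω (bad x f i j k) := by
  have hm : (0 : ℝ) < R.card := by exact_mod_cast hR.card_pos
  set m : ℝ := (R.card : ℝ) with hmdef
  set W := ∑ i ∈ R, ∑ j ∈ R, ∑ k ∈ R, pr Ω (bad x f i j k) with hW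
  have hW0 : 0 ≤ W := Finset.sum_nonneg fun i _ => Finset.sum_nonneg fun j _ =>
    Finset.sum_nonneg fun k _ => pr_nonneg _
  have hI : ∀ I : Finset ℕ, m ≤ K * I.card → I.Nonempty := by
    intro I h
    rw [Finset.nonempty_iff_ne_empty]
    rintro rfl
    simp at h; linarith
  have n1 := hI I1 k1
  have n2 := hI I2 k2
  have n3 := hI I3 k3
  have n4 := hI I4 k4
  set w : ℕ → ℕ → ℕ → ℝ := fun i j k => pr Ω (bad x f i j k) with hw
  have hw0 : ∀ i j k, 0 ≤ w i j k := fun i j k => pr_nonneg _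
  set κ := K / m with hκ
  have hκ0 : 0 ≤ κ := by positivity
  have b1 : ex I1 (fun t1 => ∑ r ∈ R, ∑ r' ∈ R, w t1 r r') ≤ κ * W :=
    ex_le_sum s1 hR k1 _ fun t => Finset.sum_nonneg fun i _ => Finset.sum_nonneg fun j _ => hw0 _ _ _
  have b2 : ex I1 (fun t1 => ex I2 (fun t2 => ∑ r ∈ R, w t1 t2 r)) ≤ κ ^ 2 * W := by
    calc _ ≤ ex I1 (fun t1 => κ * ∑ t2 ∈ R, ∑ r ∈ R, w t1 t2 r) :=
          ex_mono fun t1 _ => ex_le_sum s2 hR k2 _ fun t => Finset.sum_nonneg fun i _ => hw0 _ _ _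
      _ ≤ κ * (κ * W) := by
          rw [ex_mul_left]; exact mul_le_mul_of_nonneg_left b1 hκ0
      _ = _ := by ring
  have b3 : ∀ I I' I'' : Finset ℕ, I ⊆ R → I' ⊆ R → I'' ⊆ R → m ≤ K * I.card → m ≤ K * I'.card →
      m ≤ K * I''.card → ex I (fun t => ex I' (fun t' => ex I'' (fun t'' => w t t' t''))) ≤
      κ ^ 3 * W := by
    intro I I' I'' h h' h'' c c' c''
    calc _ ≤ ex I (fun t1 => ex I' (fun t2 => κ * ∑ r ∈ R, w t1 t2 r)) :=
          ex_mono fun t1 _ => ex_mono fun t2 _ => ex_le_sum h'' hR c'' _ fun t => hw0 _ _ _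
      _ = ex I (fun t1 => κ * ex I' (fun t2 => ∑ r ∈ R, w t1 t2 r)) := by simp only [ex_mul_left]
      _ ≤ ex I (fun t1 => κ * (κ * ∑ t2 ∈ R, ∑ r ∈ R, w t1 t2 r)) :=
          ex_mono fun t1 _ => mul_le_mul_of_nonneg_left (ex_le_sum h' hR c' _ fun t =>
            Finset.sum_nonneg fun i _ => hw0 _ _ _) hκ0
      _ = κ * (κ * ex I (fun t1 => ∑ t2 ∈ R, ∑ r ∈ R, w t1 t2 r)) := by simp only [ex_mul_left]
      _ ≤ κ * (κ * (κ * W)) := by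
          gcongr
          exact ex_le_sum h hR c _ fun t =>
            Finset.sum_nonneg fun i _ => Finset.sum_nonneg fun j _ => hw0 _ _ _
      _ = _ := by ring
  set Φ : ℕ → ℕ → ℕ → ℕ → ℝ := fun t1 t2 t3 t4 =>
    (∑ r ∈ R, ∑ r' ∈ R, w t1 r r') + 10 * m * (∑ r ∈ R, w t1 t2 r) +
    10 * m ^ 2 * B * (w t1 t2 t3 + (w t1 t2 t4 + (w t1 t3 t4 + w t2 t3 t4))) with hΦ
  have hΦ' : ex I1 (fun t1 => ex I2 (fun t2 => ex I3 (fun t3 => ex I4 (fun t4 => Φ t1 t2 t3 t4)))) ≤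
      κ * W + 10 * m * (κ ^ 2 * W) + 10 * m ^ 2 * B * (4 * (κ ^ 3 * W)) := by
    simp only [hΦ, ex_add, ex_mul_left, ex_const n4, ex_const n3, ex_const n2, ex_const n1]
    have c1 := b3 I1 I2 I3 s1 s2 s3 k1 k2 k3
    have c2 := b3 I1 I2 I4 s1 s2 s4 k1 k2 k4
    have c3 := b3 I1 I3 I4 s1 s3 s4 k1 k3 k4
    have c4 := b3 I2 I3 I4 s2 s3 s4 k2 k3 k4
    have hmB : 0 ≤ 10 * m ^ 2 * B := by positivity
    have h10 : 0 ≤ 10 * m := by positivity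
    refine add_le_add (add_le_add b1 (mul_le_mul_of_nonneg_left b2 h10))
      (mul_le_mul_of_nonneg_left ?_ hmB)
    linarith
  obtain ⟨t1, ht1, c1⟩ := exists_le_ex n1
    (fun t1 => ex I2 (fun t2 => ex I3 (fun t3 => ex I4 (fun t4 => Φ t1 t2 t3 t4))))
  obtain ⟨t2, ht2, c2⟩ := exists_le_ex n2 (fun t2 => ex I3 (fun t3 => ex I4 (fun t4 => Φ t1 t2 t3 t4)))
  obtain ⟨t3, ht3, c3⟩ := exists_le_ex n3 (fun t3 => ex I4 (fun t4 => Φ t1 t2 t3 t4))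
  obtain ⟨t4, ht4, c4⟩ := exists_le_ex n4 (fun t4 => Φ t1 t2 t3 t4)
  have hF : Φ t1 t2 t3 t4 ≤ 51 * B * K ^ 3 / m * W := by
    refine c4.trans (c3.trans (c2.trans (c1.trans (hΦ'.trans ?_))))
    have : κ * W + 10 * m * (κ ^ 2 * W) + 10 * m ^ 2 * B * (4 * (κ ^ 3 * W)) =
        (K + 10 * K ^ 2 + 40 * B * K ^ 3) * (W / m) := by
      rw [hκ]; field_simp; ring
    rw [this, div_mul_eq_mul_div, mul_div_assoc]
    refine mul_le_mul_of_nonneg_right ?_ (by positivity)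
    have g1 : K ≤ B * K ^ 3 := by
      calc K = 1 * K ^ 1 := by ring
        _ ≤ B * K ^ 3 := by gcongr <;> first | assumption | norm_num
    have g2 : K ^ 2 ≤ B * K ^ 3 := by
      calc K ^ 2 = 1 * K ^ 2 := by ring
        _ ≤ B * K ^ 3 := by gcongr <;> first | assumption | norm_num
    linarith
  obtain ⟨h12, τ, hτ1, hτ2, hτs, hτC⟩ := hC t1 ht1 t2 ht2 t3 ht3 t4 ht4
  have hτR : τ ⊆ R := by
    intro t ht
    have := hτs ht
    simp only [Finset.mem_insert, Finset.mem_singleton] at this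
    rcases this with rfl | rfl | rfl | rfl
    exacts [s1 ht1, s2 ht2, s3 ht3, s4 ht4]
  obtain ⟨g, hg⟩ := extend hf hτR (by linarith) hτC hτ1 hτ2 h12
    (fun r hr h1 h2 w => hPE r hr t1 (s1 ht1) t2 (s2 ht2) h12 h1 h2 w)
  refine ⟨g, hg.trans (le_trans ?_ hF)⟩
  have hbT : pr Ω (badT x f τ) ≤ w t1 t2 t3 + (w t1 t2 t4 + (w t1 t3 t4 + w t2 t3 t4)) := by
    refine (pr_le_of_imp_or fun ω _ h => badT_quad hf hτs h).trans (add_le_add le_rfl ?_)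
    exact (pr_or _ _).trans (add_le_add le_rfl (pr_or _ _))
  have := mul_le_mul_of_nonneg_left hbT (by positivity : 0 ≤ 10 * m ^ 2 * B)
  simp only [hΦ]
  linarith

end ext
end CB

/-! ### Flags given by bases -/

namespace CB

section flags
variable {F : Type} [Field F] [Fintype F] {n : ℕ}

/-- The span of the first `t` vectors of a family. -/
def fl (t : ℕ) (b : Fin n → Fin n → F) : Submodule F (Fin n → F) :=
  Submodule.span F (b '' {i | (i : ℕ) < t})

/-- Bases whose flag contains every member of `s`. -/
noncomputable def Om (s : Finset (Submodule F (Fin n → F))) : Finset (Fin n → Fin n → F) :=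
  Finset.univ.filter fun b => fl n b = ⊤ ∧ ∀ W ∈ s, fl (Module.finrank F W) b = W

variable {s : Finset (Submodule F (Fin n → F))} {b b' : Fin n → Fin n → F} {t i j w : ℕ}

lemma mem_Om : b ∈ Om s ↔ fl n b = ⊤ ∧ ∀ W ∈ s, fl (Module.finrank F W) b = W := by
  simp [Om]

lemma fl_mono {t t' : ℕ} (h : t ≤ t') (b : Fin n → Fin n → F) : fl t b ≤ fl t' b :=
  Submodule.span_mono (Set.image_mono fun i (hi : (i : ℕ) < t) => lt_of_lt_of_le hi h)

lemma fl_zero (b : Fin n → Fin n → F) : fl 0 b = ⊥ := by simp [fl]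

lemma fl_top_eq (b : Fin n → Fin n → F) : fl n b = Submodule.span F (Set.range b) := by
  unfold fl
  congr 1
  ext v; constructor
  · rintro ⟨i, _, rfl⟩; exact ⟨i, rfl⟩
  · rintro ⟨i, rfl⟩; exact ⟨i, i.2, rfl⟩

lemma mem_fl {i : Fin n} (h : (i : ℕ) < t) (b : Fin n → Fin n → F) : b i ∈ fl t b :=
  Submodule.subset_span ⟨i, h, rfl⟩

lemma fl_le {W : Submodule F (Fin n → F)} (h : ∀ i : Fin n, (i : ℕ) < t → b i ∈ W) : fl t b ≤ W := by
  unfold fl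
  rw [Submodule.span_le]
  rintro _ ⟨i, hi, rfl⟩
  exact h i hi

lemma fl_succ (ht : t < n) (b : Fin n → Fin n → F) :
    fl (t + 1) b = fl t b ⊔ Submodule.span F {b ⟨t, ht⟩} := by
  apply le_antisymm
  · apply fl_le
    intro i hi
    rcases Nat.lt_succ_iff_lt_or_eq.1 hi with h | h
    · exact Submodule.mem_sup_left (mem_fl h b)
    · have : i = ⟨t, ht⟩ := Fin.ext h
      subst this
      exact Submodule.mem_sup_right (Submodule.mem_span_singleton_self _)
  · apply sup_le (fl_mono (Nat.le_succ _) b)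
    rw [Submodule.span_singleton_le_iff_mem]
    exact mem_fl (Nat.lt_succ_self t) b

lemma li_of_top (h : fl n b = ⊤) : LinearIndependent F b := by
  apply linearIndependent_of_top_le_span_of_card_eq_finrank
  · rw [← fl_top_eq, h]
  · simp

lemma finrank_fl (h : fl n b = ⊤) (ht : t ≤ n) : Module.finrank F (fl t b) = t := by
  have hli := li_of_top h
  have h1 : fl t b = Submodule.span F (Set.range (b ∘ (Fin.castLE ht))) := by
    unfold fl; congr 1; ext v; constructor
    · rintro ⟨i, hi, rfl⟩; exact ⟨⟨i, hi⟩, rfl⟩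
    · rintro ⟨i, rfl⟩; exact ⟨Fin.castLE ht i, i.2, rfl⟩
  rw [h1, finrank_span_eq_card (hli.comp _ (Fin.castLE_injective ht))]
  simp

lemma fl_top_of_le (ht : n ≤ t) : fl t b = fl n b := by
  unfold fl; congr 1; ext v; constructor
  · rintro ⟨i, hi, rfl⟩; exact ⟨i, i.2, rfl⟩
  · rintro ⟨i, hi, rfl⟩; exact ⟨i, lt_of_lt_of_le i.2 ht, rfl⟩

/-- Every chain of subspaces is contained in the flag of some basis. -/
lemma Om_nonempty (hs : IsChain (· ≤ ·) (s : Set (Submodule F (Fin n → F)))) : (Om s).Nonempty := by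
  have key : ∀ t ≤ n, ∃ b : Fin n → Fin n → F, ∀ i : Fin n, (i : ℕ) < t →
      b i ∉ fl i b ∧ ∀ W ∈ s, (i : ℕ) < Module.finrank F W → b i ∈ W := by
    intro t
    induction t with
    | zero => intro _; exact ⟨0, by simp⟩
    | succ t ih =>
      intro ht
      obtain ⟨b, hb⟩ := ih (by omega)
      have hle : Module.finrank F (fl t b) ≤ t := by
        have h1 : fl t b = Submodule.span F (Set.range (b ∘ (Fin.castLE (by omega : t ≤ n)))) := by
          unfold fl; congr 1; ext v; constructor
          · rintro ⟨i, hi, rfl⟩; exact ⟨⟨i, hi⟩, rfl⟩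
          · rintro ⟨i, rfl⟩; exact ⟨Fin.castLE _ i, i.2, rfl⟩
        rw [h1]
        exact (finrank_range_le_card (R := F) _).trans (by simp)
      have hex : ∃ D : Submodule F (Fin n → F), t < Module.finrank F D ∧
          ∀ W ∈ s, t < Module.finrank F W → D ≤ W := by
        by_cases hne : (s.filter fun W : Submodule F (Fin n → F) => t < Module.finrank F W).Nonempty
        · obtain ⟨D, hD, hmin⟩ := Finset.exists_minimal hne
          rw [Finset.mem_filter] at hD
          refine ⟨D, hD.2, fun W hW hWt => ?_⟩
          rcases hs.total hD.1 hW with h | h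
          · exact h
          · exact hmin (by simp [hW, hWt]) h
        · refine ⟨⊤, by simp; omega, fun W hW hWt => ?_⟩
          exact absurd ⟨W, by simp [hW, hWt]⟩ hne
      obtain ⟨D, hD, hDW⟩ := hex
      obtain ⟨v, hv, hv'⟩ : ∃ v ∈ D, v ∉ fl t b := by
        by_contra hcon; push Not at hcon
        have : D ≤ fl t b := hcon
        have := Submodule.finrank_mono this
        omega
      refine ⟨Function.update b ⟨t, ht⟩ v, ?_⟩
      have hfl : ∀ r ≤ t, fl r (Function.update b ⟨t, ht⟩ v) = fl r b := by
        intro r hr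
        unfold fl
        congr 1
        apply Set.image_congr
        intro i hi
        have : i ≠ ⟨t, ht⟩ := by rintro rfl; simp at hi; omega
        simp [this]
      intro i hi
      rcases Nat.lt_succ_iff_lt_or_eq.1 hi with h | h
      · have hne : i ≠ ⟨t, ht⟩ := by rintro rfl; simp at h
        rw [hfl i h.le, Function.update_of_ne hne]
        exact hb i h
      · have hi' : i = ⟨t, ht⟩ := Fin.ext h
        subst hi'
        rw [hfl _ le_rfl, Function.update_self]
        exact ⟨hv', fun W hW hWt => hDW W hW hWt hv⟩
  obtain ⟨b, hb⟩ := key n le_rfl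
  have hrank : ∀ t ≤ n, t ≤ Module.finrank F (fl t b) := by
    intro t
    induction t with
    | zero => intro _; omega
    | succ t ih =>
      intro ht
      have h1 := ih (by omega)
      have h2 : fl t b < fl (t + 1) b := by
        refine lt_of_le_of_ne (fl_mono (Nat.le_succ _) b) fun h => ?_
        apply (hb ⟨t, ht⟩ ht).1
        show b ⟨t, ht⟩ ∈ fl t b
        rw [h]
        exact mem_fl (by simp) b
      have := Submodule.finrank_lt_finrank_of_lt h2
      omega
  have htop : fl n b = ⊤ := by
    apply Submodule.eq_top_of_finrank_eq
    have h1 := hrank n le_rfl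
    have h2 := Submodule.finrank_le (fl n b)
    simp at h2 ⊢; omega
  refine ⟨b, mem_Om.2 ⟨htop, fun W hW => ?_⟩⟩
  have hWn : Module.finrank F W ≤ n := by simpa using Submodule.finrank_le W
  apply Submodule.eq_of_le_of_finrank_eq
  · exact fl_le fun i hi => (hb i i.2).2 W hW hi
  · exact finrank_fl htop hWn

lemma Om_chain (hb : b ∈ Om s) : IsChain (· ≤ ·) (s : Set (Submodule F (Fin n → F))) := by
  rw [mem_Om] at hb
  intro W hW W' hW' _
  rw [← hb.2 W hW, ← hb.2 W' hW']
  exact (le_total (Module.finrank F W) (Module.finrank F W')).imp (fun h => fl_mono h b)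
    (fun h => fl_mono h b)

lemma finrank_Om (hb : b ∈ Om s) (ht : t ≤ n) : Module.finrank F (fl t b) = t :=
  finrank_fl (mem_Om.1 hb).1 ht

lemma cnd_Om (ht : t ≤ n) (v : Submodule F (Fin n → F)) (hv : Module.finrank F v = t) :
    cnd (Om s) (fl t) v = Om (insert v s) := by
  ext b
  rw [mem_cnd, mem_Om, mem_Om, Finset.forall_mem_insert, hv]
  tauto

lemma cnd_Om_empty (ht : t ≤ n) (v : Submodule F (Fin n → F)) (hv : Module.finrank F v ≠ t) :
    cnd (Om s) (fl t) v = ∅ := by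
  rw [Finset.eq_empty_iff_forall_notMem]
  intro b hb
  rw [mem_cnd] at hb
  apply hv
  rw [← hb.2, finrank_Om hb.1 ht]

lemma cnd_Om_cases (ht : t ≤ n) (v : Submodule F (Fin n → F)) :
    cnd (Om s) (fl t) v = ∅ ∨ (Module.finrank F v = t ∧ cnd (Om s) (fl t) v = Om (insert v s)) := by
  by_cases hv : Module.finrank F v = t
  · exact Or.inr ⟨hv, cnd_Om ht v hv⟩
  · exact Or.inl (cnd_Om_empty ht v hv)

lemma cnd_Om_self (hb : b ∈ Om s) (ht : t ≤ n) :
    cnd (Om s) (fl t) (fl t b) = Om (insert (fl t b) s) := cnd_Om ht _ (finrank_Om hb ht)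

/-! ### Splicing -/

/-- Take the first `w` vectors from `b` and the others from `b'`. -/
def spl (w : ℕ) (b b' : Fin n → Fin n → F) : Fin n → Fin n → F := fun i => if (i : ℕ) < w then b i else b' i

lemma fl_spl_low (h : t ≤ w) : fl t (spl w b b') = fl t b := by
  unfold fl
  congr 1
  apply Set.image_congr
  intro i (hi : (i : ℕ) < t)
  simp [spl, lt_of_lt_of_le hi h]

lemma fl_spl_high (h : w ≤ t) (hw : fl w b = fl w b') : fl t (spl w b b') = fl t b' := by
  apply le_antisymm
  · apply fl_le
    intro i hi
    unfold spl
    split_ifs with h1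
    · exact fl_mono h b' (hw ▸ mem_fl h1 b)
    · exact mem_fl hi b'
  · apply fl_le
    intro i hi
    by_cases h1 : (i : ℕ) < w
    · have h2 : b' i ∈ fl w b := hw ▸ mem_fl h1 b'
      rw [← fl_spl_low (b' := b') (le_refl w)] at h2
      exact fl_mono h _ h2
    · have : spl w b b' i = b' i := by simp [spl, h1]
      rw [← this]; exact mem_fl hi _

lemma spl_mem (hw : fl w b = fl w b') (hwn : w ≤ n) (hb : b ∈ Om s) (hb' : b' ∈ Om s) :
    spl w b b' ∈ Om s := by
  rw [mem_Om] at *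
  refine ⟨by rw [fl_spl_high hwn hw, hb'.1], fun W hW => ?_⟩
  rcases le_total (Module.finrank F W) w with h | h
  · rw [fl_spl_low h, hb.2 W hW]
  · rw [fl_spl_high h hw, hb'.2 W hW]

lemma spl_spl : spl w (spl w b b') (spl w b' b) = b := by
  funext i; unfold spl; split_ifs <;> rfl

/-- Functions of the lower and upper part of the flag are independent. -/
lemma indep_spl (hwn : w ≤ n) (hc : ∀ b ∈ Om s, ∀ b' ∈ Om s, fl w b = fl w b')
    {φ ψ : (Fin n → Fin n → F) → ℝ} (hφ : ∀ b ∈ Om s, ∀ b' ∈ Om s, φ (spl w b b') = φ b)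
    (hψ : ∀ b ∈ Om s, ∀ b' ∈ Om s, ψ (spl w b b') = ψ b') :
    ex (Om s) (fun b => φ b * ψ b) = ex (Om s) φ * ex (Om s) ψ := by
  rcases (Om s).eq_empty_or_nonempty with h0 | hne
  · simp [h0, ex_empty]
  have hcard : ((Om s).card : ℝ) ≠ 0 := by exact_mod_cast hne.card_pos.ne'
  have h1 : ∑ p ∈ (Om s) ×ˢ (Om s), φ p.1 * ψ p.1 = ∑ p ∈ (Om s) ×ˢ (Om s), φ p.1 * ψ p.2 := by
    refine Finset.sum_bij' (fun p _ => (spl w p.1 p.2, spl w p.2 p.1))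
      (fun p _ => (spl w p.1 p.2, spl w p.2 p.1)) ?_ ?_ ?_ ?_ ?_
    · rintro ⟨p, p'⟩ hp
      rw [Finset.mem_product] at hp ⊢
      exact ⟨spl_mem (hc _ hp.1 _ hp.2) hwn hp.1 hp.2, spl_mem (hc _ hp.2 _ hp.1) hwn hp.2 hp.1⟩
    · rintro ⟨p, p'⟩ hp
      rw [Finset.mem_product] at hp ⊢
      exact ⟨spl_mem (hc _ hp.1 _ hp.2) hwn hp.1 hp.2, spl_mem (hc _ hp.2 _ hp.1) hwn hp.2 hp.1⟩
    · rintro ⟨p, p'⟩ hp; simp [spl_spl]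
    · rintro ⟨p, p'⟩ hp; simp [spl_spl]
    · rintro ⟨p, p'⟩ hp
      rw [Finset.mem_product] at hp
      simp only
      rw [hφ _ hp.1 _ hp.2, hψ _ hp.2 _ hp.1]
  rw [Finset.sum_product, Finset.sum_product] at h1
  simp only [Finset.sum_const, nsmul_eq_mul, ← Finset.mul_sum] at h1
  rw [← Finset.sum_mul] at h1
  unfold ex
  field_simp
  linarith

/-! ### Group action -/

/-- Linear automorphisms stabilizing each member of `s`. -/
def Stab (s : Finset (Submodule F (Fin n → F))) : Type :=
  {φ : (Fin n → F) ≃ₗ[F] (Fin n → F) // ∀ W ∈ s, W.map φ.toLinearMap = W}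

lemma map_fl (φ : (Fin n → F) ≃ₗ[F] (Fin n → F)) :
    (fl t b).map φ.toLinearMap = fl t (fun i => φ (b i)) := by
  unfold fl
  rw [Submodule.map_span, ← Set.image_comp]
  rfl

noncomputable instance : Fintype (Stab s) := by
  have : Finite ((Fin n → F) ≃ₗ[F] (Fin n → F)) :=
    Finite.of_injective (fun φ => (φ : (Fin n → F) → (Fin n → F))) DFunLike.coe_injective
  unfold Stab
  exact Fintype.ofFinite _

instance : Nonempty (Stab s) := ⟨⟨LinearEquiv.refl F _, fun W _ => by simp⟩⟩

/-- Action of the stabilizer on bases. -/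
def act (h : Stab s) (b : Fin n → Fin n → F) : Fin n → Fin n → F := fun i => h.1 (b i)

lemma act_mem (h : Stab s) (hb : b ∈ Om s) : act h b ∈ Om s := by
  rw [mem_Om] at *
  unfold act
  rw [← map_fl, hb.1]
  refine ⟨by simp, fun W hW => ?_⟩
  rw [← map_fl, hb.2 W hW, h.2 W hW]

lemma fl_act (h : Stab s) : fl t (act h b) = (fl t b).map h.1.toLinearMap := (map_fl h.1).symm

lemma act_inj (h : Stab s) : Function.Injective (act h) := by
  intro b b' hbb
  funext i
  exact h.1.injective (congrFun hbb i)

lemma exists_act (hb : b ∈ Om s) (hb' : b' ∈ Om s) : ∃ h : Stab s, act h b = b' := by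
  have e1 := mem_Om.1 hb
  have e2 := mem_Om.1 hb'
  let B := Module.Basis.mk (li_of_top e1.1) (by rw [← fl_top_eq, e1.1])
  let B' := Module.Basis.mk (li_of_top e2.1) (by rw [← fl_top_eq, e2.1])
  let φ := B.equiv B' (Equiv.refl _)
  have hφ : ∀ i, φ (b i) = b' i := by
    intro i
    have h1 : b i = B i := by simp [B]
    rw [h1]; simp [φ, B']
  have hφ' : (fun i => φ (b i)) = b' := funext hφ
  refine ⟨⟨φ, fun W hW => ?_⟩, hφ'⟩
  rw [← e1.2 W hW]
  conv_lhs => rw [map_fl, hφ']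
  rw [e1.2 W hW, e2.2 W hW]

lemma act_ext {h h' : Stab s} (hb : b ∈ Om s) (hh : act h b = act h' b) : h = h' := by
  apply Subtype.ext
  have e1 := mem_Om.1 hb
  apply LinearEquiv.toLinearMap_injective
  apply LinearMap.ext_on_range (v := b) (by rw [← fl_top_eq, e1.1])
  intro i; exact congrFun hh i

lemma ex_of_inj {X : Type} {Ω : Finset X} {σ : X → X} (hm : ∀ ω ∈ Ω, σ ω ∈ Ω)
    (hi : ∀ ω ∈ Ω, ∀ ω' ∈ Ω, σ ω = σ ω' → ω = ω') (φ : X → ℝ) : ex Ω (fun ω => φ (σ ω)) = ex Ω φ := by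
  unfold ex
  congr 1
  have himg : Ω.image σ = Ω := by
    apply Finset.eq_of_subset_of_card_le
    · intro y hy
      obtain ⟨z, hz, rfl⟩ := Finset.mem_image.1 hy
      exact hm z hz
    · rw [Finset.card_image_of_injOn (fun a ha b hb h => hi a ha b hb h)]
  conv_rhs => rw [← himg]
  rw [Finset.sum_image (fun a ha b hb h => hi a ha b hb h)]

lemma ex_act (h : Stab s) (φ : (Fin n → Fin n → F) → ℝ) :
    ex (Om s) (fun b => φ (act h b)) = ex (Om s) φ :=
  ex_of_inj (fun _ hb => act_mem h hb) (fun _ _ _ _ hh => act_inj h hh) φ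

lemma avg_act (hb : b ∈ Om s) (φ : (Fin n → Fin n → F) → ℝ) :
    ex (Finset.univ : Finset (Stab s)) (fun h => φ (act h b)) = ex (Om s) φ := by
  have himg : Finset.univ.image (fun h : Stab s => act h b) = Om s := by
    ext b'; constructor
    · intro h
      obtain ⟨g, _, rfl⟩ := Finset.mem_image.1 h
      exact act_mem g hb
    · intro h
      obtain ⟨g, hg⟩ := exists_act hb h
      exact Finset.mem_image.2 ⟨g, Finset.mem_univ _, hg⟩
  have hinj : Set.InjOn (fun h : Stab s => act h b) ((Finset.univ : Finset (Stab s)) : Set (Stab s)) :=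
    fun h _ h' _ hh => act_ext hb hh
  unfold ex
  rw [← himg, Finset.sum_image hinj, Finset.card_image_of_injOn hinj]

end flags
end CB

/-! ### Spectral expansion of flags -/

namespace CB

section generic
variable {X V W : Type} {Ω : Finset X}

/-- Conditional expectations of functions of `y` given `z` have small variance. -/
def VE (Ω : Finset X) (y : X → V) (z : X → W) (r : ℝ) : Prop :=
  ∀ h : V → ℝ, cov Ω (fun ω => ex (cnd Ω z (z ω)) (fun ω' => h (y ω')))
    (fun ω => ex (cnd Ω z (z ω)) (fun ω' => h (y ω'))) ≤ r * cov Ω (fun ω => h (y ω)) (fun ω => h (y ω))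

lemma two_cov_le {l : ℝ} (hl : 0 < l) (φ ψ : X → ℝ) :
    2 * cov Ω φ ψ ≤ l⁻¹ * cov Ω φ φ + l * cov Ω ψ ψ := by
  have h := var_nonneg (Ω := Ω) (fun ω => φ ω + (-l) * ψ ω)
  have e : cov Ω (fun ω => φ ω + (-l) * ψ ω) (fun ω => φ ω + (-l) * ψ ω) =
      cov Ω φ φ - 2 * l * cov Ω φ ψ + l ^ 2 * cov Ω ψ ψ := by
    unfold cov
    have h1 : (fun ω => (φ ω + (-l) * ψ ω) * (φ ω + (-l) * ψ ω)) =
      fun ω => (φ ω * φ ω + (-2 * l) * (φ ω * ψ ω)) + l ^ 2 * (ψ ω * ψ ω) := by funext ω; ring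
    rw [h1, ex_add, ex_add, ex_add, ex_mul_left, ex_mul_left, ex_mul_left]; ring
  rw [e] at h
  have h2 := mul_nonneg (inv_nonneg.2 hl.le) h
  have h3 : l⁻¹ * (cov Ω φ φ - 2 * l * cov Ω φ ψ + l ^ 2 * cov Ω ψ ψ) =
    l⁻¹ * cov Ω φ φ - 2 * cov Ω φ ψ + l * cov Ω ψ ψ := by field_simp
  linarith

lemma PE_of_avg {y : X → V} {z : X → W} {l : ℝ} (hl : 0 < l)
    (h : ∀ h : V → ℝ, ∃ A : X → ℝ, (∀ k : W → ℝ, cov Ω (fun ω => h (y ω)) (fun ω => k (z ω)) =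
      cov Ω A (fun ω => k (z ω))) ∧ cov Ω A A ≤ l ^ 2 * cov Ω (fun ω => h (y ω)) (fun ω => h (y ω))) :
    PE Ω y z l := by
  intro k h'
  obtain ⟨A, h1, h2⟩ := h h'
  rw [h1]
  refine (two_cov_le hl _ _).trans ?_
  have h3 := mul_le_mul_of_nonneg_left h2 (inv_nonneg.2 hl.le)
  have h4 : l⁻¹ * (l ^ 2 * cov Ω (fun ω => h' (y ω)) (fun ω => h' (y ω))) =
    l * cov Ω (fun ω => h' (y ω)) (fun ω => h' (y ω)) := by field_simp
  linarith

lemma cov_condE (z : X → W) (φ : X → ℝ) (k : W → ℝ) :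
    cov Ω φ (fun ω => k (z ω)) =
      cov Ω (fun ω => ex (cnd Ω z (z ω)) φ) (fun ω => k (z ω)) := by
  unfold cov
  rw [ex_tower]
  congr 1
  rw [← ex_tower' z (fun a ω => φ ω * k a)]
  exact ex_congr fun ω _ => ex_mul_right _ _

lemma PE_of_VE {y : X → V} {z : X → W} {l : ℝ} (hl : 0 < l) (h : VE Ω y z (l ^ 2)) : PE Ω y z l :=
  PE_of_avg hl fun h' => ⟨_, fun k => cov_condE z _ k, h h'⟩

lemma VE_of_PE {y : X → V} {z : X → W} {l : ℝ} (hl : 0 < l) (h : PE Ω y z l) : VE Ω z y (l ^ 2) :=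
  fun k => (h k).samp hl

lemma PE_const_left {y : X → V} {z : X → W} {l : ℝ} (hl : 0 ≤ l) (c : V) (hc : ∀ ω ∈ Ω, y ω = c) :
    PE Ω y z l := PE_of_indep hl fun h k => by
  rw [cov_comm]; exact cov_const_right _ _ (h c) fun ω hω => by rw [hc ω hω]

/-- Push-forward to a uniform distribution. -/
lemma ex_unif (hne : Ω.Nonempty) (π : X → V)
    (h : ∀ b ∈ Ω, ∀ b' ∈ Ω, (cnd Ω π (π b)).card = (cnd Ω π (π b')).card) (φ : V → ℝ) :
    ex Ω (fun ω => φ (π ω)) = ex (Ω.image π) φ := by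
  obtain ⟨b0, hb0⟩ := hne
  set c := (cnd Ω π (π b0)).card with hc
  have hc0 : (c : ℝ) ≠ 0 := by
    exact_mod_cast (Finset.card_pos.2 ⟨b0, self_mem_cnd hb0⟩).ne'
  have h1 : ∀ φ : V → ℝ, ∑ ω ∈ Ω, φ (π ω) = c * ∑ y ∈ Ω.image π, φ y := by
    intro φ
    rw [← Finset.sum_fiberwise_of_maps_to (t := Ω.image π) (g := π)
      (fun x hx => Finset.mem_image_of_mem π hx), Finset.mul_sum]
    refine Finset.sum_congr rfl fun y hy => ?_
    obtain ⟨b, hb, rfl⟩ := Finset.mem_image.1 hy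
    rw [Finset.sum_congr rfl (g := fun _ => φ (π b))
      (fun x hx => by rw [(Finset.mem_filter.1 hx).2])]
    rw [Finset.sum_const, nsmul_eq_mul]
    have := h b hb b0 hb0
    unfold cnd at this hc
    rw [hc, ← this]
  have h2 := h1 (fun _ => 1)
  simp at h2
  unfold ex
  rw [h1 φ, h2]
  field_simp
end generic

section flags
variable {F : Type} [Field F] [Fintype F] {n : ℕ}
variable {s : Finset (Submodule F (Fin n → F))} {b b' : Fin n → Fin n → F} {t i j w : ℕ}

lemma card_fib {V : Type} (π : (Fin n → Fin n → F) → V)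
    (hπ : ∀ (h : Stab s) (b1 b2), π b1 = π b2 → π (act h b1) = π (act h b2))
    (hb : b ∈ Om s) (hb' : b' ∈ Om s) :
    (cnd (Om s) π (π b)).card = (cnd (Om s) π (π b')).card := by
  have key : ∀ b ∈ Om s, ∀ b' ∈ Om s, (cnd (Om s) π (π b)).card ≤ (cnd (Om s) π (π b')).card := by
    intro b hb b' hb'
    obtain ⟨h, rfl⟩ := exists_act hb hb'
    apply Finset.card_le_card_of_injOn (act h)
    · intro c hc
      have hc := mem_cnd.1 (Finset.mem_coe.1 hc)
      exact Finset.mem_coe.2 (mem_cnd.2 ⟨act_mem h hc.1, hπ h _ _ hc.2⟩)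
    · exact (act_inj h).injOn
  exact le_antisymm (key _ hb _ hb') (key _ hb' _ hb)

def mix (ht : t + 1 < n) (c c' : F) (b : Fin n → Fin n → F) : Fin n → Fin n → F := fun i =>
  if (i : ℕ) = t then b ⟨t, by omega⟩ + c • b ⟨t + 1, ht⟩
  else if (i : ℕ) = t + 1 then b ⟨t, by omega⟩ + c' • b ⟨t + 1, ht⟩ else b i

lemma mix_low (ht : t + 1 < n) (c c' : F) (b : Fin n → Fin n → F) (hj : j ≤ t) :
    fl j (mix ht c c' b) = fl j b := by
  unfold fl
  congr 1
  apply Set.image_congr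
  intro i (hi : (i : ℕ) < j)
  have h1 : (i : ℕ) ≠ t := by omega
  have h2 : (i : ℕ) ≠ t + 1 := by omega
  simp [mix, h1, h2]

lemma mix_t (ht : t + 1 < n) (c c' : F) (b : Fin n → Fin n → F) :
    mix ht c c' b ⟨t, by omega⟩ = b ⟨t, by omega⟩ + c • b ⟨t + 1, ht⟩ := by simp [mix]

lemma mix_t1 (ht : t + 1 < n) (c c' : F) (b : Fin n → Fin n → F) :
    mix ht c c' b ⟨t + 1, ht⟩ = b ⟨t, by omega⟩ + c' • b ⟨t + 1, ht⟩ := by simp [mix]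

lemma mix_rec1 (ht : t + 1 < n) {c c' : F} (hc : c ≠ c') (b : Fin n → Fin n → F) :
    b ⟨t + 1, ht⟩ = (c' - c)⁻¹ • (mix ht c c' b ⟨t + 1, ht⟩ - mix ht c c' b ⟨t, by omega⟩) := by
  rw [mix_t, mix_t1, add_sub_add_left_eq_sub, ← sub_smul, smul_smul,
    inv_mul_cancel₀ (sub_ne_zero.2 (Ne.symm hc)), one_smul]

lemma mix_rec0 (ht : t + 1 < n) {c c' : F} (b : Fin n → Fin n → F) :
    b ⟨t, by omega⟩ = mix ht c c' b ⟨t, by omega⟩ - c • b ⟨t + 1, ht⟩ := by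
  rw [mix_t]; simp

lemma mix_high (ht : t + 1 < n) {c c' : F} (hc : c ≠ c') (b : Fin n → Fin n → F) (hj : t + 2 ≤ j) :
    fl j (mix ht c c' b) = fl j b := by
  apply le_antisymm
  · apply fl_le
    intro i hi
    have m0 : b ⟨t, by omega⟩ ∈ fl j b := mem_fl (by simp; omega) b
    have m1 : b ⟨t + 1, ht⟩ ∈ fl j b := mem_fl (by simp; omega) b
    unfold mix
    split_ifs
    · exact Submodule.add_mem _ m0 (Submodule.smul_mem _ _ m1)
    · exact Submodule.add_mem _ m0 (Submodule.smul_mem _ _ m1)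
    · exact mem_fl hi b
  · apply fl_le
    intro i hi
    have m0 : mix ht c c' b ⟨t, by omega⟩ ∈ fl j (mix ht c c' b) := mem_fl (by simp; omega) _
    have m1 : mix ht c c' b ⟨t + 1, ht⟩ ∈ fl j (mix ht c c' b) := mem_fl (by simp; omega) _
    have k1 : b ⟨t + 1, ht⟩ ∈ fl j (mix ht c c' b) := by
      rw [mix_rec1 ht hc b]
      exact Submodule.smul_mem _ _ (Submodule.sub_mem _ m1 m0)
    by_cases h1 : (i : ℕ) = t + 1
    · have : i = ⟨t + 1, ht⟩ := Fin.ext h1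
      rw [this]; exact k1
    by_cases h0 : (i : ℕ) = t
    · have : i = ⟨t, by omega⟩ := Fin.ext h0
      rw [this, mix_rec0 ht (c := c) (c' := c') b]
      exact Submodule.sub_mem _ m0 (Submodule.smul_mem _ _ k1)
    · have : mix ht c c' b i = b i := by simp [mix, h0, h1]
      rw [← this]; exact mem_fl hi _

lemma mix_mem (ht : t + 1 < n) {c c' : F} (hc : c ≠ c')
    (hs : ∀ W ∈ s, Module.finrank F W ≠ t + 1) (hb : b ∈ Om s) : mix ht c c' b ∈ Om s := by
  rw [mem_Om] at *
  refine ⟨by rw [mix_high ht hc b (by omega), hb.1], fun W hW => ?_⟩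
  rcases lt_or_gt_of_ne (hs W hW) with h | h
  · rw [mix_low ht c c' b (by omega), hb.2 W hW]
  · rw [mix_high ht hc b (by omega), hb.2 W hW]

lemma mix_inj (ht : t + 1 < n) {c c' : F} (hc : c ≠ c') : Function.Injective (mix ht c c') := by
  intro b b' h
  have e1 : b ⟨t + 1, ht⟩ = b' ⟨t + 1, ht⟩ := by rw [mix_rec1 ht hc b, h, ← mix_rec1 ht hc b']
  have e0 : b ⟨t, by omega⟩ = b' ⟨t, by omega⟩ := by
    rw [mix_rec0 ht (c := c) (c' := c') b, h, e1, ← mix_rec0 ht (c := c) (c' := c') b']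
  funext i
  by_cases h1 : (i : ℕ) = t + 1
  · have : i = ⟨t + 1, ht⟩ := Fin.ext h1
    rw [this]; exact e1
  by_cases h0 : (i : ℕ) = t
  · have : i = ⟨t, by omega⟩ := Fin.ext h0
    rw [this]; exact e0
  · have := congrFun h i
    simpa [mix, h0, h1] using this

/-- The span of the first `t` vectors and vector number `t+1`. -/
def fl' (ht : t + 1 < n) (b : Fin n → Fin n → F) : Submodule F (Fin n → F) :=
  fl t b ⊔ Submodule.span F {b ⟨t + 1, ht⟩}

lemma fl'_act (ht : t + 1 < n) (h : Stab s) :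
    fl' ht (act h b) = (fl' ht b).map h.1.toLinearMap := by
  unfold fl'
  rw [fl_act, Submodule.map_sup, Submodule.map_span, Set.image_singleton]
  rfl

/-- Two distinct points determine a pair of consecutive steps. -/
lemma exists_pair (ht : t + 1 < n) (hs : ∀ W ∈ s, Module.finrank F W ≠ t + 1)
    (hc : ∀ b ∈ Om s, ∀ b' ∈ Om s, fl t b = fl t b') (hb : b ∈ Om s) (hb' : b' ∈ Om s)
    (hne : fl (t + 1) b ≠ fl (t + 1) b') :
    ∃ a ∈ Om s, fl (t + 1) a = fl (t + 1) b ∧ fl' ht a = fl (t + 1) b' := by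
  set v := b' ⟨t, by omega⟩ with hv
  have hb'v : fl (t + 1) b' = fl t b ⊔ Submodule.span F {v} := by
    rw [fl_succ (by omega), hc b hb b' hb']
  have hvb : v ∉ fl (t + 1) b := by
    intro hm
    apply hne
    symm
    apply Submodule.eq_of_le_of_finrank_eq
    · rw [hb'v]
      exact sup_le (fl_mono (Nat.le_succ _) b) ((Submodule.span_singleton_le_iff_mem _ _).2 hm)
    · rw [finrank_Om hb' (by omega), finrank_Om hb (by omega)]
  have key : ∃ a ∈ Om s, fl (t + 1) a = fl (t + 1) b ∧
      fl (t + 2) a = fl (t + 1) b ⊔ Submodule.span F {v} := by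
    set y := fl (t + 1) b ⊔ Submodule.span F {v} with hy
    have hyW : ∀ W ∈ s, t + 1 < Module.finrank F W → y ≤ W := by
      intro W hW hlt
      apply sup_le
      · rw [← (mem_Om.1 hb).2 W hW]; exact fl_mono hlt.le b
      · rw [Submodule.span_singleton_le_iff_mem, ← (mem_Om.1 hb').2 W hW]
        exact mem_fl (by simp; omega) b'
    have hyr : Module.finrank F y = t + 2 := by
      apply le_antisymm
      · have h1 := Submodule.finrank_add_le_finrank_add_finrank (fl (t + 1) b) (Submodule.span F {v})
        rw [finrank_Om hb (by omega), ← hy] at h1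
        have h2 : Module.finrank F (Submodule.span F {v}) ≤ 1 := by
          simpa using finrank_span_le_card (R := F) ({v} : Set (Fin n → F))
        omega
      · have h1 : fl (t + 1) b < y := by
          refine lt_of_le_of_ne le_sup_left fun h => hvb ?_
          rw [h]; exact Submodule.mem_sup_right (Submodule.mem_span_singleton_self v)
        have h2 := Submodule.finrank_lt_finrank_of_lt h1
        rw [finrank_Om hb (by omega)] at h2
        omega
    have hch : IsChain (· ≤ ·)
        ((insert y (insert (fl (t + 1) b) s) : Finset (Submodule F (Fin n → F))) :
          Set (Submodule F (Fin n → F))) := by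
      have h0 : IsChain (· ≤ ·) ((insert (fl (t + 1) b) s : Finset (Submodule F (Fin n → F))) :
          Set (Submodule F (Fin n → F))) := by
        apply Om_chain (b := b)
        rw [← cnd_Om_self hb (by omega)]
        exact self_mem_cnd hb
      rw [Finset.coe_insert]
      apply h0.insert
      intro W hW _
      rcases Finset.mem_insert.1 (Finset.mem_coe.1 hW) with rfl | hW
      · exact Or.inr le_sup_left
      · rcases lt_or_gt_of_ne (hs W hW) with h | h
        · right
          rw [← (mem_Om.1 hb).2 W hW]
          exact (fl_mono h.le b).trans le_sup_left
        · exact Or.inl (hyW W hW h)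
    obtain ⟨a, ha⟩ := Om_nonempty hch
    rw [mem_Om] at ha
    refine ⟨a, mem_Om.2 ⟨ha.1, fun W hW => ha.2 W (by simp [hW])⟩, ?_, ?_⟩
    · have := ha.2 (fl (t + 1) b) (by simp)
      rwa [finrank_Om hb (by omega)] at this
    · have := ha.2 y (by simp)
      rwa [hyr] at this
  obtain ⟨a, ha, ha1, ha2⟩ := key
  have hlow : ∀ j ≤ t + 1, fl j (Function.update a ⟨t + 1, ht⟩ v) = fl j a := by
    intro j hj
    unfold fl
    congr 1
    apply Set.image_congr
    intro i hi
    have : i ≠ ⟨t + 1, ht⟩ := by rintro rfl; simp at hi; omega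
    simp [this]
  have h2 : fl (t + 2) (Function.update a ⟨t + 1, ht⟩ v) = fl (t + 2) a := by
    rw [fl_succ ht, hlow _ le_rfl, Function.update_self, ha1, ha2]
  have hhigh : ∀ j, t + 2 ≤ j → fl j (Function.update a ⟨t + 1, ht⟩ v) = fl j a := by
    intro j hj
    have hsp : fl j (Function.update a ⟨t + 1, ht⟩ v) =
        fl j (spl (t + 2) (Function.update a ⟨t + 1, ht⟩ v) a) := by
      unfold fl
      congr 1
      apply Set.image_congr
      intro i hi
      unfold spl
      split_ifs with h
      · rfl
      · have : i ≠ ⟨t + 1, ht⟩ := by rintro rfl; simp at h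
        simp [this]
    rw [hsp, fl_spl_high hj h2]
  refine ⟨Function.update a ⟨t + 1, ht⟩ v, ?_, by rw [hlow _ le_rfl, ha1], ?_⟩
  · rw [mem_Om] at ha ⊢
    refine ⟨by rw [hhigh n (by omega), ha.1], fun W hW => ?_⟩
    rcases lt_or_gt_of_ne (hs W hW) with h | h
    · rw [hlow _ h.le, ha.2 W hW]
    · rw [hhigh _ h, ha.2 W hW]
  · unfold fl'
    rw [hlow _ (Nat.le_succ _), Function.update_self, hb'v, hc a ha b hb]

end flags
end CB

namespace CB

section flags
variable {F : Type} [Field F] [Fintype F] {n : ℕ}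
variable {s : Finset (Submodule F (Fin n → F))} {b b' : Fin n → Fin n → F} {t i j w : ℕ}

lemma fl'_ne (ht : t + 1 < n) (hb : b ∈ Om s) : fl (t + 1) b ≠ fl' ht b := by
  intro h
  have h1 : fl (t + 2) b = fl (t + 1) b := by
    rw [fl_succ ht]
    apply sup_eq_left.2
    rw [h]; exact le_sup_right
  have h2 := finrank_Om hb (t := t + 2) (by omega)
  rw [h1, finrank_Om hb (by omega)] at h2
  omega

/-- Distinct points are negatively correlated. -/
lemma neg_corr (ht : t + 1 < n) (hs : ∀ W ∈ s, Module.finrank F W ≠ t + 1)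
    (hc : ∀ b ∈ Om s, ∀ b' ∈ Om s, fl t b = fl t b') (h : Submodule F (Fin n → F) → ℝ) :
    ex (Om s) (fun b => h (fl (t + 1) b) * h (fl' ht b)) ≤ ex (Om s) (fun b => h (fl (t + 1) b)) ^ 2 := by
  rcases (Om s).eq_empty_or_nonempty with h0 | hne
  · simp [h0, ex_empty]
  have hswap : ∀ b ∈ Om s, ∃ a ∈ Om s, fl (t + 1) a = fl' ht b := by
    intro b hb
    refine ⟨fun i => b (Equiv.swap ⟨t, by omega⟩ ⟨t + 1, ht⟩ i), ?_, ?_⟩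
    · have hlow : ∀ j ≤ t, fl j (fun i => b (Equiv.swap ⟨t, by omega⟩ ⟨t + 1, ht⟩ i)) = fl j b := by
        intro j hj
        unfold fl
        congr 1
        apply Set.image_congr
        intro i (hi : (i : ℕ) < j)
        rw [Equiv.swap_apply_of_ne_of_ne]
        · rintro rfl; simp at hi; omega
        · rintro rfl; simp at hi; omega
      have hhigh : ∀ j, t + 2 ≤ j → fl j (fun i => b (Equiv.swap ⟨t, by omega⟩ ⟨t + 1, ht⟩ i)) = fl j b := by
        intro j hj
        have hlt : ∀ i : Fin n, (i : ℕ) < j →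
            ((Equiv.swap (⟨t, by omega⟩ : Fin n) ⟨t + 1, ht⟩ i : Fin n) : ℕ) < j := by
          intro i hi
          rw [Equiv.swap_apply_def]
          split_ifs
          · simp; omega
          · simp; omega
          · exact hi
        apply le_antisymm
        · exact fl_le fun i hi => mem_fl (hlt i hi) b
        · apply fl_le
          intro i hi
          have := mem_fl (hlt i hi) (fun i => b (Equiv.swap (⟨t, by omega⟩ : Fin n) ⟨t + 1, ht⟩ i))
          simpa using this
      rw [mem_Om] at hb ⊢
      refine ⟨by rw [hhigh n (by omega), hb.1], fun W hW => ?_⟩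
      rcases lt_or_gt_of_ne (hs W hW) with h | h
      · rw [hlow _ (by omega), hb.2 W hW]
      · rw [hhigh _ h, hb.2 W hW]
    · rw [fl_succ (by omega)]
      unfold fl'
      rw [Equiv.swap_apply_left]
      congr 1
      unfold fl
      congr 1
      apply Set.image_congr
      intro i (hi : (i : ℕ) < t)
      rw [Equiv.swap_apply_of_ne_of_ne]
      · rintro rfl; simp at hi
      · rintro rfl; simp at hi
  set P := (Om s).image (fl (t + 1)) with hP
  have e1 : ex (Om s) (fun b => h (fl (t + 1) b)) = ex P h :=
    ex_unif hne (fl (t + 1)) (fun b hb b' hb' => card_fib _ (fun g b1 b2 hh => by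
      rw [fl_act, fl_act, hh]) hb hb') h
  have himg : (Om s).image (fun b => (fl (t + 1) b, fl' ht b)) =
      (P ×ˢ P).filter (fun p => p.1 ≠ p.2) := by
    ext ⟨p, p'⟩
    simp only [Finset.mem_image, Finset.mem_filter, Finset.mem_product, Prod.mk.injEq]
    constructor
    · rintro ⟨b, hb, rfl, rfl⟩
      obtain ⟨a, ha, hab⟩ := hswap b hb
      exact ⟨⟨Finset.mem_image_of_mem _ hb, by rw [← hab]; exact Finset.mem_image_of_mem _ ha⟩,
        fl'_ne ht hb⟩
    · rintro ⟨⟨hp, hp'⟩, hne⟩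
      obtain ⟨b, hb, rfl⟩ := Finset.mem_image.1 hp
      obtain ⟨b', hb', rfl⟩ := Finset.mem_image.1 hp'
      obtain ⟨a, ha, h1, h2⟩ := exists_pair ht hs hc hb hb' hne
      exact ⟨a, ha, h1, h2⟩
  have e2 : ex (Om s) (fun b => h (fl (t + 1) b) * h (fl' ht b)) =
      ex ((P ×ˢ P).filter (fun p => p.1 ≠ p.2)) (fun p => h p.1 * h p.2) := by
    rw [← himg]
    convert ex_unif hne (fun b => (fl (t + 1) b, fl' ht b)) (fun b hb b' hb' => card_fib _
      (fun g b1 b2 hh => by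
        rw [Prod.mk.injEq] at hh
        simp only [fl_act, fl'_act, hh.1, hh.2]) hb hb') (fun p => h p.1 * h p.2)
  rw [e1, e2]
  have hsum : ∀ k : Submodule F (Fin n → F) → ℝ,
      ∑ p ∈ (P ×ˢ P).filter (fun p => p.1 ≠ p.2), k p.1 * k p.2 = (∑ p ∈ P, k p) ^ 2 - ∑ p ∈ P, k p ^ 2 := by
    intro k
    have h1 := Finset.sum_filter_add_sum_filter_not (P ×ˢ P) (fun p => p.1 = p.2) (fun p => k p.1 * k p.2)
    have h2 : ∑ p ∈ (P ×ˢ P).filter (fun p => p.1 = p.2), k p.1 * k p.2 = ∑ p ∈ P, k p ^ 2 := by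
      rw [Finset.sum_filter, Finset.sum_product]
      refine Finset.sum_congr rfl fun p hp => ?_
      simp only [Finset.sum_ite_eq, hp, if_true]
      ring
    have h3 : ∑ p ∈ P ×ˢ P, k p.1 * k p.2 = (∑ p ∈ P, k p) ^ 2 := by
      rw [Finset.sum_product, sq, Finset.sum_mul_sum]
    linarith
  have hcard := hsum (fun _ => 1)
  simp only [mul_one, one_pow, Finset.sum_const, nsmul_eq_mul] at hcard
  unfold ex
  rw [hsum h, hcard]
  have hcs : (∑ p ∈ P, h p) ^ 2 ≤ P.card * ∑ p ∈ P, h p ^ 2 := sq_sum_le_card_mul_sum_sq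
  set S := ∑ p ∈ P, h p
  set Q := ∑ p ∈ P, h p ^ 2
  have hPne : 1 < P.card := by
    obtain ⟨b, hb⟩ := hne
    obtain ⟨a, ha, hab⟩ := hswap b hb
    exact Finset.one_lt_card.2 ⟨_, Finset.mem_image_of_mem _ hb, _, Finset.mem_image_of_mem _ ha,
      by rw [hab]; exact fl'_ne ht hb⟩
  have hN : (1 : ℝ) < P.card := by exact_mod_cast hPne
  set N : ℝ := (P.card : ℝ)
  have hN1 : 0 < N ^ 2 - N := by nlinarith
  rw [div_pow, div_le_div_iff₀ hN1 (by positivity)]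
  nlinarith

/-- The base case: points and lines. -/
lemma PE_base (ht : t + 1 < n) (hc : ∀ b ∈ Om s, ∀ b' ∈ Om s, fl t b = fl t b') {l : ℝ}
    (hl : 0 < l) (hq : 1 ≤ l ^ 2 * Fintype.card F) : PE (Om s) (fl (t + 1)) (fl (t + 2)) l := by
  by_cases hs : ∀ W ∈ s, Module.finrank F W ≠ t + 1
  swap
  · push Not at hs
    obtain ⟨W, hW, hWr⟩ := hs
    exact PE_const_left hl.le W fun b hb => by
      have := (mem_Om.1 hb).2 W hW
      rwa [hWr] at this
  apply PE_of_avg hl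
  intro h
  set q : ℝ := (Fintype.card F : ℝ) with hqd
  have hq0 : 0 < q := by
    have : 0 < Fintype.card F := Fintype.card_pos
    rw [hqd]; exact_mod_cast this
  set X : F → (Fin n → Fin n → F) → ℝ := fun c b =>
    h (fl t b ⊔ Submodule.span F {b ⟨t, by omega⟩ + c • b ⟨t + 1, ht⟩}) with hX
  have hmix : ∀ c c' b, h (fl (t + 1) (mix ht c c' b)) = X c b := by
    intro c c' b
    rw [fl_succ (by omega), mix_low ht c c' b le_rfl, mix_t]
  have hmix' : ∀ c c' b, h (fl' ht (mix ht c c' b)) = X c' b := by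
    intro c c' b
    unfold fl'
    rw [mix_low ht c c' b le_rfl, mix_t1]
  have hcc : ∀ c : F, c ≠ c + 1 := fun c hh => one_ne_zero (left_eq_add.1 hh)
  have hinv : ∀ c c' : F, c ≠ c' → ∀ φ : (Fin n → Fin n → F) → ℝ,
      ex (Om s) (fun b => φ (mix ht c c' b)) = ex (Om s) φ := fun c c' hne φ =>
    ex_of_inj (fun b hb => mix_mem ht hne hs hb) (fun _ _ _ _ hh => mix_inj ht hne hh) φ
  have hm : ∀ c, ex (Om s) (X c) = ex (Om s) (fun b => h (fl (t + 1) b)) := by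
    intro c
    rw [← hinv c (c + 1) (hcc c) (fun b => h (fl (t + 1) b))]
    exact ex_congr fun b _ => (hmix c _ b).symm
  have hm2 : ∀ c, ex (Om s) (fun b => X c b * X c b) =
      ex (Om s) (fun b => h (fl (t + 1) b) * h (fl (t + 1) b)) := by
    intro c
    rw [← hinv c (c + 1) (hcc c) (fun b => h (fl (t + 1) b) * h (fl (t + 1) b))]
    exact ex_congr fun b _ => by rw [hmix c _ b]
  have hmk : ∀ c (k : Submodule F (Fin n → F) → ℝ), ex (Om s) (fun b => X c b * k (fl (t + 2) b)) =
      ex (Om s) (fun b => h (fl (t + 1) b) * k (fl (t + 2) b)) := by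
    intro c k
    rw [← hinv c (c + 1) (hcc c) (fun b => h (fl (t + 1) b) * k (fl (t + 2) b))]
    exact ex_congr fun b _ => by rw [hmix c _ b, mix_high ht (hcc c) b le_rfl]
  have hoff : ∀ c c', c ≠ c' → ex (Om s) (fun b => X c b * X c' b) ≤
      ex (Om s) (fun b => h (fl (t + 1) b)) ^ 2 := by
    intro c c' hne
    refine le_trans (le_of_eq ?_) (neg_corr ht hs hc h)
    rw [← hinv c c' hne (fun b => h (fl (t + 1) b) * h (fl' ht b))]
    exact ex_congr fun b _ => by rw [hmix c c' b, hmix' c c' b]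
  have hA1 : ex (Om s) (fun b => q⁻¹ * ∑ c, X c b) = ex (Om s) (fun b => h (fl (t + 1) b)) := by
    rw [ex_mul_left, ex_sum, Finset.sum_congr rfl fun c _ => hm c, Finset.sum_const, nsmul_eq_mul,
      Finset.card_univ, ← hqd]
    field_simp
  refine ⟨fun b => q⁻¹ * ∑ c, X c b, fun k => ?_, ?_⟩
  · unfold cov
    rw [hA1]
    congr 1
    have : (fun b => (q⁻¹ * ∑ c, X c b) * k (fl (t + 2) b)) =
        fun b => q⁻¹ * ∑ c, X c b * k (fl (t + 2) b) := by
      funext b; rw [mul_assoc, Finset.sum_mul]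
    rw [this, ex_mul_left, ex_sum, Finset.sum_congr rfl fun c _ => hmk c k, Finset.sum_const,
      nsmul_eq_mul, Finset.card_univ, ← hqd]
    field_simp
  · set m := ex (Om s) (fun b => h (fl (t + 1) b)) with hmdef
    set D := ex (Om s) (fun b => h (fl (t + 1) b) * h (fl (t + 1) b)) with hD
    have hv : 0 ≤ D - m * m := var_nonneg (Ω := Om s) (fun b => h (fl (t + 1) b))
    have hcov : cov (Om s) (fun b => h (fl (t + 1) b)) (fun b => h (fl (t + 1) b)) = D - m * m := rfl
    rw [hcov]
    unfold cov
    rw [hA1]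
    have e1 : (fun b => (q⁻¹ * ∑ c, X c b) * (q⁻¹ * ∑ c, X c b)) =
        fun b => q⁻¹ * (q⁻¹ * ∑ c, ∑ c', X c b * X c' b) := by
      funext b; rw [← Finset.sum_mul_sum]; ring
    rw [e1, ex_mul_left, ex_mul_left, ex_sum]
    have e2 : ∀ c ∈ (Finset.univ : Finset F), ex (Om s) (fun b => ∑ c', X c b * X c' b) ≤
        D + (q - 1) * m ^ 2 := by
      intro c _
      rw [ex_sum, ← Finset.add_sum_erase _ _ (Finset.mem_univ c), hm2]
      gcongr
      refine (Finset.sum_le_sum fun c' hc' => hoff c c' (Finset.ne_of_mem_erase hc').symm).trans ?_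
      rw [Finset.sum_const, nsmul_eq_mul, Finset.card_erase_of_mem (Finset.mem_univ c),
        Finset.card_univ, Nat.cast_sub Fintype.card_pos, ← hqd]
      simp
    have e3 := Finset.sum_le_sum e2
    rw [Finset.sum_const, nsmul_eq_mul, Finset.card_univ, ← hqd] at e3
    have e4 : q⁻¹ * (q⁻¹ * ∑ c, ex (Om s) (fun b => ∑ c', X c b * X c' b)) ≤
        q⁻¹ * (q⁻¹ * (q * (D + (q - 1) * m ^ 2))) := by gcongr
    have e5 : q⁻¹ * (q⁻¹ * (q * (D + (q - 1) * m ^ 2))) - m * m = q⁻¹ * (D - m * m) := by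
      field_simp; ring
    have e6 : q⁻¹ ≤ l ^ 2 := by
      rw [inv_le_iff_one_le_mul₀ hq0]; linarith
    have e7 := mul_le_mul_of_nonneg_right e6 hv
    linarith

/-- Given the flag member of dimension `w`, lower and upper parts are independent. -/
lemma indep_fl {p r : Type} (hwn : w ≤ n) (hc : ∀ b ∈ Om s, ∀ b' ∈ Om s, fl w b = fl w b')
    {a : (Fin n → Fin n → F) → p} {c : (Fin n → Fin n → F) → r} (φ : p → ℝ) (ψ : r → ℝ)
    (ha : ∀ b b', fl w b = fl w b' → a (spl w b b') = a b)
    (hc' : ∀ b b', fl w b = fl w b' → c (spl w b b') = c b') :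
    ex (Om s) (fun b => φ (a b) * ψ (c b)) = ex (Om s) (fun b => φ (a b)) * ex (Om s) (fun b => ψ (c b)) :=
  indep_spl hwn hc (φ := fun b => φ (a b)) (ψ := fun b => ψ (c b))
    (fun b hb b' hb' => by simp only [ha b b' (hc b hb b' hb')])
    (fun b hb b' hb' => by simp only [hc' b b' (hc b hb b' hb')])

lemma const_of_mem {W : Submodule F (Fin n → F)} (hW : W ∈ s) (hw : Module.finrank F W = w) :
    ∀ b ∈ Om s, ∀ b' ∈ Om s, fl w b = fl w b' := by
  intro b hb b' hb'
  rw [← hw, (mem_Om.1 hb).2 W hW, (mem_Om.1 hb').2 W hW]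

lemma condindep (hi : i ≤ w) (hj : w ≤ j) (hwn : w ≤ n) (v : Submodule F (Fin n → F))
    (φ ψ : Submodule F (Fin n → F) → ℝ) :
    ex (cnd (Om s) (fl w) v) (fun b => φ (fl i b) * ψ (fl j b)) =
      ex (cnd (Om s) (fl w) v) (fun b => φ (fl i b)) * ex (cnd (Om s) (fl w) v) (fun b => ψ (fl j b)) := by
  rcases cnd_Om_cases (s := s) hwn v with h | ⟨hv, h⟩
  · simp [h, ex_empty]
  · rw [h]
    exact indep_fl hwn (const_of_mem (Finset.mem_insert_self v s) hv) φ ψ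
      (fun b b' _ => fl_spl_low hi) (fun b b' hh => fl_spl_high hj hh)

/-- Conditioning further on the past does not change the law of the future. -/
lemma cond_past (hb : b ∈ Om s) (hi : i ≤ w) (hj : w ≤ j) (hwn : w ≤ n)
    (ψ : Submodule F (Fin n → F) → ℝ) :
    ex (cnd (cnd (Om s) (fl i) (fl i b)) (fl w) (fl w b)) (fun a => ψ (fl j a)) =
      ex (cnd (Om s) (fl w) (fl w b)) (fun a => ψ (fl j a)) := by
  have h := condindep (s := s) hi hj hwn (fl w b) (fun v => ind (v = fl i b)) ψ
  rw [cnd_comm]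
  set Ω := cnd (Om s) (fl w) (fl w b)
  have hbΩ : b ∈ Ω := self_mem_cnd hb
  have hbc : b ∈ cnd Ω (fl i) (fl i b) := self_mem_cnd hbΩ
  have hc1 : (Ω.card : ℝ) ≠ 0 := by exact_mod_cast (Finset.card_pos.2 ⟨b, hbΩ⟩).ne'
  have hc2 : ((cnd Ω (fl i) (fl i b)).card : ℝ) ≠ 0 := by
    exact_mod_cast (Finset.card_pos.2 ⟨b, hbc⟩).ne'
  unfold ex at h ⊢
  have e1 : ∑ a ∈ Ω, ind (fl i a = fl i b) * ψ (fl j a) = ∑ a ∈ cnd Ω (fl i) (fl i b), ψ (fl j a) := by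
    unfold cnd; rw [Finset.sum_filter]
    refine Finset.sum_congr rfl fun a _ => ?_
    unfold ind; split_ifs <;> simp
  have e2 : ∑ a ∈ Ω, ind (fl i a = fl i b) = ((cnd Ω (fl i) (fl i b)).card : ℝ) := by
    unfold cnd; rw [Finset.card_filter]; push_cast
    refine Finset.sum_congr rfl fun a _ => ?_
    unfold ind; split_ifs <;> simp
  rw [e1, e2] at h
  field_simp at h ⊢
  linarith

/-- Consecutive flag members form an expander. -/
lemma PE_succ {l : ℝ} (hl : 0 < l) (hl2 : l ^ 2 ≤ 1 / 2) (hq : 2 ≤ l ^ 2 * Fintype.card F) (ht : t + 1 ≤ n) :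
    PE (Om s) (fl t) (fl (t + 1)) l := by
  induction t generalizing s with
  | zero => exact PE_const_left hl.le ⊥ fun b _ => fl_zero b
  | succ t ih =>
    set l0 := Real.sqrt (l ^ 2 / 2) with hl0
    have hl0s : l0 ^ 2 = l ^ 2 / 2 := Real.sq_sqrt (by positivity)
    have hl00 : 0 < l0 := Real.sqrt_pos.2 (by positivity)
    have ih' : VE (Om s) (fl (t + 1)) (fl t) (l ^ 2) := VE_of_PE hl (ih (s := s) (by omega))
    have base : ∀ v, VE (cnd (Om s) (fl t) v) (fl (t + 2)) (fl (t + 1)) (l0 ^ 2) := by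
      intro v
      rcases cnd_Om_cases (s := s) (t := t) (by omega) v with h | ⟨hv, h⟩
      · rw [h]; intro k; simp [cov, ex_empty]
      · rw [h]
        exact VE_of_PE hl00 (PE_base (by omega) (const_of_mem (Finset.mem_insert_self v s) hv) hl00
          (by rw [hl0s]; linarith))
    apply PE.symm
    apply PE_of_VE hl
    intro k
    set u : (Fin n → Fin n → F) → ℝ := fun b =>
      ex (cnd (Om s) (fl (t + 1)) (fl (t + 1) b)) (fun a => k (fl (t + 2) a)) with hu
    have e1 := cov_total (Ω := Om s) (fl t) u u
    have e2 : cov (Om s) (fun b => ex (cnd (Om s) (fl t) (fl t b)) u)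
        (fun b => ex (cnd (Om s) (fl t) (fl t b)) u) ≤ l ^ 2 * cov (Om s) u u :=
      ih' (fun v => ex (cnd (Om s) (fl (t + 1)) v) (fun a => k (fl (t + 2) a)))
    have e3 := cov_total (Ω := Om s) (fl t) (fun a => k (fl (t + 2) a)) (fun a => k (fl (t + 2) a))
    have e4 := var_nonneg (Ω := Om s) (fun b => ex (cnd (Om s) (fl t) (fl t b)) (fun a => k (fl (t + 2) a)))
    have e5 : ex (Om s) (fun b => cov (cnd (Om s) (fl t) (fl t b)) u u) ≤
        l0 ^ 2 * ex (Om s) (fun b => cov (cnd (Om s) (fl t) (fl t b)) (fun a => k (fl (t + 2) a))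
          (fun a => k (fl (t + 2) a))) := by
      rw [← ex_mul_left]
      apply ex_mono
      intro b hb
      refine le_trans (le_of_eq ?_) (base (fl t b) k)
      have hcong : ∀ a ∈ cnd (Om s) (fl t) (fl t b), u a =
          ex (cnd (cnd (Om s) (fl t) (fl t b)) (fl (t + 1)) (fl (t + 1) a)) (fun a => k (fl (t + 2) a)) := by
        intro a ha
        rw [mem_cnd] at ha
        rw [← ha.2]
        exact (cond_past ha.1 (by omega) (by omega) (by omega) k).symm
      unfold cov
      rw [ex_congr hcong, ex_congr (φ := fun a => u a * u a) fun a ha => by rw [hcong a ha]]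
    have e6 := var_nonneg (Ω := Om s) u
    rw [hl0s] at e5
    change cov (Om s) u u ≤ _
    nlinarith

/-- Any two flag members form an expander. -/
lemma PE_fl {l : ℝ} (hl : 0 < l) (hl2 : l ^ 2 ≤ 1 / 2) (hq : 2 ≤ l ^ 2 * Fintype.card F)
    (hi : i ≤ n) (hj : j ≤ n) (hij : i ≠ j) : PE (Om s) (fl i) (fl j) l := by
  wlog h : i < j generalizing i j
  · exact (this hj hi hij.symm (by omega)).symm
  apply PE_of_avg hl
  intro φ
  refine ⟨fun b => ex (cnd (Om s) (fl (i + 1)) (fl (i + 1) b)) (fun a => φ (fl i a)), fun ψ => ?_, ?_⟩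
  · unfold cov
    rw [ex_tower]
    congr 1
    rw [← ex_tower (fl (i + 1)) (fun b => φ (fl i b) * ψ (fl j b)),
      ← ex_tower' (fl (i + 1)) (fun v b => ex (cnd (Om s) (fl (i + 1)) v) (fun a => φ (fl i a)) * ψ (fl j b))]
    refine ex_congr fun b _ => ?_
    rw [ex_mul_left, condindep (by omega) h (by omega)]
  · exact VE_of_PE hl (PE_succ (s := s) hl hl2 hq (by omega)).symm φ

end flags
end CB

/-! ### Lattice lemmas, cones, and vanishing of the first cohomology -/

namespace CB

/-- A rank function on a lattice, with interpolation. -/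
structure RL {α : Type} [Lattice α] (r : α → ℕ) : Prop where
  mono : ∀ x y, x ≤ y → r x ≤ r y
  mod : ∀ x y, r (x ⊔ y) + r (x ⊓ y) = r x + r y
  interp : ∀ x y m, x ≤ y → r x ≤ m → m ≤ r y → ∃ z, x ≤ z ∧ z ≤ y ∧ r z = m

section lattice
variable {α : Type} [Lattice α] {r : α → ℕ}

lemma RL.exchange (R : RL r) {u u' : α} (h : r u = r u') {e j : ℕ} (he : r (u ⊓ u') + e = r u)
    (hj : j ≤ e) : ∃ v, u ⊓ u' ≤ v ∧ v ≤ u ⊔ u' ∧ r v = r u ∧ r (u ⊔ v) = r u + j ∧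
      r (v ⊔ u') + j = r u + e := by
  obtain ⟨a, ha1, ha2, ha3⟩ := R.interp (u ⊓ u') u (r (u ⊓ u') + (e - j)) inf_le_left (by omega) (by omega)
  obtain ⟨c, hc1, hc2, hc3⟩ := R.interp (u ⊓ u') u' (r (u ⊓ u') + j) inf_le_right (by omega) (by omega)
  have m1 : a ⊓ c = u ⊓ u' := le_antisymm (inf_le_inf ha2 hc2) (le_inf ha1 hc1)
  have m2 : u ⊓ c = u ⊓ u' := le_antisymm (inf_le_inf le_rfl hc2) (le_inf inf_le_left hc1)
  have m3 : a ⊓ u' = u ⊓ u' := le_antisymm (inf_le_inf ha2 le_rfl) (le_inf ha1 inf_le_right)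
  have e1 := R.mod a c
  have e2 := R.mod u c
  have e3 := R.mod a u'
  rw [m1] at e1; rw [m2] at e2; rw [m3] at e3
  have s1 : u ⊔ (a ⊔ c) = u ⊔ c := by rw [← sup_assoc, sup_eq_left.2 ha2]
  have s2 : (a ⊔ c) ⊔ u' = a ⊔ u' := by rw [sup_assoc, sup_eq_right.2 hc2]
  refine ⟨a ⊔ c, ha1.trans le_sup_left, sup_le_sup ha2 hc2, by omega, ?_, ?_⟩
  · rw [s1]; omega
  · rw [s2]; omega

lemma RL.H1 (R : RL r) {L U : α} {i k : ℕ} (hk : k ≤ r U) (h3 : 3 * i ≤ k + 2 * r L) {u v w : α}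
    (hu : r u = i ∧ L ≤ u ∧ u ≤ U) (hv : r v = i ∧ L ≤ v ∧ v ≤ U) (hw : r w = i ∧ L ≤ w ∧ w ≤ U) :
    ∃ P, (r P = k ∧ L ≤ P ∧ P ≤ U) ∧ u ≤ P ∧ v ≤ P ∧ w ≤ P := by
  have e1 := R.mod u v
  have e2 := R.mod (u ⊔ v) w
  have e3 := R.mono L (u ⊓ v) (le_inf hu.2.1 hv.2.1)
  have e4 := R.mono L ((u ⊔ v) ⊓ w) (le_inf (hu.2.1.trans le_sup_left) hw.2.1)
  obtain ⟨P, p1, p2, p3⟩ := R.interp (u ⊔ v ⊔ w) U k (sup_le (sup_le hu.2.2 hv.2.2) hw.2.2)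
    (by omega) hk
  exact ⟨P, ⟨p3, hu.2.1.trans (le_sup_left.trans (le_sup_left.trans p1)), p2⟩,
    le_sup_left.trans (le_sup_left.trans p1), le_sup_right.trans (le_sup_left.trans p1),
    le_sup_right.trans p1⟩

lemma RL.H2 (R : RL r) {L U : α} {i j k : ℕ} (hjk : j ≤ k) (h2 : 2 * i ≤ j + r L) {u v P : α}
    (hu : r u = i ∧ L ≤ u ∧ u ≤ U) (hv : r v = i ∧ L ≤ v ∧ v ≤ U) (hP : r P = k ∧ L ≤ P ∧ P ≤ U)
    (h1 : u ≤ P) (h1' : v ≤ P) : ∃ l, (r l = j ∧ L ≤ l ∧ l ≤ U) ∧ u ≤ l ∧ v ≤ l ∧ l ≤ P := by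
  have e1 := R.mod u v
  have e3 := R.mono L (u ⊓ v) (le_inf hu.2.1 hv.2.1)
  obtain ⟨l, p1, p2, p3⟩ := R.interp (u ⊔ v) P j (sup_le h1 h1') (by omega) (by omega)
  exact ⟨l, ⟨p3, hu.2.1.trans (le_sup_left.trans p1), p2.trans hP.2.2⟩, le_sup_left.trans p1,
    le_sup_right.trans p1, p2⟩

lemma RL.H3 (R : RL r) {L U : α} {i j k : ℕ} (hk : k ≤ r U) (h3 : 3 * j ≤ 2 * k + i)
    (hij : i ≤ j) {u v l l' : α}
    (hu : r u = i ∧ L ≤ u ∧ u ≤ U) (_hv : r v = i ∧ L ≤ v ∧ v ≤ U)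
    (hl : r l = j ∧ L ≤ l ∧ l ≤ U) (hl' : r l' = j ∧ L ≤ l' ∧ l' ≤ U)
    (h1 : u ≤ l) (h2 : v ≤ l) (h1' : u ≤ l') (h2' : v ≤ l') :
    ∃ l'' P1 P2, (r l'' = j ∧ L ≤ l'' ∧ l'' ≤ U) ∧ (r P1 = k ∧ L ≤ P1 ∧ P1 ≤ U) ∧
      (r P2 = k ∧ L ≤ P2 ∧ P2 ≤ U) ∧ u ≤ l'' ∧ v ≤ l'' ∧ l ≤ P1 ∧ l'' ≤ P1 ∧ l'' ≤ P2 ∧ l' ≤ P2 := by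
  have e1 := R.mono u (l ⊓ l') (le_inf h1 h1')
  have e2 := R.mono (l ⊓ l') l inf_le_left
  obtain ⟨w, w1, w2, w3, w4, w5⟩ := R.exchange (u := l) (u' := l') (by omega)
    (e := j - r (l ⊓ l')) (j := (j - r (l ⊓ l') + 1) / 2) (by omega) (by omega)
  have hwU : w ≤ U := w2.trans (sup_le hl.2.2 hl'.2.2)
  have hLw : L ≤ w := (le_inf hl.2.1 hl'.2.1).trans w1
  obtain ⟨P1, p1, p2, p3⟩ := R.interp (l ⊔ w) U k (sup_le hl.2.2 hwU) (by omega) hk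
  obtain ⟨P2, p1', p2', p3'⟩ := R.interp (w ⊔ l') U k (sup_le hwU hl'.2.2) (by omega) hk
  exact ⟨w, P1, P2, ⟨by omega, hLw, hwU⟩, ⟨p3, hl.2.1.trans (le_sup_left.trans p1), p2⟩,
    ⟨p3', hLw.trans (le_sup_left.trans p1'), p2'⟩, (le_inf h1 h1').trans w1, (le_inf h2 h2').trans w1,
    le_sup_left.trans p1, le_sup_right.trans p1, le_sup_left.trans p1', le_sup_right.trans p1'⟩

lemma RL.conn (R : RL r) {z T : α} (hT : ∀ x, x ≤ T) {j k : ℕ} (hjk : j < k) (hk : k ≤ r T) {β : Type}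
    (φ : α → β) (hφ : ∀ u u' w, r u = j → r u' = j → r w = k → z ≤ u → z ≤ u' → u ≤ w → u' ≤ w → φ u = φ u')
    (u u' : α) (hu : r u = j) (hu' : r u' = j) (hz : z ≤ u) (hz' : z ≤ u') : φ u = φ u' := by
  obtain ⟨e, he⟩ : ∃ e, e = j - r (u ⊓ u') := ⟨_, rfl⟩
  induction e generalizing u with
  | zero =>
    have e1 := R.mod u u'
    obtain ⟨w, w1, _, w3⟩ := R.interp (u ⊔ u') T k (hT _) (by omega) hk
    exact hφ u u' w hu hu' w3 hz hz' (le_sup_left.trans w1) (le_sup_right.trans w1)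
  | succ e ih =>
    have e2 := R.mono (u ⊓ u') u inf_le_left
    obtain ⟨v, v1, v2, v3, v4, v5⟩ := R.exchange (u := u) (u' := u') (by omega) (e := e + 1) (j := 1)
      (by omega) (by omega)
    have hzv : z ≤ v := (le_inf hz hz').trans v1
    obtain ⟨w, w1, _, w3⟩ := R.interp (u ⊔ v) T k (hT _) (by omega) hk
    rw [hφ u v w hu (by omega) w3 hz hzv (le_sup_left.trans w1) (le_sup_right.trans w1)]
    have e3 := R.mod v u'
    exact ih v (by omega) hzv (by omega)

lemma RL.dual (R : RL r) {n : ℕ} (hn : ∀ x, r x ≤ n) :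
    RL (α := αᵒᵈ) (fun x => n - r (OrderDual.ofDual x)) where
  mono x y h := by
    have := R.mono (OrderDual.ofDual y) (OrderDual.ofDual x) h
    exact Nat.sub_le_sub_left this n
  mod x y := by
    have h := R.mod (OrderDual.ofDual x) (OrderDual.ofDual y)
    have h1 := hn (OrderDual.ofDual x)
    have h2 := hn (OrderDual.ofDual y)
    have h3 := hn (OrderDual.ofDual x ⊔ OrderDual.ofDual y)
    have h4 := hn (OrderDual.ofDual x ⊓ OrderDual.ofDual y)
    show n - r (OrderDual.ofDual x ⊓ OrderDual.ofDual y) + (n - r (OrderDual.ofDual x ⊔ OrderDual.ofDual y))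
      = n - r (OrderDual.ofDual x) + (n - r (OrderDual.ofDual y))
    omega
  interp x y m hxy h1 h2 := by
    have hy := hn (OrderDual.ofDual y)
    have hx := hn (OrderDual.ofDual x)
    obtain ⟨z, z1, z2, z3⟩ := R.interp (OrderDual.ofDual y) (OrderDual.ofDual x) (n - m) hxy
      (by omega) (by omega)
    exact ⟨OrderDual.toDual z, z2, z1, by simp; omega⟩
end lattice

section flags
variable {F : Type} [Field F] [Fintype F] {n : ℕ} {Γ : Type} [Group Γ]
variable {s : Finset (Submodule F (Fin n → F))} {b b' : Fin n → Fin n → F} {t i j k l u w : ℕ}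

lemma finrank_le_n (W : Submodule F (Fin n → F)) : Module.finrank F W ≤ n := by
  simpa using Submodule.finrank_le W

lemma RLsub : RL (fun W : Submodule F (Fin n → F) => Module.finrank F W) where
  mono x y h := Submodule.finrank_mono h
  mod x y := Submodule.finrank_sup_add_finrank_inf_eq x y
  interp x y m hxy h1 h2 := by
    have hch : IsChain (· ≤ ·) (({x, y} : Finset (Submodule F (Fin n → F))) : Set (Submodule F (Fin n → F))) := by
      rw [Finset.coe_pair]
      exact IsChain.pair hxy
    obtain ⟨b, hb⟩ := Om_nonempty hch
    have hb' := mem_Om.1 hb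
    refine ⟨fl m b, ?_, ?_, finrank_Om hb (h2.trans (finrank_le_n y))⟩
    · rw [← hb'.2 x (by simp)]; exact fl_mono h1 b
    · conv_rhs => rw [← hb'.2 y (by simp)]
      exact fl_mono h2 b

/-- Any chain of three subspaces in a gap of `s` is in a flag. -/
lemma exists_three (hne : (Om s).Nonempty) {L U : Submodule F (Fin n → F)} (hL : ∀ b ∈ Om s, fl l b = L)
    (hU : ∀ b ∈ Om s, fl u b = U) (hgap : ∀ W ∈ s, Module.finrank F W ≤ l ∨ u ≤ Module.finrank F W)
    {x y z : Submodule F (Fin n → F)} (hx : Module.finrank F x = i ∧ L ≤ x ∧ x ≤ U)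
    (hy : Module.finrank F y = j ∧ L ≤ y ∧ y ≤ U) (hz : Module.finrank F z = k ∧ L ≤ z ∧ z ≤ U)
    (hxy : x ≤ y) (hyz : y ≤ z) : ∃ b ∈ Om s, fl i b = x ∧ fl j b = y ∧ fl k b = z := by
  obtain ⟨b0, hb0⟩ := hne
  have hcomp : ∀ W ∈ s, W ≤ L ∨ U ≤ W := by
    intro W hW
    have e := (mem_Om.1 hb0).2 W hW
    rcases hgap W hW with h | h
    · left; rw [← e, ← hL b0 hb0]; exact fl_mono h b0
    · right; rw [← e, ← hU b0 hb0]; exact fl_mono h b0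
  have hch : IsChain (· ≤ ·) ((insert x (insert y (insert z s)) : Finset (Submodule F (Fin n → F))) :
      Set (Submodule F (Fin n → F))) := by
    have h0 := Om_chain hb0
    have hc : ∀ p : Submodule F (Fin n → F), L ≤ p → p ≤ U → ∀ W ∈ s, p ≤ W ∨ W ≤ p := by
      intro p h1 h2 W hW
      rcases hcomp W hW with h | h
      · exact Or.inr (h.trans h1)
      · exact Or.inl (h2.trans h)
    rw [Finset.coe_insert, Finset.coe_insert, Finset.coe_insert]
    refine ((h0.insert fun W hW _ => hc z hz.2.1 hz.2.2 W hW).insert ?_).insert ?_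
    · rintro W hW _
      rcases hW with rfl | hW
      · exact Or.inl hyz
      · exact hc y hy.2.1 hy.2.2 W hW
    · rintro W hW _
      rcases hW with rfl | rfl | hW
      · exact Or.inl hxy
      · exact Or.inl (hxy.trans hyz)
      · exact hc x hx.2.1 hx.2.2 W hW
  obtain ⟨b, hb⟩ := Om_nonempty hch
  have hb := mem_Om.1 hb
  refine ⟨b, mem_Om.2 ⟨hb.1, fun W hW => hb.2 W (by simp [hW])⟩, ?_, ?_, ?_⟩
  · rw [← hx.1]; exact hb.2 x (by simp)
  · rw [← hy.1]; exact hb.2 y (by simp)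
  · rw [← hz.1]; exact hb.2 z (by simp)

lemma C_apply {i j k : ℕ} (cd : ConeData (Om s) fl i j k) (hij : i ≠ j) (hjk : j ≠ k) (hik : i ≠ k) :
    Cob Γ (Om s) fl {i, j, k} 63 :=
  C_lemma cd hij hjk hik (H := Stab s) (fun h v => v.map h.1.toLinearMap)
    (fun h v => v.map h.1.symm.toLinearMap) act
    (fun h v => by
      rw [← Submodule.map_comp]
      convert Submodule.map_id v
      ext1 x; simp)
    (fun h ω hω => act_mem h hω) (fun t h ω _ => fl_act h) (fun h φ => ex_act h φ)
    (fun ω hω φ => avg_act hω φ)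

lemma Cob_empty {X V : Type} {x : ℕ → X → V} {J : Finset ℕ} {B : ℝ} : Cob Γ (∅ : Finset X) x J B :=
  fun _ _ => ⟨fun _ _ => 1, by simp [pr, ex_empty]⟩

/-- Coboundary expansion of three types in a gap, cone from below. -/
lemma C_fl {L U : Submodule F (Fin n → F)} (hL : ∀ b ∈ Om s, fl l b = L)
    (hU : ∀ b ∈ Om s, fl u b = U) (hgap : ∀ W ∈ s, Module.finrank F W ≤ l ∨ u ≤ Module.finrank F W)
    (hli : l ≤ i) (hij : i < j) (hjk : j < k) (hku : k ≤ u) (hun : u ≤ n)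
    (c1 : 2 * i ≤ j + l) (c2 : 3 * i ≤ k + 2 * l) (c3 : 3 * j ≤ 2 * k + i) :
    Cob Γ (Om s) fl {i, j, k} 63 := by
  rcases (Om s).eq_empty_or_nonempty with h0 | hne
  · rw [h0]; exact Cob_empty
  have hlr : Module.finrank F L = l := by
    obtain ⟨b, hb⟩ := hne; rw [← hL b hb]; exact finrank_Om hb (by omega)
  have hur : Module.finrank F U = u := by
    obtain ⟨b, hb⟩ := hne; rw [← hU b hb]; exact finrank_Om hb (by omega)
  have hmem : ∀ t, l ≤ t → t ≤ u → ∀ b ∈ Om s,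
      Module.finrank F (fl t b) = t ∧ L ≤ fl t b ∧ fl t b ≤ U := by
    intro t h1 h2 b hb
    refine ⟨finrank_Om hb (by omega), ?_, ?_⟩
    · rw [← hL b hb]; exact fl_mono h1 b
    · rw [← hU b hb]; exact fl_mono h2 b
  let P : ℕ → Submodule F (Fin n → F) → Prop := fun t W => Module.finrank F W = t ∧ L ≤ W ∧ W ≤ U
  exact C_apply (Γ := Γ) (s := s)
    { le := (· ≤ ·), A := P i, B := P j, C := P k
      trans := fun _ _ _ => le_trans
      hA := hmem i (by omega) (by omega)
      hB := hmem j (by omega) (by omega)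
      hC := hmem k (by omega) (by omega)
      hAB := fun b _ => fl_mono hij.le b
      hBC := fun b _ => fl_mono hjk.le b
      hT := fun x y z hx hy hz h1 h2 => exists_three hne hL hU hgap hx hy hz h1 h2
      H1 := fun x y z hx hy hz => RLsub.H1 (r := fun W : Submodule F (Fin n → F) => Module.finrank F W)
        (by simp only [hur]; omega) (by simp only [hlr]; omega) hx hy hz
      H2 := fun x y p hx hy hp h1 h2 => RLsub.H2 (r := fun W : Submodule F (Fin n → F) => Module.finrank F W)
        hjk.le (by simp only [hlr]; omega) hx hy hp h1 h2
      H3 := fun x y p p' hx hy hp hp' h1 h2 h3 h4 =>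
        RLsub.H3 (r := fun W : Submodule F (Fin n → F) => Module.finrank F W)
        (by simp only [hur]; omega) c3 hij.le hx hy hp hp' h1 h2 h3 h4 } (by omega) (by omega) (by omega)

/-- Coboundary expansion of three types in a gap, cone from above. -/
lemma C_fl' {L U : Submodule F (Fin n → F)} (hL : ∀ b ∈ Om s, fl l b = L)
    (hU : ∀ b ∈ Om s, fl u b = U) (hgap : ∀ W ∈ s, Module.finrank F W ≤ l ∨ u ≤ Module.finrank F W)
    (hli : l ≤ i) (hij : i < j) (hjk : j < k) (hku : k ≤ u) (hun : u ≤ n)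
    (c1 : j + u ≤ 2 * k) (c2 : 2 * u + i ≤ 3 * k) (c3 : k + 2 * i ≤ 3 * j) :
    Cob Γ (Om s) fl {k, j, i} 63 := by
  rcases (Om s).eq_empty_or_nonempty with h0 | hne
  · rw [h0]; exact Cob_empty
  have hlr : Module.finrank F L = l := by
    obtain ⟨b, hb⟩ := hne; rw [← hL b hb]; exact finrank_Om hb (by omega)
  have hur : Module.finrank F U = u := by
    obtain ⟨b, hb⟩ := hne; rw [← hU b hb]; exact finrank_Om hb (by omega)
  let r' : (Submodule F (Fin n → F))ᵒᵈ → ℕ := fun x =>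
    n - Module.finrank F (OrderDual.ofDual x : Submodule F (Fin n → F))
  have hRL : RL r' := RLsub.dual finrank_le_n
  let P : ℕ → (Submodule F (Fin n → F))ᵒᵈ → Prop := fun t W =>
    r' W = n - t ∧ OrderDual.toDual U ≤ W ∧ W ≤ OrderDual.toDual L
  have hP : ∀ t ≤ n, ∀ W, P t W → Module.finrank F (OrderDual.ofDual W : Submodule F (Fin n → F)) = t ∧
      L ≤ OrderDual.ofDual W ∧ OrderDual.ofDual W ≤ U := by
    intro t ht W hW
    have h1 : n - Module.finrank F (OrderDual.ofDual W : Submodule F (Fin n → F)) = n - t := hW.1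
    have h2 := finrank_le_n (OrderDual.ofDual W)
    exact ⟨by omega, hW.2.2, hW.2.1⟩
  have hmem : ∀ t, l ≤ t → t ≤ u → ∀ b ∈ Om s, P t (OrderDual.toDual (fl t b)) := by
    intro t h1 h2 b hb
    refine ⟨?_, ?_, ?_⟩
    · show n - Module.finrank F (fl t b) = n - t
      rw [finrank_Om hb (by omega)]
    · show fl t b ≤ U
      rw [← hU b hb]; exact fl_mono h2 b
    · show L ≤ fl t b
      rw [← hL b hb]; exact fl_mono h1 b
  have hUr : r' (OrderDual.toDual U) = n - u := by show n - Module.finrank F U = n - u; rw [hur]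
  have hLr : r' (OrderDual.toDual L) = n - l := by show n - Module.finrank F L = n - l; rw [hlr]
  exact C_apply (Γ := Γ) (s := s)
    { le := fun x y => y ≤ x, A := P k, B := P j, C := P i
      trans := fun _ _ _ h1 h2 => le_trans h2 h1
      hA := hmem k (by omega) (by omega)
      hB := hmem j (by omega) (by omega)
      hC := hmem i (by omega) (by omega)
      hAB := fun b _ => fl_mono hjk.le b
      hBC := fun b _ => fl_mono hij.le b
      hT := fun z y x hz hy hx h1 h2 => by
        obtain ⟨b, hb, b1, b2, b3⟩ := exists_three hne hL hU hgap (hP i (by omega) x hx)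
          (hP j (by omega) y hy) (hP k (by omega) z hz) h2 h1
        exact ⟨b, hb, b3, b2, b1⟩
      H1 := fun x y z hx hy hz => hRL.H1 (by rw [hLr]; omega) (by rw [hUr]; omega) hx hy hz
      H2 := fun x y p hx hy hp h1 h2 => hRL.H2 (by omega) (by rw [hUr]; omega) hx hy hp h1 h2
      H3 := fun x y p p' hx hy hp hp' h1 h2 h3 h4 =>
        hRL.H3 (by rw [hLr]; omega) (by omega) (by omega) hx hy hp hp' h1 h2 h3 h4 }
    (by omega) (by omega) (by omega)

end flags
end CB

namespace CB

section van
variable {α : Type} [Lattice α] {r : α → ℕ} {Γ : Type} [Group Γ]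

/-- Closed and exact cochains above `L` with ranks in `τ`. -/
def Clo (r : α → ℕ) (L : α) (τ : Finset ℕ) (f : α → α → Γ) : Prop :=
  ∀ u v w, L ≤ u → u ≤ v → v ≤ w → r u ∈ τ → r v ∈ τ → r w ∈ τ → r u < r v → r v < r w →
    f u v * f v w = f u w

lemma van_direct (R : RL r) {T L : α} (hT : ∀ x, x ≤ T) {τ : Finset ℕ} {t1 t2 t3 : ℕ}
    (h1 : t1 = r L + 1) (h12 : t1 < t2) (h23 : t2 < t3) (m1 : t1 ∈ τ) (m2 : t2 ∈ τ) (m3 : t3 ∈ τ)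
    (hmin : ∀ t ∈ τ, t ≠ t1 → t2 ≤ t) (hmax : ∀ t ∈ τ, t ≤ r T) {f : α → α → Γ} (hf : Clo r L τ f) :
    ∃ g : α → Γ, ∀ u v, L ≤ u → u ≤ v → r u ∈ τ → r v ∈ τ → r u < r v → f u v = g u * (g v)⁻¹ := by
  have hLT := hT L
  have hA : ∀ x x' u u', L ≤ x → L ≤ x' → r x = t1 → r x' = t1 → x ≤ u → x' ≤ u → x ≤ u' → x' ≤ u' →
      r u ∈ τ → r u' ∈ τ → r u ≠ t1 → r u' ≠ t1 → f x u * (f x' u)⁻¹ = f x u' * (f x' u')⁻¹ := by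
    intro x x' u u' hx hx' rx rx' a1 a2 a3 a4 b1 b2 b3 b4
    have hm := R.mod x x'
    have hm2 := R.mono L (x ⊓ x') (le_inf hx hx')
    have key : ∀ w, x ≤ w → x' ≤ w → r w ∈ τ → r w ≠ t1 → ∃ v, x ≤ v ∧ x' ≤ v ∧ r v = t2 ∧
        f x w * (f x' w)⁻¹ = f x v * (f x' v)⁻¹ := by
      intro w c1 c2 c3 c4
      have := hmin _ c3 c4
      by_cases hw : r w = t2
      · exact ⟨w, c1, c2, hw, rfl⟩
      obtain ⟨v, v1, v2, v3⟩ := R.interp (x ⊔ x') w t2 (sup_le c1 c2) (by omega) this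
      have xv := le_sup_left.trans v1
      have xv' := le_sup_right.trans v1
      refine ⟨v, xv, xv', v3, ?_⟩
      rw [← hf x v w hx xv v2 (by rw [rx]; exact m1) (by rw [v3]; exact m2) c3 (by omega) (by omega),
        ← hf x' v w hx' xv' v2 (by rw [rx']; exact m1) (by rw [v3]; exact m2) c3 (by omega) (by omega)]
      group
    obtain ⟨v, v1, v2, v3, v4⟩ := key u a1 a2 b1 b3
    obtain ⟨v', v1', v2', v3', v4'⟩ := key u' a3 a4 b2 b4
    rw [v4, v4']
    refine R.conn (z := x ⊔ x') hT h23 (hmax _ m3) (fun u => f x u * (f x' u)⁻¹) ?_ v v' v3 v3'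
      (sup_le v1 v2) (sup_le v1' v2')
    have gen : ∀ u w, r u = t2 → r w = t3 → x ⊔ x' ≤ u → u ≤ w →
        f x u * (f x' u)⁻¹ = f x w * (f x' w)⁻¹ := by
      intro u w e1 e2 e3 e4
      rw [← hf x u w hx (le_sup_left.trans e3) e4 (by rw [rx]; exact m1) (by rw [e1]; exact m2)
          (by rw [e2]; exact m3) (by omega) (by omega),
        ← hf x' u w hx' (le_sup_right.trans e3) e4 (by rw [rx']; exact m1) (by rw [e1]; exact m2)
          (by rw [e2]; exact m3) (by omega) (by omega)]
      group
    intro u u' w e1 e2 e3 e4 e5 e6 e7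
    show f x u * (f x' u)⁻¹ = f x u' * (f x' u')⁻¹
    rw [gen u w e1 e3 e4 e6, gen u' w e2 e3 e5 e7]
  have h1T := hmax _ m1
  obtain ⟨p, p1, _, p3⟩ := R.interp L T t1 hLT (by omega) h1T
  have hw3 : ∀ x y z, L ≤ x → L ≤ y → L ≤ z → r x = t1 → r y = t1 → r z = t1 →
      ∃ w, x ≤ w ∧ y ≤ w ∧ z ≤ w ∧ r w = t3 := by
    intro x y z a1 a2 a3 b1 b2 b3
    have e1 := R.mod x y
    have e2 := R.mod (x ⊔ y) z
    have e3 := R.mono L (x ⊓ y) (le_inf a1 a2)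
    have e4 := R.mono L ((x ⊔ y) ⊓ z) (le_inf (a1.trans le_sup_left) a3)
    obtain ⟨w, w1, _, w3⟩ := R.interp (x ⊔ y ⊔ z) T t3 (hT _) (by omega) (hmax _ m3)
    exact ⟨w, le_sup_left.trans (le_sup_left.trans w1), le_sup_right.trans (le_sup_left.trans w1),
      le_sup_right.trans w1, w3⟩
  have hU : ∀ x, ∃ w, L ≤ x → r x = t1 → x ≤ w ∧ p ≤ w ∧ r w = t3 := by
    intro x
    by_cases h : L ≤ x ∧ r x = t1
    · obtain ⟨w, w1, w2, _, w3⟩ := hw3 x p p h.1 p1 p1 h.2 p3 p3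
      exact ⟨w, fun _ _ => ⟨w1, w2, w3⟩⟩
    · exact ⟨x, fun a b => absurd ⟨a, b⟩ h⟩
  choose W hW using hU
  have hX : ∀ u, ∃ x, L ≤ u → r u ∈ τ → r u ≠ t1 → L ≤ x ∧ x ≤ u ∧ r x = t1 := by
    intro u
    by_cases h : L ≤ u ∧ r u ∈ τ ∧ r u ≠ t1
    · have := hmin _ h.2.1 h.2.2
      obtain ⟨x, x1, x2, x3⟩ := R.interp L u t1 h.1 (by omega) (by omega)
      exact ⟨x, fun _ _ _ => ⟨x1, x2, x3⟩⟩
    · exact ⟨u, fun a b c => absurd ⟨a, b, c⟩ h⟩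
  choose X hX using hX
  set G : α → Γ := fun x => f x (W x) * (f p (W x))⁻¹ with hG
  have hGw : ∀ x w, L ≤ x → r x = t1 → x ≤ w → p ≤ w → r w = t3 → G x = f x w * (f p w)⁻¹ := by
    intro x w a1 a2 a3 a4 a5
    obtain ⟨w1, w2, w3⟩ := hW x a1 a2
    exact hA x p (W x) w a1 p1 a2 p3 w1 w2 a3 a4 (by rw [w3]; exact m3) (by rw [a5]; exact m3)
      (by omega) (by omega)
  have hGG : ∀ x x' u, L ≤ x → L ≤ x' → r x = t1 → r x' = t1 → x ≤ u → x' ≤ u → r u ∈ τ → r u ≠ t1 →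
      f x u * (f x' u)⁻¹ = G x * (G x')⁻¹ := by
    intro x x' u a1 a2 a3 a4 a5 a6 a7 a8
    obtain ⟨w, w1, w2, w3, w4⟩ := hw3 x x' p a1 a2 p1 a3 a4 p3
    rw [hGw x w a1 a3 w1 w3 w4, hGw x' w a2 a4 w2 w3 w4,
      hA x x' u w a1 a2 a3 a4 a5 a6 w1 w2 a7 (by rw [w4]; exact m3) a8 (by omega)]
    group
  set g : α → Γ := fun u => if r u = t1 then G u else (f (X u) u)⁻¹ * G (X u) with hg
  have step : ∀ x u, L ≤ x → r x = t1 → x ≤ u → r u ∈ τ → r u ≠ t1 → f x u = g x * (g u)⁻¹ := by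
    intro x u a1 a2 a3 a4 a5
    obtain ⟨x1, x2, x3⟩ := hX u (a1.trans a3) a4 a5
    have h := hGG x (X u) u a1 x1 a2 x3 a3 x2 a4 a5
    simp only [hg, a2, a5, if_true, if_false]
    rw [mul_inv_rev, inv_inv, ← mul_assoc, ← h]
    group
  refine ⟨g, fun u v hu huv ru rv hlt => ?_⟩
  have hv1 : r v ≠ t1 := by
    intro h
    have e := R.mono L u hu
    have : r u ≠ t1 := by omega
    have := hmin _ ru this
    omega
  by_cases hu1 : r u = t1
  · exact step u v hu hu1 huv rv hv1
  · obtain ⟨x1, x2, x3⟩ := hX u hu ru hu1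
    have := hmin _ ru hu1
    have e1 := step (X u) u x1 x3 x2 ru hu1
    have e2 := step (X u) v x1 x3 (x2.trans huv) rv hv1
    have e3 := hf (X u) u v x1 x2 huv (by rw [x3]; exact m1) ru rv (by omega) hlt
    rw [e1, e2] at e3
    have : f u v = (g (X u) * (g u)⁻¹)⁻¹ * (g (X u) * (g v)⁻¹) := by rw [← e3]; group
    rw [this]; group

lemma van (R : RL r) {T : α} (hT : ∀ x, x ≤ T) (m : ℕ) : ∀ (L : α) (τ : Finset ℕ) (f : α → α → Γ),
    r T - r L ≤ m → (∀ t ∈ τ, r L < t ∧ t ≤ r T) → 3 ≤ τ.card → Clo r L τ f →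
    ∃ g : α → Γ, ∀ u v, L ≤ u → u ≤ v → r u ∈ τ → r v ∈ τ → r u < r v → f u v = g u * (g v)⁻¹ := by
  have direct : ∀ (L : α) (τ : Finset ℕ) (f : α → α → Γ),
      (∀ t ∈ τ, r L < t ∧ t ≤ r T) → 3 ≤ τ.card → r L + 1 ∈ τ → Clo r L τ f →
      ∃ g : α → Γ, ∀ u v, L ≤ u → u ≤ v → r u ∈ τ → r v ∈ τ → r u < r v → f u v = g u * (g v)⁻¹ := by
    intro L τ f ht hc h1 hf
    have c1 : (τ.erase (r L + 1)).card = τ.card - 1 := Finset.card_erase_of_mem h1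
    have n1 : (τ.erase (r L + 1)).Nonempty := Finset.card_pos.1 (by omega)
    obtain ⟨t2, m2, hm2⟩ := Finset.exists_minimal n1
    have c2 := Finset.card_erase_of_mem m2
    obtain ⟨t3, m3⟩ : ((τ.erase (r L + 1)).erase t2).Nonempty := Finset.card_pos.1 (by omega)
    have q2 := Finset.mem_erase.1 m2
    have q3 := Finset.mem_erase.1 m3
    have q3' := Finset.mem_erase.1 q3.2
    have hmin : ∀ t ∈ τ, t ≠ r L + 1 → t2 ≤ t := by
      intro t h h'
      rcases le_total t2 t with h0 | h0
      · exact h0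
      · exact hm2 (Finset.mem_erase.2 ⟨h', h⟩) h0
    have k2 := ht _ q2.2
    have k3 := hmin _ q3'.2 q3'.1
    exact van_direct R hT (t2 := t2) (t3 := t3) rfl (by omega) (by omega) h1 q2.2 q3'.2 hmin
      (fun t h => (ht t h).2) hf
  induction m with
  | zero =>
    intro L τ f h0 ht hc _
    obtain ⟨t, h⟩ : τ.Nonempty := Finset.card_pos.1 (by omega)
    have := ht t h
    omega
  | succ m ih =>
    intro L τ f h0 ht hc hf
    by_cases h1 : r L + 1 ∈ τ
    · exact direct L τ f ht hc h1 hf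
    have hgy : ∀ y, ∃ g : α → Γ, L ≤ y → r y = r L + 1 →
        ∀ u v, y ≤ u → u ≤ v → r u ∈ τ → r v ∈ τ → r u < r v → f u v = g u * (g v)⁻¹ := by
      intro y
      by_cases hy : L ≤ y ∧ r y = r L + 1
      · obtain ⟨g, hg⟩ := ih y τ f (by omega) (fun t h => by
          have := ht t h
          have : t ≠ r L + 1 := fun e => h1 (e ▸ h)
          omega) hc (fun u v w a => hf u v w (hy.1.trans a))
        exact ⟨g, fun _ _ => hg⟩
      · exact ⟨fun _ => 1, fun a b => absurd ⟨a, b⟩ hy⟩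
    choose gy hgy using hgy
    set f' : α → α → Γ := fun u v => if r u = r L + 1 then (gy u v)⁻¹ else f u v with hf'
    have hne : ∀ t ∈ τ, t ≠ r L + 1 := fun t h e => h1 (e ▸ h)
    obtain ⟨t0, ht0⟩ : τ.Nonempty := Finset.card_pos.1 (by omega)
    have hT0 := ht _ ht0
    obtain ⟨g, hg⟩ := direct L (insert (r L + 1) τ) f' (by
        intro t h
        rcases Finset.mem_insert.1 h with rfl | h
        · omega
        · exact ht t h) (by rw [Finset.card_insert_of_notMem h1]; omega) (Finset.mem_insert_self _ _) (by
        intro u v w a1 a2 a3 b1 b2 b3 c1 c2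
        have d2 : r v ∈ τ := by
          rcases Finset.mem_insert.1 b2 with h | h
          · exfalso
            rcases Finset.mem_insert.1 b1 with h' | h'
            · omega
            · have := ht _ h'; omega
          · exact h
        have d3 : r w ∈ τ := by
          rcases Finset.mem_insert.1 b3 with h | h
          · exfalso
            have := ht _ d2; omega
          · exact h
        have k2 := hne _ d2
        rcases Finset.mem_insert.1 b1 with h | h
        · simp only [hf', h, k2, if_true, if_false]
          rw [hgy u a1 h v w a2 a3 d2 d3 c2]
          group
        · have k1 := hne _ h
          simp only [hf', k1, k2, if_false]
          exact hf u v w a1 a2 a3 h d2 d3 c1 c2)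
    refine ⟨g, fun u v a1 a2 b1 b2 c => ?_⟩
    have := hg u v a1 a2 (Finset.mem_insert_of_mem b1) (Finset.mem_insert_of_mem b2) c
    simpa only [hf', hne _ b1, if_false] using this
end van

section flags
variable {F : Type} [Field F] [Fintype F] {n : ℕ} {Γ : Type} [Group Γ]
variable {s : Finset (Submodule F (Fin n → F))} {b b' : Fin n → Fin n → F} {t i j k l u w : ℕ}

/-- Vanishing of the first cohomology, in the form needed for `M_lemma`. -/
lemma van_fl {J : Finset ℕ} (hJ : 3 ≤ J.card) (hJn : ∀ t ∈ J, 0 < t ∧ t ≤ n)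
    (f : ℕ → ℕ → Submodule F (Fin n → F) → Submodule F (Fin n → F) → Γ) (hf : AS f)
    (h0 : ∀ b ∈ Om (∅ : Finset (Submodule F (Fin n → F))), ¬ badT fl f J b) :
    ∃ g, ∀ b ∈ Om (∅ : Finset (Submodule F (Fin n → F))), ¬ badE fl f g J b := by
  have hne : (Om (∅ : Finset (Submodule F (Fin n → F)))).Nonempty := Om_nonempty (by simp)
  have hbot : Module.finrank F (⊥ : Submodule F (Fin n → F)) = 0 := finrank_bot F _
  have htop : Module.finrank F (⊤ : Submodule F (Fin n → F)) = n := by simp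
  obtain ⟨g, hg⟩ := van (Γ := Γ) (RLsub (F := F) (n := n)) (T := ⊤) (fun _ => le_top) n ⊥ J
    (fun u v => f (Module.finrank F u) (Module.finrank F v) u v)
    (by simp only [htop]; omega) (by simpa only [htop, hbot] using hJn) hJ (by
      intro u v w _ a2 a3 b1 b2 b3 c1 c2
      simp only at b1 b2 b3 c1 c2 ⊢
      obtain ⟨b, hb, e1, e2, e3⟩ := exists_three (s := ∅) (l := 0) (u := n) (L := ⊥) (U := ⊤) hne
        (fun b _ => fl_zero b) (fun b hb => (mem_Om.1 hb).1) (by simp)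
        (x := u) (y := v) (z := w) ⟨rfl, bot_le, le_top⟩ ⟨rfl, bot_le, le_top⟩ ⟨rfl, bot_le, le_top⟩ a2 a3
      by_contra hcon
      apply h0 b hb
      refine ⟨_, b1, _, b2, _, b3, by omega, by omega, by omega, fun h => hcon ?_⟩
      unfold tri at h
      rw [e1, e2, e3, hf _ _ w u (by omega)] at h
      exact mul_inv_eq_one.1 h)
  refine ⟨fun _ => g, ?_⟩
  rintro b hb ⟨i, hi, j, hj, hij, h⟩
  apply h
  have ri := finrank_Om hb (hJn i hi).2
  have rj := finrank_Om hb (hJn j hj).2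
  unfold edg
  rcases lt_or_gt_of_ne hij with hlt | hlt
  · have := hg (fl i b) (fl j b) bot_le (fl_mono hlt.le b) (by simpa only [ri] using hi)
      (by simpa only [rj] using hj) (by simpa only [ri, rj] using hlt)
    simpa only [ri, rj] using this
  · have := hg (fl j b) (fl i b) bot_le (fl_mono hlt.le b) (by simpa only [rj] using hj)
      (by simpa only [ri] using hi) (by simpa only [ri, rj] using hlt)
    simp only [ri, rj] at this
    rw [hf i j _ _ hij, this]; group

/-- Conditioning on an independent variable does nothing. -/
lemma ex_cnd_of_indep {X V : Type} {Ω : Finset X} {z : X → V} {φ : X → ℝ} {ω0 : X} (h0 : ω0 ∈ Ω)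
    (h : ex Ω (fun ω => ind (z ω = z ω0) * φ ω) = ex Ω (fun ω => ind (z ω = z ω0)) * ex Ω φ) :
    ex (cnd Ω z (z ω0)) φ = ex Ω φ := by
  have hbc : ω0 ∈ cnd Ω z (z ω0) := self_mem_cnd h0
  have hc1 : (Ω.card : ℝ) ≠ 0 := by exact_mod_cast (Finset.card_pos.2 ⟨ω0, h0⟩).ne'
  have hc2 : ((cnd Ω z (z ω0)).card : ℝ) ≠ 0 := by
    exact_mod_cast (Finset.card_pos.2 ⟨ω0, hbc⟩).ne'
  unfold ex at h ⊢
  have e1 : ∑ a ∈ Ω, ind (z a = z ω0) * φ a = ∑ a ∈ cnd Ω z (z ω0), φ a := by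
    unfold cnd; rw [Finset.sum_filter]
    refine Finset.sum_congr rfl fun a _ => ?_
    unfold ind; split_ifs <;> simp
  have e2 : ∑ a ∈ Ω, ind (z a = z ω0) = ((cnd Ω z (z ω0)).card : ℝ) := by
    unfold cnd ind; rw [Finset.sum_ite]; simp
  rw [e1, e2] at h
  field_simp at h ⊢
  linarith

lemma PE_empty {X V W : Type} {y : X → V} {z : X → W} {l : ℝ} (hl : 0 ≤ l) : PE (∅ : Finset X) y z l :=
  PE_of_indep hl fun _ _ => by simp [cov, ex_empty]

lemma J_fl {l : ℝ} (hl : 0 < l) (hl2 : l ≤ 1 / 2) (hq : 2 ≤ l ^ 2 * Fintype.card F)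
    (hwn : w ≤ n) (hc : ∀ b ∈ Om s, ∀ b' ∈ Om s, fl w b = fl w b')
    (hi : i ≤ n) (hj : j ≤ n) (hk : k ≤ n) (hij : i ≠ j) (hjk : j ≠ k) (hik : i ≠ k)
    (hsep : (k ≤ w ∧ w ≤ i ∧ w ≤ j) ∨ (w ≤ k ∧ i ≤ w ∧ j ≤ w)) :
    Cob Γ (Om s) fl {i, j, k} 11 := by
  apply J_lemma hij hjk hik
  · intro b hb φ
    apply ex_cnd_of_indep hb
    rcases hsep with ⟨h1, h2, h3⟩ | ⟨h1, h2, h3⟩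
    · exact indep_fl hwn hc (a := fl k) (c := fun b => (fl i b, fl j b)) (fun v => ind (v = fl k b))
        (fun v => φ v.1 v.2) (fun b b' _ => fl_spl_low h1)
        (fun b b' hh => by simp only [fl_spl_high h2 hh, fl_spl_high h3 hh])
    · have := indep_fl hwn hc (c := fl k) (a := fun b => (fl i b, fl j b)) (fun v => φ v.1 v.2)
        (fun v => ind (v = fl k b)) 
        (fun b b' hh => by simp only [fl_spl_low h2, fl_spl_low h3])
        (fun b b' hh => fl_spl_high h1 hh)
      simp only [mul_comm] at this ⊢
      exact this
  · intro v
    rcases cnd_Om_cases (s := s) hk v with h | ⟨_, h⟩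
    · rw [h]
      exact PE_empty (by norm_num)
    · rw [h]
      exact (PE_fl hl (by nlinarith) hq hi hj hij).mono (by linarith)
end flags
end CB

namespace CB
section sel
variable {F : Type} [Field F] [Fintype F] {n : ℕ} {Γ : Type} [Group Γ]
variable {s : Finset (Submodule F (Fin n → F))} {l : ℝ}

lemma PE_cnd (hl : 0 < l) (hl2 : l ≤ 1 / 2) (hq : 2 ≤ l ^ 2 * Fintype.card F) {i j k : ℕ}
    (hi : i ≤ n) (hj : j ≤ n) (hk : k ≤ n) (hij : i ≠ j) (v : Submodule F (Fin n → F)) :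
    PE (cnd (Om s) (fl k) v) (fl i) (fl j) l := by
  rcases cnd_Om_cases (s := s) hk v with h | ⟨_, h⟩
  · rw [h]; exact PE_empty hl.le
  · rw [h]; exact PE_fl hl (by nlinarith) hq hi hj hij

lemma PE_cnd2 (hl : 0 < l) (hl2 : l ≤ 1 / 2) (hq : 2 ≤ l ^ 2 * Fintype.card F) {i j k k' : ℕ}
    (hi : i ≤ n) (hj : j ≤ n) (hk : k ≤ n) (hk' : k' ≤ n) (hij : i ≠ j) (v v' : Submodule F (Fin n → F)) :
    PE (cnd (cnd (Om s) (fl k) v) (fl k') v') (fl i) (fl j) l := by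
  rcases cnd_Om_cases (s := s) hk v with h | ⟨_, h⟩
  · have : cnd (∅ : Finset (Fin n → Fin n → F)) (fl k') v' = ∅ := by simp [cnd]
    rw [h, this]; exact PE_empty hl.le
  · rw [h]; exact PE_cnd hl hl2 hq hi hj hk' hij v'

lemma quad_fl (hl : 0 < l) (hl2 : l ≤ 1 / (20000 * 63)) (hq : 2 ≤ l ^ 2 * Fintype.card F)
    {t1 t2 t3 t4 : ℕ} (h0 : 0 < t1) (h12 : t1 < t2) (h23 : t2 < t3) (h34 : t3 < t4) (h4 : t4 ≤ n)
    (c1 : 2 * t2 ≤ t3 + t1) (c2 : 3 * t2 ≤ t4 + 2 * t1) (c3 : 3 * t3 ≤ 2 * t4 + t2)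
    (c4 : t2 + t4 ≤ 2 * t3) (c5 : 2 * t4 + t1 ≤ 3 * t3) (c6 : t3 + 2 * t1 ≤ 3 * t2) :
    Cob Γ (Om (∅ : Finset (Submodule F (Fin n → F)))) fl {t1, t2, t3, t4} 50400 := by
  have hl' : l ≤ 1 / 2 := hl2.trans (by norm_num)
  have hmem : ∀ t ∈ ({t1, t2, t3, t4} : Finset ℕ), t = t1 ∨ t = t2 ∨ t = t3 ∨ t = t4 := by
    intro t ht; simpa using ht
  have hn : ∀ t ∈ ({t1, t2, t3, t4} : Finset ℕ), 0 < t ∧ t ≤ n := by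
    intro t ht; rcases hmem t ht with h | h | h | h <;> omega
  have hcard : ({t1, t2, t3, t4} : Finset ℕ).card = 4 := by
    rw [Finset.card_insert_of_notMem, Finset.card_insert_of_notMem, Finset.card_insert_of_notMem,
      Finset.card_singleton] <;> simp <;> omega
  have e800 : (50400 : ℝ) = 800 * 63 := by norm_num
  rw [e800]
  refine M_lemma (by norm_num) hl hl2 hcard ⟨?_, ?_, ?_⟩ ?_ ?_
  · intro i hi j hj hij
    exact PE_fl hl (by nlinarith) hq (hn i hi).2 (hn j hj).2 hij
  · intro i hi j hj hij k hk a _ _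
    exact PE_cnd hl hl' hq (hn i hi).2 (hn j hj).2 (hn k hk).2 hij a
  · intro i hi j hj hij k hk k' hk' a a' _ _ _ _ _
    exact PE_cnd2 hl hl' hq (hn i hi).2 (hn j hj).2 (hn k hk).2 (hn k' hk').2 hij a a'
  · intro i hi v
    rcases cnd_Om_cases (s := ∅) (hn i hi).2 v with h | ⟨hv, h⟩
    · rw [h]; exact Cob_empty
    rw [h]
    have hvc : ∀ b ∈ Om (insert v (∅ : Finset (Submodule F (Fin n → F)))), fl i b = v := by
      intro b hb
      rw [← hv]; exact (mem_Om.1 hb).2 v (by simp)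
    have hcc : ∀ b ∈ Om (insert v (∅ : Finset (Submodule F (Fin n → F)))),
        ∀ b' ∈ Om (insert v (∅ : Finset (Submodule F (Fin n → F)))), fl i b = fl i b' := by
      intro b hb b' hb'; rw [hvc b hb, hvc b' hb']
    rcases hmem i hi with rfl | rfl | rfl | rfl
    · have := C_fl (Γ := Γ) (l := i) (u := n) (L := v) (U := ⊤) (i := t2) (j := t3) (k := t4) hvc
        (fun b hb => (mem_Om.1 hb).1) (by simp [hv]) (by omega) (by omega) (by omega) (by omega) le_rfl
        (by omega) (by omega) (by omega)
      convert this using 1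
      ext t; simp only [Finset.mem_erase, Finset.mem_insert, Finset.mem_singleton]; omega
    · have := (J_fl (Γ := Γ) (w := i) (i := t3) (j := t4) (k := t1) hl hl' hq (by omega) hcc (by omega)
        (by omega) (by omega) (by omega) (by omega) (by omega) (Or.inl ⟨by omega, by omega, by omega⟩)).mono
        (show (11 : ℝ) ≤ 63 by norm_num)
      convert this using 1
      ext t; simp only [Finset.mem_erase, Finset.mem_insert, Finset.mem_singleton]; omega
    · have := (J_fl (Γ := Γ) (w := i) (i := t1) (j := t2) (k := t4) hl hl' hq (by omega) hcc (by omega)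
        (by omega) (by omega) (by omega) (by omega) (by omega) (Or.inr ⟨by omega, by omega, by omega⟩)).mono
        (show (11 : ℝ) ≤ 63 by norm_num)
      convert this using 1
      ext t; simp only [Finset.mem_erase, Finset.mem_insert, Finset.mem_singleton]; omega
    · have := C_fl' (Γ := Γ) (l := 0) (u := i) (L := ⊥) (U := v) (i := t1) (j := t2) (k := t3)
        (fun b _ => fl_zero b) hvc (by simp [hv]) (by omega) (by omega) (by omega) (by omega) (by omega)
        (by omega) (by omega) (by omega)
      convert this using 1
      ext t; simp only [Finset.mem_erase, Finset.mem_insert, Finset.mem_singleton]; omega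
  · intro f hf h
    exact van_fl (by omega) hn f hf h

/-- Combinatorial selection of types. -/
def Good (Γ : Type) [Group Γ] (s : Finset (Submodule F (Fin n → F))) (R : Finset ℕ) : Prop :=
  ∃ I1 I2 I3 I4 : Finset ℕ, I1 ⊆ R ∧ I2 ⊆ R ∧ I3 ⊆ R ∧ I4 ⊆ R ∧
    R.card ≤ 48 * I1.card ∧ R.card ≤ 48 * I2.card ∧ R.card ≤ 48 * I3.card ∧ R.card ≤ 48 * I4.card ∧
    ∀ t1 ∈ I1, ∀ t2 ∈ I2, ∀ t3 ∈ I3, ∀ t4 ∈ I4, t1 ≠ t2 ∧ ∃ τ : Finset ℕ, t1 ∈ τ ∧ t2 ∈ τ ∧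
      τ ⊆ {t1, t2, t3, t4} ∧ Cob Γ (Om s) fl τ 50400

lemma good_empty (hl : 0 < l) (hl2 : l ≤ 1 / (20000 * 63)) (hq : 2 ≤ l ^ 2 * Fintype.card F)
    {a c : ℕ} (ha : 0 < a) (hc : c ≤ n) (hac : a + 4 ≤ c) :
    Good Γ (∅ : Finset (Submodule F (Fin n → F))) (Finset.Icc a c) := by
  obtain ⟨e, he⟩ : ∃ e, e = (c - a) / 4 := ⟨_, rfl⟩
  obtain ⟨δ, hδ⟩ : ∃ δ, δ = e / 9 := ⟨_, rfl⟩
  refine ⟨Finset.Icc a (a + δ), Finset.Icc (a + e) (a + e + δ),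
    Finset.Icc (a + 2 * e + 6 * δ) (a + 2 * e + 7 * δ), Finset.Icc (a + 3 * e + 6 * δ) (a + 3 * e + 7 * δ),
    Finset.Icc_subset_Icc (by omega) (by omega), Finset.Icc_subset_Icc (by omega) (by omega),
    Finset.Icc_subset_Icc (by omega) (by omega), Finset.Icc_subset_Icc (by omega) (by omega),
    by simp only [Nat.card_Icc]; omega, by simp only [Nat.card_Icc]; omega,
    by simp only [Nat.card_Icc]; omega, by simp only [Nat.card_Icc]; omega, ?_⟩
  intro t1 h1 t2 h2 t3 h3 t4 h4
  rw [Finset.mem_Icc] at h1 h2 h3 h4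
  refine ⟨by omega, {t1, t2, t3, t4}, by simp, by simp, subset_rfl, ?_⟩
  exact quad_fl hl hl2 hq (by omega) (by omega) (by omega) (by omega) (by omega) (by omega) (by omega)
    (by omega) (by omega) (by omega) (by omega)

/-- The balanced case: a separator with many types on both sides. -/
lemma good_J (hl : 0 < l) (hl2 : l ≤ 1 / 2) (hq : 2 ≤ l ^ 2 * Fintype.card F)
    {R P Q : Finset ℕ} {w : ℕ} (hRn : ∀ t ∈ R, t ≤ n) (hwn : w ≤ n)
    (hc : ∀ b ∈ Om s, ∀ b' ∈ Om s, fl w b = fl w b') (hP : P ⊆ R) (hQ : Q ⊆ R)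
    (hcP : R.card ≤ 2 * P.card) (hP2 : 2 ≤ P.card) (hcQ : R.card ≤ 10 * Q.card)
    (hsep : ((∀ t ∈ Q, t < w) ∧ ∀ t ∈ P, w < t) ∨ ((∀ t ∈ Q, w < t) ∧ ∀ t ∈ P, t < w)) :
    Good Γ s R := by
  obtain ⟨P1, h1, h2⟩ := Finset.exists_subset_card_eq (show P.card / 2 ≤ P.card by omega)
  have h3 : (P \ P1).card = P.card - P1.card := Finset.card_sdiff_of_subset h1
  refine ⟨Q, P1, P \ P1, Q, hQ, h1.trans hP, Finset.sdiff_subset.trans hP, hQ, by omega, by omega,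
    by omega, by omega, ?_⟩
  intro t1 m1 t2 m2 t3 m3 t4 m4
  have m3' := Finset.mem_sdiff.1 m3
  have h23 : t2 ≠ t3 := fun h => m3'.2 (h ▸ m2)
  have n1 := hRn _ (hQ m1)
  have n2 := hRn _ (hP (h1 m2))
  have n3 := hRn _ (hP m3'.1)
  have hs : (t1 < w ∧ w < t2 ∧ w < t3) ∨ (w < t1 ∧ t2 < w ∧ t3 < w) := by
    rcases hsep with ⟨a, b⟩ | ⟨a, b⟩
    · exact Or.inl ⟨a _ m1, b _ (h1 m2), b _ m3'.1⟩
    · exact Or.inr ⟨a _ m1, b _ (h1 m2), b _ m3'.1⟩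
  refine ⟨by omega, {t2, t3, t1}, by simp, by simp, ?_, ?_⟩
  · intro t; simp only [Finset.mem_insert, Finset.mem_singleton]; omega
  · exact (J_fl hl hl2 hq hwn hc n2 n3 n1 h23 (by omega) (by omega) (by omega)).mono (by norm_num)

/-- A large gap next to an element of `s` below. -/
lemma good_gap {R : Finset ℕ} {l u l' u' : ℕ} {L U : Submodule F (Fin n → F)}
    (hL : ∀ b ∈ Om s, fl l' b = L) (hU : ∀ b ∈ Om s, fl u' b = U)
    (hgap : ∀ W ∈ s, Module.finrank F W ≤ l' ∨ u' ≤ Module.finrank F W)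
    (hll : l' ≤ l) (huu : u ≤ u') (hun : u' ≤ n) (hR : ∀ t, l < t → t < u → t ∈ R)
    (h3 : l + 4 ≤ u) (hm : R.card ≤ 2 * (u - l - 1)) (hor : l' = l ∨ u' = u) : Good Γ s R := by
  obtain ⟨e, he⟩ : ∃ e, e = (u - l) / 4 := ⟨_, rfl⟩
  obtain ⟨δ, hδ⟩ : ∃ δ, δ = e / 6 := ⟨_, rfl⟩
  rcases hor with rfl | rfl
  · refine ⟨Finset.Icc (l' + e) (l' + e + δ), Finset.Icc (l' + 2 * e + 2 * δ) (l' + 2 * e + 3 * δ),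
      Finset.Icc (l' + 3 * e + 4 * δ) (l' + 3 * e + 5 * δ), Finset.Icc (l' + e) (l' + e + δ),
      ?_, ?_, ?_, ?_, by simp only [Nat.card_Icc]; omega, by simp only [Nat.card_Icc]; omega,
      by simp only [Nat.card_Icc]; omega, by simp only [Nat.card_Icc]; omega, ?_⟩
    iterate 4
      · intro t ht; rw [Finset.mem_Icc] at ht; exact hR t (by omega) (by omega)
    intro t1 m1 t2 m2 t3 m3 t4 _
    rw [Finset.mem_Icc] at m1 m2 m3
    refine ⟨by omega, {t1, t2, t3}, by simp, by simp, ?_, ?_⟩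
    · intro t; simp only [Finset.mem_insert, Finset.mem_singleton]; omega
    · exact (C_fl hL hU hgap (by omega) (by omega) (by omega) (by omega) hun (by omega) (by omega)
        (by omega)).mono (by norm_num)
  · refine ⟨Finset.Icc (u' - e - δ) (u' - e), Finset.Icc (u' - 2 * e - 3 * δ) (u' - 2 * e - 2 * δ),
      Finset.Icc (u' - 3 * e - 5 * δ) (u' - 3 * e - 4 * δ), Finset.Icc (u' - e - δ) (u' - e),
      ?_, ?_, ?_, ?_, by simp only [Nat.card_Icc]; omega, by simp only [Nat.card_Icc]; omega,
      by simp only [Nat.card_Icc]; omega, by simp only [Nat.card_Icc]; omega, ?_⟩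
    iterate 4
      · intro t ht; rw [Finset.mem_Icc] at ht; exact hR t (by omega) (by omega)
    intro t1 m1 t2 m2 t3 m3 t4 _
    rw [Finset.mem_Icc] at m1 m2 m3
    refine ⟨by omega, {t1, t2, t3}, by simp, by simp, ?_, ?_⟩
    · intro t; simp only [Finset.mem_insert, Finset.mem_singleton]; omega
    · exact (C_fl' hL hU hgap (by omega) (by omega) (by omega) (by omega) hun (by omega) (by omega)
        (by omega)).mono (by norm_num)

lemma good_ne (hl : 0 < l) (hl2 : l ≤ 1 / 2) (hq : 2 ≤ l ^ 2 * Fintype.card F)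
    {a c : ℕ} (ha : 0 < a) (hcn : c < n) {D R : Finset ℕ} (hD : D = s.image fun W : Submodule F (Fin n → F) => Module.finrank F W)
    (hDs : D ⊆ Finset.Icc a c) (hDne : D.Nonempty) (hR : R = Finset.Icc a c \ D) (h3 : 3 ≤ R.card) :
    Good Γ s R := by
  have hRm : ∀ t, t ∈ R ↔ (a ≤ t ∧ t ≤ c) ∧ t ∉ D := by
    intro t; rw [hR, Finset.mem_sdiff, Finset.mem_Icc]
  have hDm : ∀ t ∈ D, a ≤ t ∧ t ≤ c := fun t ht => Finset.mem_Icc.1 (hDs ht)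
  have hDW : ∀ t ∈ D, ∃ W ∈ s, Module.finrank F W = t := by
    intro t ht; rw [hD, Finset.mem_image] at ht; exact ht
  set A : ℕ → ℕ := fun w => (R.filter (· < w)).card with hA
  set B : ℕ → ℕ := fun w => (R.filter (w < ·)).card with hB
  by_cases hbal : ∃ w ∈ D, R.card ≤ 10 * A w ∧ R.card ≤ 10 * B w
  · obtain ⟨w, hw, w1, w2⟩ := hbal
    have hsum : A w + B w = R.card := by
      rw [hA, hB]
      have : R.filter (w < ·) = R.filter (fun t => ¬ t < w) := by
        apply Finset.filter_congr
        intro t ht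
        have : t ≠ w := fun h => ((hRm t).1 ht).2 (h ▸ hw)
        omega
      simp only [this]
      exact Finset.card_filter_add_card_filter_not _
    obtain ⟨W, hW, hWw⟩ := hDW w hw
    have hwc := hDm w hw
    have hcon := const_of_mem hW hWw
    have hRn : ∀ t ∈ R, t ≤ n := fun t ht => by have := (hRm t).1 ht; omega
    have f1 : ∀ t ∈ R.filter (· < w), t < w := fun t ht => (Finset.mem_filter.1 ht).2
    have f2 : ∀ t ∈ R.filter (w < ·), w < t := fun t ht => (Finset.mem_filter.1 ht).2
    rcases le_total (A w) (B w) with hle | hle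
    · exact good_J hl hl2 hq hRn (by omega) hcon (Finset.filter_subset (w < ·) R)
        (Finset.filter_subset (· < w) R) (by change _ ≤ 2 * B w; omega) (by change _ ≤ B w; omega) w1
        (Or.inl ⟨f1, f2⟩)
    · exact good_J hl hl2 hq hRn (by omega) hcon (Finset.filter_subset (· < w) R)
        (Finset.filter_subset (w < ·) R) (by change _ ≤ 2 * A w; omega) (by change _ ≤ A w; omega) w2
        (Or.inr ⟨f2, f1⟩)
  · push Not at hbal
    set D' := insert (a - 1) (insert (c + 1) D) with hD'
    have hD'm : ∀ t ∈ D', t = a - 1 ∨ t = c + 1 ∨ t ∈ D := by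
      intro t ht; simpa [hD'] using ht
    have hA0 : A (a - 1) = 0 := by
      rw [hA]; simp only [Finset.card_eq_zero, Finset.filter_eq_empty_iff]
      intro t ht; have := (hRm t).1 ht; omega
    have hB0 : B (c + 1) = 0 := by
      rw [hB]; simp only [Finset.card_eq_zero, Finset.filter_eq_empty_iff]
      intro t ht; have := (hRm t).1 ht; omega
    set lo := D'.filter (fun w => 10 * A w < R.card) with hlo
    set hi := D'.filter (fun w => 10 * B w < R.card) with hhi
    have hlone : lo.Nonempty := ⟨a - 1, Finset.mem_filter.2 ⟨by simp [hD'], by rw [hA0]; omega⟩⟩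
    have hhine : hi.Nonempty := ⟨c + 1, Finset.mem_filter.2 ⟨by simp [hD'], by rw [hB0]; omega⟩⟩
    obtain ⟨x, hx, hxm⟩ : ∃ x ∈ lo, ∀ y ∈ lo, y ≤ x := ⟨lo.max' hlone, lo.max'_mem _, lo.le_max'⟩
    obtain ⟨u, hu, hum⟩ : ∃ x ∈ hi, ∀ y ∈ hi, x ≤ y := ⟨hi.min' hhine, hi.min'_mem _, hi.min'_le⟩
    have hx' := Finset.mem_filter.1 hx
    have hu' := Finset.mem_filter.1 hu
    have hdic : ∀ t ∈ D, t ≤ x ∨ u ≤ t := by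
      intro t ht
      by_cases h : 10 * A t < R.card
      · exact Or.inl (hxm t (Finset.mem_filter.2 ⟨by simp [hD', ht], h⟩))
      · exact Or.inr (hum t (Finset.mem_filter.2 ⟨by simp [hD', ht], hbal t ht (by omega)⟩))
    have hnot : ∀ t ∈ R, t ∉ D' := by
      intro t ht h
      have h1 := (hRm t).1 ht
      rcases hD'm t h with h | h | h
      · omega
      · omega
      · exact h1.2 h
    have hcount : R.card ≤ A x + B u + (u - x - 1) := by
      have hsub : R ⊆ (R.filter (· < x) ∪ R.filter (u < ·)) ∪ Finset.Ioo x u := by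
        intro t ht
        have hnt := hnot t ht
        have n1 : t ≠ x := fun h => hnt (h ▸ hx'.1)
        have n2 : t ≠ u := fun h => hnt (h ▸ hu'.1)
        simp only [Finset.mem_union, Finset.mem_filter, Finset.mem_Ioo, ht, true_and]
        omega
      have e1 := Finset.card_le_card hsub
      have e2 := Finset.card_union_le (R.filter (· < x) ∪ R.filter (u < ·)) (Finset.Ioo x u)
      have e3 := Finset.card_union_le (R.filter (· < x)) (R.filter (u < ·))
      rw [Nat.card_Ioo] at e2
      change _ ≤ (R.filter (· < x)).card + (R.filter (u < ·)).card + _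
      omega
    have hx2 := hx'.2
    have hu2 := hu'.2
    have hac : a ≤ c := by
      obtain ⟨t, ht⟩ := hDne
      have := hDm t ht; omega
    have hxb : x = a - 1 ∨ x ∈ D := by
      rcases hD'm x hx'.1 with h | h | h
      · exact Or.inl h
      · exfalso
        rcases hD'm u hu'.1 with h' | h' | h'
        · omega
        · omega
        · have := hDm u h'; omega
      · exact Or.inr h
    have hub : u = c + 1 ∨ u ∈ D := by
      rcases hD'm u hu'.1 with h | h | h
      · exfalso
        rcases hxb with h' | h'
        · omega
        · have := hDm x h'; omega
      · exact Or.inl h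
      · exact Or.inr h
    have hax : a ≤ x + 1 := by
      rcases hxb with h | h
      · omega
      · have := hDm x h; omega
    have huc : u ≤ c + 1 := by
      rcases hub with h | h
      · omega
      · have := hDm u h; omega
    have hRg : ∀ t, x < t → t < u → t ∈ R := by
      intro t h1 h2
      refine (hRm t).2 ⟨by omega, fun h => ?_⟩
      have := hdic t h
      omega
    have hconst : ∀ t ∈ D, ∃ W, ∀ b ∈ Om s, fl t b = W := by
      intro t ht
      obtain ⟨W, hW, hWw⟩ := hDW t ht
      exact ⟨W, fun b hb => by rw [← hWw]; exact (mem_Om.1 hb).2 W hW⟩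
    have hWD : ∀ W ∈ s, Module.finrank F W ∈ D := fun W hW => by
      rw [hD]; exact Finset.mem_image_of_mem _ hW
    have key : x ∈ D ∨ u ∈ D := by
      obtain ⟨t, ht⟩ := hDne
      have h1 := hDm t ht
      by_contra hcon
      push Not at hcon
      have := hdic t ht
      rcases hxb with h | h
      · rcases hub with h' | h'
        · omega
        · exact hcon.2 h'
      · exact hcon.1 h
    by_cases hxD : x ∈ D
    · obtain ⟨L, hL⟩ := hconst x hxD
      by_cases huD : u ∈ D
      · obtain ⟨U, hU⟩ := hconst u huD
        exact good_gap hL hU (fun W hW => hdic _ (hWD W hW)) le_rfl le_rfl (by omega) hRg (by omega)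
          (by omega) (Or.inl rfl)
      · exact good_gap (u' := n) (U := ⊤) hL (fun b hb => (mem_Om.1 hb).1)
          (fun W hW => Or.inl (by
            have h1 := hdic _ (hWD W hW)
            have h2 := hDm _ (hWD W hW)
            have : u = c + 1 := hub.resolve_right huD
            omega)) le_rfl (by omega) le_rfl hRg (by omega) (by omega) (Or.inl rfl)
    · have huD := key.resolve_left hxD
      obtain ⟨U, hU⟩ := hconst u huD
      exact good_gap (l' := 0) (L := ⊥) (fun b _ => fl_zero b) hU
          (fun W hW => Or.inr (by
            have h1 := hdic _ (hWD W hW)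
            have h2 := hDm _ (hWD W hW)
            have : x = a - 1 := hxb.resolve_right hxD
            omega)) (by omega) le_rfl (by omega) hRg (by omega) (by omega) (Or.inr rfl)

/-- The main estimate in terms of random flags. -/
lemma main_fl (hl : 0 < l) (hl2 : l ≤ 1 / (20000 * 63)) (hq : 2 ≤ l ^ 2 * Fintype.card F)
    {a c : ℕ} (ha : 0 < a) (hcn : c < n) (hac : a + 4 ≤ c)
    (hs : ∀ W ∈ s, Module.finrank F W ∈ Finset.Icc a c) {R : Finset ℕ}
    (hR : R = Finset.Icc a c \ s.image fun W : Submodule F (Fin n → F) => Module.finrank F W) (h3 : 3 ≤ R.card)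
    {f : ℕ → ℕ → Submodule F (Fin n → F) → Submodule F (Fin n → F) → Γ} (hf : AS f) :
    ∃ g : ℕ → Submodule F (Fin n → F) → Γ,
      ∑ r ∈ R, ∑ r' ∈ R, pr (Om s) (fun ω => r ≠ r' ∧ ¬ edg fl f g r r' ω) ≤
      51 * 50400 * 48 ^ 3 / R.card * ∑ i ∈ R, ∑ j ∈ R, ∑ k ∈ R, pr (Om s) (bad fl f i j k) := by
  have hl' : l ≤ 1 / 2 := hl2.trans (by norm_num)
  have hRn : ∀ t ∈ R, t ≤ n := by
    intro t ht; rw [hR, Finset.mem_sdiff, Finset.mem_Icc] at ht; omega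
  have hG : Good Γ s R := by
    rcases s.eq_empty_or_nonempty with rfl | hne
    · rw [hR]; simp only [Finset.image_empty, Finset.sdiff_empty]
      exact good_empty hl hl2 hq ha hcn.le hac
    · refine good_ne hl hl' hq ha hcn rfl ?_ (hne.image _) hR h3
      intro t ht
      obtain ⟨W, hW, rfl⟩ := Finset.mem_image.1 ht
      exact hs W hW
  obtain ⟨I1, I2, I3, I4, s1, s2, s3, s4, k1, k2, k3, k4, hC⟩ := hG
  exact assemble (K := 48) (B := 50400) (by norm_num) (by norm_num) (Finset.card_pos.1 (by omega)) s1 s2 s3 s4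
    (by exact_mod_cast k1) (by exact_mod_cast k2) (by exact_mod_cast k3) (by exact_mod_cast k4)
    (fun r hr a ha b hb hab _ _ w => (PE_cnd hl hl' hq (hRn a ha) (hRn b hb) (hRn r hr) hab w).mono hl')
    hC hf
end sel
end CB

namespace CB
section final
variable {F : Type} [Field F] [Fintype F] {n : ℕ} {Γ : Type} [Group Γ]
variable {s : Finset (Submodule F (Fin n → F))} {S : Finset ℕ} {b : Fin n → Fin n → F}

/-- The maximal face of a flag. -/
noncomputable def face (S : Finset ℕ) (b : Fin n → Fin n → F) : Finset (Submodule F (Fin n → F)) :=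
  S.image fun t => fl t b

lemma face_flag (hS : ∀ t ∈ S, t ≤ n) (hb : b ∈ Om s) : IsFlagFace F n S (face S b) := by
  constructor
  · intro W hW W' hW' _
    obtain ⟨t, _, rfl⟩ := Finset.mem_image.1 (Finset.mem_coe.1 hW)
    obtain ⟨t', _, rfl⟩ := Finset.mem_image.1 (Finset.mem_coe.1 hW')
    rcases le_total t t' with h | h
    · exact Or.inl (fl_mono h b)
    · exact Or.inr (fl_mono h b)
  · intro W hW
    obtain ⟨t, ht, rfl⟩ := Finset.mem_image.1 hW
    rw [finrank_Om hb (hS t ht)]; exact ht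

lemma subset_face (hs : ∀ W ∈ s, Module.finrank F W ∈ S) (hb : b ∈ Om s) : s ⊆ face S b := by
  intro W hW
  rw [← (mem_Om.1 hb).2 W hW]
  exact Finset.mem_image_of_mem (fun t => fl t b) (hs W hW)

lemma image_face (hS : ∀ t ∈ S, t ≤ n) (hs : ∀ W ∈ s, Module.finrank F W ∈ S) :
    (Om s).image (face S) = maxFacesAbove F n S s := by
  ext T
  unfold maxFacesAbove
  rw [Finset.mem_image, Finset.mem_filter]
  constructor
  · rintro ⟨b, hb, rfl⟩
    refine ⟨Finset.mem_univ _, ⟨face_flag hS hb, fun t ht => ?_⟩, subset_face hs hb⟩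
    exact ⟨fl t b, Finset.mem_image_of_mem (fun t => fl t b) ht, finrank_Om hb (hS t ht)⟩
  · rintro ⟨_, ⟨⟨hch, hdim⟩, hall⟩, hsub⟩
    obtain ⟨b, hb⟩ := Om_nonempty hch
    have hb' := mem_Om.1 hb
    refine ⟨b, mem_Om.2 ⟨hb'.1, fun W hW => hb'.2 W (hsub hW)⟩, ?_⟩
    apply Finset.Subset.antisymm
    · intro W hW
      obtain ⟨t, ht, rfl⟩ := Finset.mem_image.1 hW
      obtain ⟨W', hW', rfl⟩ := hall t ht
      show fl (Module.finrank F W') b ∈ T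
      rw [hb'.2 W' hW']; exact hW'
    · exact subset_face hdim hb

lemma avg_face (hS : ∀ t ∈ S, t ≤ n) (hs : ∀ W ∈ s, Module.finrank F W ∈ S)
    (hch : IsChain (· ≤ ·) (s : Set (Submodule F (Fin n → F)))) (φ : Finset (Submodule F (Fin n → F)) → ℝ) :
    (∑ T ∈ maxFacesAbove F n S s, φ T) / ((maxFacesAbove F n S s).card : ℝ) =
      ex (Om s) (fun b => φ (face S b)) := by
  rw [ex_unif (Om_nonempty hch) (face S) (fun b hb b' hb' => card_fib (face S) ?_ hb hb')]
  · have e : (Om s).image (face S) = maxFacesAbove F n S s := image_face hS hs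
    have e2 : ∀ A : Finset (Finset (Submodule F (Fin n → F))), A = maxFacesAbove F n S s →
        (∑ T ∈ maxFacesAbove F n S s, φ T) / ((maxFacesAbove F n S s).card : ℝ) = ex A φ := by
      rintro A rfl; rfl
    apply e2
    convert e
  · intro h b1 b2 h12
    have key : ∀ b, face S (act h b) = (face S b).image (fun W => W.map h.1.toLinearMap) := by
      intro b
      unfold face
      rw [Finset.image_image]
      apply Finset.image_congr
      intro t _
      exact fl_act h
    rw [key, key, h12]

lemma fl_injOn {R : Finset ℕ} (hR : ∀ t ∈ R, t ≤ n) (hb : b ∈ Om s) {i j : ℕ} (hi : i ∈ R) (hj : j ∈ R)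
    (h : fl i b = fl j b) : i = j := by
  rw [← finrank_Om hb (hR i hi), h, finrank_Om hb (hR j hj)]

lemma face_sdiff {R : Finset ℕ} (hS : ∀ t ∈ S, t ≤ n)
    (hR : R = S \ s.image fun W : Submodule F (Fin n → F) => Module.finrank F W) (hb : b ∈ Om s) :
    face S b \ s = R.image fun t => fl t b := by
  ext W
  unfold face
  rw [Finset.mem_sdiff, Finset.mem_image, Finset.mem_image]
  constructor
  · rintro ⟨⟨t, ht, rfl⟩, hW⟩
    refine ⟨t, ?_, rfl⟩
    rw [hR, Finset.mem_sdiff]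
    refine ⟨ht, fun h => hW ?_⟩
    obtain ⟨W', hW', rfl⟩ := Finset.mem_image.1 h
    show fl (Module.finrank F W') b ∈ s
    rw [(mem_Om.1 hb).2 W' hW']; exact hW'
  · rintro ⟨t, ht, rfl⟩
    rw [hR, Finset.mem_sdiff] at ht
    refine ⟨⟨t, ht.1, rfl⟩, fun h => ht.2 ?_⟩
    exact Finset.mem_image.2 ⟨_, h, finrank_Om hb (hS t ht.1)⟩

/-- The typed version of a cochain. -/
noncomputable def typed {V : Type} (f : V → V → Γ) : ℕ → ℕ → V → V → Γ :=
  fun i j u v => if i < j then f u v else (f v u)⁻¹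

lemma typed_AS {V : Type} (f : V → V → Γ) : AS (typed f) := by
  intro i j u v hij
  unfold typed
  rcases lt_or_gt_of_ne hij with h | h
  · rw [if_pos h, if_neg (by omega), inv_inv]
  · rw [if_neg (by omega), if_pos h]

lemma sum_ind {κ : Type} (A : Finset κ) (p : κ → Prop) : ∑ a ∈ A, ind (p a) = ((A.filter p).card : ℝ) := by
  unfold ind; rw [Finset.sum_ite]; simp

lemma if_ind (p : Prop) [Decidable p] : (if p then (1 : ℝ) else 0) = ind p := by
  unfold ind; split_ifs <;> rfl

section counts
variable {V : Type} {R : Finset ℕ} {y : ℕ → V}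

lemma count2 (f : V → V → Γ) (g : V → Γ) :
    ∑ e ∈ (R.image y).powersetCard 2, ind (∃ u ∈ e, ∃ v ∈ e, u ≠ v ∧ f u v ≠ g u * (g v)⁻¹) ≤
      ∑ r ∈ R, ∑ r' ∈ R, ind (r ≠ r' ∧ f (y r) (y r') ≠ g (y r) * (g (y r'))⁻¹) := by
  have h1 := sum_ind ((R.image y).powersetCard 2) (fun e => ∃ u ∈ e, ∃ v ∈ e, u ≠ v ∧ f u v ≠ g u * (g v)⁻¹)
  rw [h1, ← Finset.sum_product', sum_ind (R ×ˢ R) (fun z => z.1 ≠ z.2 ∧ f (y z.1) (y z.2) ≠ g (y z.1) * (g (y z.2))⁻¹)]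
  norm_cast
  refine (Finset.card_le_card ?_).trans (Finset.card_image_le (f := fun z : ℕ × ℕ => ({y z.1, y z.2} : Finset V)))
  intro e he
  obtain ⟨he, u, hu, v, hv, huv, hbad⟩ := Finset.mem_filter.1 he
  obtain ⟨hsub, hcard⟩ := Finset.mem_powersetCard.1 he
  obtain ⟨r, hr, rfl⟩ := Finset.mem_image.1 (hsub hu)
  obtain ⟨r', hr', rfl⟩ := Finset.mem_image.1 (hsub hv)
  refine Finset.mem_image.2 ⟨(r, r'), Finset.mem_filter.2 ⟨Finset.mem_product.2 ⟨hr, hr'⟩, ?_, hbad⟩, ?_⟩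
  · rintro h; exact huv (congrArg y h)
  · apply Finset.eq_of_subset_of_card_le
    · intro z hz
      rcases Finset.mem_insert.1 hz with rfl | hz
      · exact hu
      · rw [Finset.mem_singleton.1 hz]; exact hv
    · rw [hcard, Finset.card_pair huv]

lemma count3 (hy : ∀ i ∈ R, ∀ j ∈ R, y i = y j → i = j) (f : V → V → Γ) :
    ∑ i ∈ R, ∑ j ∈ R, ∑ k ∈ R, ind (i ≠ j ∧ j ≠ k ∧ i ≠ k ∧ f (y i) (y j) * f (y j) (y k) * f (y k) (y i) ≠ 1) ≤
    27 * ∑ e ∈ (R.image y).powersetCard 3, ind (∃ u ∈ e, ∃ v ∈ e, ∃ w ∈ e, u ≠ v ∧ v ≠ w ∧ u ≠ w ∧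
              f u v * f v w * f w u ≠ 1) := by
  have h1 := sum_ind ((R.image y).powersetCard 3) (fun e => ∃ u ∈ e, ∃ v ∈ e, ∃ w ∈ e, u ≠ v ∧ v ≠ w ∧ u ≠ w ∧
              f u v * f v w * f w u ≠ 1)
  rw [h1]
  have h2 : ∑ i ∈ R, ∑ j ∈ R, ∑ k ∈ R, ind (i ≠ j ∧ j ≠ k ∧ i ≠ k ∧ f (y i) (y j) * f (y j) (y k) * f (y k) (y i) ≠ 1)
      = ∑ z ∈ R ×ˢ R ×ˢ R, ind (z.1 ≠ z.2.1 ∧ z.2.1 ≠ z.2.2 ∧ z.1 ≠ z.2.2 ∧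
        f (y z.1) (y z.2.1) * f (y z.2.1) (y z.2.2) * f (y z.2.2) (y z.1) ≠ 1) := by
    rw [Finset.sum_product]
    refine Finset.sum_congr rfl fun i _ => ?_
    rw [Finset.sum_product]
  rw [h2, sum_ind (R ×ˢ R ×ˢ R) (fun z => z.1 ≠ z.2.1 ∧ z.2.1 ≠ z.2.2 ∧ z.1 ≠ z.2.2 ∧
        f (y z.1) (y z.2.1) * f (y z.2.1) (y z.2.2) * f (y z.2.2) (y z.1) ≠ 1)]
  norm_cast
  refine Finset.card_le_mul_card_image_of_maps_to (f := fun z : ℕ × ℕ × ℕ => ({y z.1, y z.2.1, y z.2.2} : Finset V)) ?_ 27 ?_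
  · rintro ⟨i, j, k⟩ hz
    obtain ⟨hz, h12, h23, h13, hb⟩ := Finset.mem_filter.1 hz
    simp only [Finset.mem_product] at hz
    simp only at h12 h23 h13 hb
    obtain ⟨hi, hj, hk⟩ := hz
    have n12 : y i ≠ y j := fun h => h12 (hy i hi j hj h)
    have n23 : y j ≠ y k := fun h => h23 (hy j hj k hk h)
    have n13 : y i ≠ y k := fun h => h13 (hy i hi k hk h)
    refine Finset.mem_filter.2 ⟨Finset.mem_powersetCard.2 ⟨?_, ?_⟩, y i, by simp, y j, by simp, y k, by simp,
      n12, n23, n13, hb⟩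
    · intro v hv
      simp only [Finset.mem_insert, Finset.mem_singleton] at hv
      rcases hv with rfl | rfl | rfl
      · exact Finset.mem_image_of_mem y hi
      · exact Finset.mem_image_of_mem y hj
      · exact Finset.mem_image_of_mem y hk
    · exact Finset.card_eq_three.2 ⟨_, _, _, n12, n13, n23, rfl⟩
  · intro e he
    have hc := (Finset.mem_powersetCard.1 (Finset.mem_filter.1 he).1).2
    have : (e ×ˢ e ×ˢ e).card = 27 := by simp [hc]
    rw [← this]
    refine Finset.card_le_card_of_injOn (fun z => (y z.1, y z.2.1, y z.2.2)) ?_ ?_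
    · rintro ⟨i, j, k⟩ hz
      obtain ⟨_, h⟩ := Finset.mem_filter.1 (Finset.mem_coe.1 hz)
      simp only at h
      rw [← h]; simp
    · rintro ⟨i, j, k⟩ hz ⟨i', j', k'⟩ hz' heq
      have m1 := (Finset.mem_filter.1 (Finset.mem_filter.1 (Finset.mem_coe.1 hz)).1).1
      have m2 := (Finset.mem_filter.1 (Finset.mem_filter.1 (Finset.mem_coe.1 hz')).1).1
      simp only [Finset.mem_product] at m1 m2
      simp only [Prod.mk.injEq] at heq ⊢
      exact ⟨hy _ m1.1 _ m2.1 heq.1, hy _ m1.2.1 _ m2.2.1 heq.2.1, hy _ m1.2.2 _ m2.2.2 heq.2.2⟩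
end counts

lemma final_fl {l : ℝ} (hl : 0 < l) (hl2 : l ≤ 1 / (20000 * 63)) (hq : 2 ≤ l ^ 2 * Fintype.card F)
    {a c : ℕ} (ha : 0 < a) (hcn : c < n) (hac : a + 4 ≤ c)
    (hface : IsFlagFace F n (Finset.Icc a c) s) (hcard : s.card + 3 ≤ c + 1 - a)
    (f : Submodule F (Fin n → F) → Submodule F (Fin n → F) → Γ)
    (hf : ∀ U V : Submodule F (Fin n → F), U ≠ V → U ∉ s → V ∉ s →
            IsFlagFace F n (Finset.Icc a c) (insert U (insert V s)) → f U V = (f V U)⁻¹) :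
    ∃ g : Submodule F (Fin n → F) → Γ,
      1 / (27 * (51 * 50400 * 48 ^ 3)) * linkDist F n (Finset.Icc a c) s Γ f g ≤
        linkWt F n (Finset.Icc a c) s Γ f := by
  have hS : ∀ t ∈ Finset.Icc a c, t ≤ n := fun t ht => by rw [Finset.mem_Icc] at ht; omega
  obtain ⟨hch, hs⟩ := hface
  obtain ⟨R, hR⟩ : ∃ R, R = Finset.Icc a c \ s.image fun W : Submodule F (Fin n → F) => Module.finrank F W := ⟨_, rfl⟩
  have hRS : ∀ t ∈ R, t ∈ Finset.Icc a c := fun t ht => by rw [hR] at ht; exact (Finset.mem_sdiff.1 ht).1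
  have hRn : ∀ t ∈ R, t ≤ n := fun t ht => hS t (hRS t ht)
  have hm3 : 3 ≤ R.card := by
    rw [hR]
    have e1 := Finset.le_card_sdiff (s.image fun W : Submodule F (Fin n → F) => Module.finrank F W) (Finset.Icc a c)
    have e2 : (s.image fun W : Submodule F (Fin n → F) => Module.finrank F W).card ≤ s.card := Finset.card_image_le
    rw [Nat.card_Icc] at e1
    omega
  obtain ⟨g, hg⟩ := main_fl hl hl2 hq ha hcn hac hs hR hm3 (typed_AS f)
  have hty : ∀ b ∈ Om s, ∀ i ∈ R, ∀ j ∈ R, i ≠ j → typed f i j (fl i b) (fl j b) = f (fl i b) (fl j b) := by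
    intro b hb i hi j hj hij
    unfold typed
    split_ifs with h
    · rfl
    · have hsd := face_sdiff hS hR hb
      have hi' : fl i b ∈ face (Finset.Icc a c) b \ s := by
        rw [hsd]; exact Finset.mem_image_of_mem (fun t => fl t b) hi
      have hj' : fl j b ∈ face (Finset.Icc a c) b \ s := by
        rw [hsd]; exact Finset.mem_image_of_mem (fun t => fl t b) hj
      rw [Finset.mem_sdiff] at hi' hj'
      have hff := face_flag hS hb
      have hsub : insert (fl i b) (insert (fl j b) s) ⊆ face (Finset.Icc a c) b := by
        intro W hW
        rcases Finset.mem_insert.1 hW with rfl | hW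
        · exact hi'.1
        rcases Finset.mem_insert.1 hW with rfl | hW
        · exact hj'.1
        · exact subset_face hs hb hW
      exact (hf _ _ (fun h => hij (fl_injOn hRn hb hi hj h)) hi'.2 hj'.2
        ⟨hff.1.mono (by exact_mod_cast hsub), fun W hW => hff.2 W (hsub hW)⟩).symm
  set m := R.card with hm
  have hmpos : (0 : ℝ) < m := by exact_mod_cast (by omega : 0 < m)
  have hcd : ∀ b ∈ Om s, (face (Finset.Icc a c) b \ s).card = m := by
    intro b hb
    rw [face_sdiff hS hR hb, Finset.card_image_of_injOn]
    intro i hi j hj h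
    exact fl_injOn hRn hb hi hj h
  set G : Submodule F (Fin n → F) → Γ := fun W => g (Module.finrank F W) W with hG
  set W3 := ∑ i ∈ R, ∑ j ∈ R, ∑ k ∈ R, pr (Om s) (bad fl (typed f) i j k) with hW3
  have hW3nn : 0 ≤ W3 := Finset.sum_nonneg fun i _ => Finset.sum_nonneg fun j _ =>
    Finset.sum_nonneg fun k _ => pr_nonneg _
  have hc2 : (0 : ℝ) < (m.choose 2 : ℕ) := by exact_mod_cast Nat.choose_pos (by omega)
  have hc3 : (0 : ℝ) < (m.choose 3 : ℕ) := by exact_mod_cast Nat.choose_pos (by omega)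
  have hdist : linkDist F n (Finset.Icc a c) s Γ f G ≤ 1 / (m.choose 2 : ℕ) *
      ∑ r ∈ R, ∑ r' ∈ R, pr (Om s) (fun ω => r ≠ r' ∧ ¬ edg fl (typed f) g r r' ω) := by
    unfold linkDist
    rw [avg_face hS hs hch]
    have : ∑ r ∈ R, ∑ r' ∈ R, pr (Om s) (fun ω => r ≠ r' ∧ ¬ edg fl (typed f) g r r' ω) =
        ex (Om s) (fun ω => ∑ r ∈ R, ∑ r' ∈ R, ind (r ≠ r' ∧ ¬ edg fl (typed f) g r r' ω)) := by
      rw [ex_sum]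
      refine Finset.sum_congr rfl fun r _ => ?_
      rw [ex_sum]; rfl
    rw [this, ← ex_mul_left]
    apply ex_mono
    intro b hb
    simp only [if_ind]
    rw [Finset.card_powersetCard, hcd b hb, face_sdiff hS hR hb, div_eq_inv_mul, one_div]
    refine mul_le_mul_of_nonneg_left ((count2 f G).trans (le_of_eq ?_)) (by positivity)
    refine Finset.sum_congr rfl fun r hr => Finset.sum_congr rfl fun r' hr' => ?_
    congr 1
    apply propext
    refine and_congr_right fun hne => ?_
    unfold edg
    rw [hty b hb r hr r' hr' hne]
    simp only [hG, finrank_Om hb (hRn r hr), finrank_Om hb (hRn r' hr')]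
  have hwt : 1 / (27 * (m.choose 3 : ℕ)) * W3 ≤ linkWt F n (Finset.Icc a c) s Γ f := by
    unfold linkWt
    rw [avg_face hS hs hch]
    have : W3 = ex (Om s) (fun ω => ∑ i ∈ R, ∑ j ∈ R, ∑ k ∈ R, ind (bad fl (typed f) i j k ω)) := by
      rw [ex_sum]
      refine Finset.sum_congr rfl fun i _ => ?_
      rw [ex_sum]
      refine Finset.sum_congr rfl fun j _ => ?_
      rw [ex_sum]; rfl
    rw [this, ← ex_mul_left]
    apply ex_mono
    intro b hb
    simp only [if_ind]
    rw [Finset.card_powersetCard, hcd b hb, face_sdiff hS hR hb]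
    have h3 := count3 (R := R) (y := fun t => fl t b) (fun i hi j hj h => fl_injOn hRn hb hi hj h) f
    have e : ∑ i ∈ R, ∑ j ∈ R, ∑ k ∈ R, ind (bad fl (typed f) i j k b) = ∑ i ∈ R, ∑ j ∈ R, ∑ k ∈ R,
        ind (i ≠ j ∧ j ≠ k ∧ i ≠ k ∧ f (fl i b) (fl j b) * f (fl j b) (fl k b) * f (fl k b) (fl i b) ≠ 1) := by
      refine Finset.sum_congr rfl fun i hi => Finset.sum_congr rfl fun j hj => Finset.sum_congr rfl fun k hk => ?_
      congr 1
      apply propext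
      unfold bad tri
      refine and_congr_right fun h1 => and_congr_right fun h2 => and_congr_right fun h3 => ?_
      rw [hty b hb i hi j hj h1, hty b hb j hj k hk h2, hty b hb k hk i hi h3.symm]
    rw [e]
    have e27 : (1 : ℝ) / (27 * (m.choose 3 : ℕ)) = ((m.choose 3 : ℕ) : ℝ)⁻¹ * (1 / 27) := by
      rw [one_div, mul_inv]; ring
    rw [e27, mul_assoc, le_div_iff₀ hc3, mul_comm, ← mul_assoc, mul_inv_cancel₀ hc3.ne', one_mul]
    refine (mul_le_mul_of_nonneg_left h3 (by norm_num)).trans (le_of_eq ?_)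
    rw [← mul_assoc, show (1 / 27 : ℝ) * 27 = 1 by norm_num, one_mul]
    congr!
  refine ⟨G, ?_⟩
  have hch3 : (m.choose 3 : ℝ) * 3 ≤ (m.choose 2 : ℕ) * m := by
    have := Nat.choose_succ_right_eq m 2
    have h2 : m.choose 3 * 3 ≤ m.choose 2 * m := by
      rw [show (3 : ℕ) = 2 + 1 from rfl, this]; exact Nat.mul_le_mul_left _ (Nat.sub_le _ _)
    exact_mod_cast h2
  have hd2 : linkDist F n (Finset.Icc a c) s Γ f G ≤ 1 / (m.choose 2 : ℕ) * (51 * 50400 * 48 ^ 3 / m * W3) :=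
    hdist.trans (mul_le_mul_of_nonneg_left hg (by positivity))
  refine le_trans (mul_le_mul_of_nonneg_left hd2 (by positivity)) (le_trans ?_ hwt)
  have e1 : (1 : ℝ) / (27 * (51 * 50400 * 48 ^ 3)) * (1 / (m.choose 2 : ℕ) * (51 * 50400 * 48 ^ 3 / m * W3)) =
      1 / (27 * ((m.choose 2 : ℕ) * m)) * W3 := by
    field_simp
  rw [e1]
  refine mul_le_mul_of_nonneg_right ?_ hW3nn
  apply one_div_le_one_div_of_le (by positivity)
  have : (0 : ℝ) < (m.choose 3 : ℕ) := hc3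
  nlinarith
end final
end CB

/-- There are a threshold `q₀` and a constant `c > 0` such that for every
group `Γ`, all integers `d > k ≥ 2`, every prime power `q ≥ q₀`, and every (possibly empty)
face `s` of `B(2d, S_k, q)` of codimension at least `3`, every `Γ`-valued 1-cochain `f` on
the link of `s` admits `g` with `c · dist(f, δg) ≤ wt(δf)`.  In particular (with `s = ∅`)
the complex `B(2d, S_k, q)` itself is a 1-coboundary expander with expansion at least `c`
with respect to every group. -/
theorem stmt_10 :
    ∃ (q₀ : ℕ) (c : ℝ), 0 < c ∧
      ∀ (Γ : Type) [Group Γ], ∀ d k : ℕ, k < d → 2 ≤ k →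
      ∀ q : ℕ, q₀ ≤ q → IsPrimePow q →
      ∀ (F : Type) [Field F] [Fintype F], Fintype.card F = q →
      ∀ s : Finset (Submodule F (Fin (2 * d) → F)),
        IsFlagFace F (2 * d) (Finset.Icc (d - k) (d + k)) s →
        s.card + 3 ≤ 2 * k + 1 →
        ∀ f : Submodule F (Fin (2 * d) → F) → Submodule F (Fin (2 * d) → F) → Γ,
          (∀ U V : Submodule F (Fin (2 * d) → F), U ≠ V → U ∉ s → V ∉ s →
            IsFlagFace F (2 * d) (Finset.Icc (d - k) (d + k)) (insert U (insert V s)) →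
            f U V = (f V U)⁻¹) →
          ∃ g : Submodule F (Fin (2 * d) → F) → Γ,
            c * linkDist F (2 * d) (Finset.Icc (d - k) (d + k)) s Γ f g ≤
              linkWt F (2 * d) (Finset.Icc (d - k) (d + k)) s Γ f := by
  refine ⟨2 * 1260000 ^ 2, 1 / (27 * (51 * 50400 * 48 ^ 3)), by positivity, ?_⟩
  intro Γ _ d k hkd hk q hq _ F _ _ hF s hs hcard f hf
  have hq' : (2 * 1260000 ^ 2 : ℝ) ≤ (Fintype.card F : ℝ) := by rw [hF]; exact_mod_cast hq
  refine CB.final_fl (l := 1 / 1260000) (by norm_num) (by norm_num) ?_ (by omega) (by omega) (by omega) hs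
    (by omega) f hf
  rw [one_div, inv_pow, ← div_eq_inv_mul, le_div_iff₀ (by positivity)]
  exact hq'
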